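/- Let A and B be C*-algebras and let J be a closed two-sided ideal of B. Then A ⊗̂ J = { x ∈ A ⊗̂ B : R_φ(x) ∈ J for all φ ∈ A* }; that is, the slice map conjecture holds for ideals with respect to the operator space projective tensor norm. -/

import Mathlib

open scoped TensorProduct
open Pointwise

universe u

noncomputable section

/-- A C⋆-norm on a complex `*`-algebra.  On a matrix algebra over a C⋆-algebra such a
norm is unique, namely the canonical C⋆-norm. -/
structure IsCStarNorm {M : Type*} [NonUnitalRing M] [StarRing M] [Module ℂ M]
    (N : M → ℝ) : Prop where
  add_le : ∀ x y, N (x + y) ≤ N x + N y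
  smul_eq : ∀ (c : ℂ) (x : M), N (c • x) = ‖c‖ * N x
  eq_zero_of : ∀ x, N x = 0 → x = 0
  mul_le : ∀ x y, N (x * y) ≤ N x * N y
  star_mul_self : ∀ x, N (star x * x) = N x * N x

/-- The operator space projective tensor norm `‖·‖_∧` on the algebraic tensor product
`A ⊗ B`, relative to given families of matrix norms on `A` and `B`:
`‖u‖_∧ = inf { ‖α‖ ‖v‖ ‖w‖ ‖β‖ : u = α (v ⊗ w) β }` where `v ∈ M_p(A)`, `w ∈ M_q(B)`,
`α ∈ M_{1,pq}(ℂ)` and `β ∈ M_{pq,1}(ℂ)` (row and column vectors carrying the Euclidean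
norm, which is their norm as scalar matrices). -/
noncomputable def osProjNorm {A B : Type u}
    [AddCommGroup A] [Module ℂ A] [AddCommGroup B] [Module ℂ B]
    (NA : ∀ p : ℕ, Matrix (Fin p) (Fin p) A → ℝ)
    (NB : ∀ q : ℕ, Matrix (Fin q) (Fin q) B → ℝ) (u : A ⊗[ℂ] B) : ℝ :=
  sInf { r : ℝ | ∃ (p q : ℕ) (α : Fin p × Fin q → ℂ) (v : Matrix (Fin p) (Fin p) A)
      (w : Matrix (Fin q) (Fin q) B) (β : Fin p × Fin q → ℂ),
      u = ∑ ik : Fin p × Fin q, ∑ jl : Fin p × Fin q,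
            (α ik * β jl) • (v ik.1 jl.1 ⊗ₜ[ℂ] w ik.2 jl.2) ∧
      r = Real.sqrt (∑ ik, ‖α ik‖ ^ 2) * NA p v * NB q w *
            Real.sqrt (∑ jl, ‖β jl‖ ^ 2) }

/-- `X` is a completion of the algebraic tensor product `A ⊗ B` with respect to the
norm `ν`, via the (necessarily isometric) dense embedding `ι`, and the multiplication and
involution of `X` are the canonical ones induced from `A` and `B`.  Applied with
`ν = osProjNorm NA NB` (for the canonical matrix C⋆-norms `NA`, `NB`) this characterizes
the Banach `*`-algebra `A ⊗̂ B` (the operator space projective tensor product) up to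
isometric `*`-isomorphism; applied with `ν = bsProjNorm` it characterizes the Banach
space projective tensor product `A ⊗_γ B`. -/
structure IsTensorCompletion {A B : Type u} [NonUnitalRing A] [StarRing A] [Module ℂ A]
    [NonUnitalRing B] [StarRing B] [Module ℂ B] (ν : A ⊗[ℂ] B → ℝ)
    (X : Type u) [NonUnitalNormedRing X] [StarRing X] [NormedSpace ℂ X] [CompleteSpace X]
    (ι : A ⊗[ℂ] B →ₗ[ℂ] X) : Prop where
  norm_eq : ∀ u, ‖ι u‖ = ν u
  dense : DenseRange ι
  mul_tmul : ∀ (a c : A) (b d : B),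
    ι (a ⊗ₜ[ℂ] b) * ι (c ⊗ₜ[ℂ] d) = ι ((a * c) ⊗ₜ[ℂ] (b * d))
  star_tmul : ∀ (a : A) (b : B), star (ι (a ⊗ₜ[ℂ] b)) = ι (star a ⊗ₜ[ℂ] star b)

/-- The product ideal `S ⊗̂ T`: the closure in `X` (a completion of `A ⊗ B`) of the span of
elementary tensors `a ⊗ b` with `a ∈ S`, `b ∈ T`. -/
def tensorIdeal {A B : Type u} [NonUnitalRing A] [StarRing A] [Module ℂ A]
    [NonUnitalRing B] [StarRing B] [Module ℂ B]
    {X : Type u} [NonUnitalNormedRing X] [StarRing X] [NormedSpace ℂ X] [CompleteSpace X]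
    (ι : A ⊗[ℂ] B →ₗ[ℂ] X) (S : Set A) (T : Set B) : Set X :=
  closure (ι '' (Submodule.span ℂ (Set.image2 (fun a b => a ⊗ₜ[ℂ] b) S T)))

/-- A closed prime (two-sided) ideal of a Banach algebra: a proper closed two-sided ideal `K`
such that whenever the product of two closed two-sided ideals is contained in `K`, one of them
is contained in `K`. -/
def IsClosedPrimeIdeal {Y : Type u} [NonUnitalNormedRing Y] (K : TwoSidedIdeal Y) : Prop :=
  IsClosed (K : Set Y) ∧ (K : Set Y) ≠ Set.univ ∧
    ∀ I J : TwoSidedIdeal Y, IsClosed (I : Set Y) → IsClosed (J : Set Y) →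
      (∀ x ∈ I, ∀ y ∈ J, x * y ∈ K) → (I : Set Y) ⊆ (K : Set Y) ∨ (J : Set Y) ⊆ (K : Set Y)

/-- An irreducible continuous `*`-representation of a Banach `*`-algebra `Y` on a complex
Hilbert space. -/
structure IrreducibleRepOn (Y : Type u)
    [NonUnitalNormedRing Y] [StarRing Y] [NormedSpace ℂ Y] where
  H : Type u
  [normH : NormedAddCommGroup H]
  [ipsH : InnerProductSpace ℂ H]
  [csH : CompleteSpace H]
  π : Y →⋆ₙₐ[ℂ] (H →L[ℂ] H)
  continuous : Continuous π
  nonzero : ∃ y, π y ≠ 0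
  irreducible : ∀ S : Submodule ℂ H, IsClosed (S : Set H) →
    (∀ y : Y, ∀ v ∈ S, π y v ∈ S) → S = ⊥ ∨ S = ⊤

/-- A primitive ideal: the kernel of an irreducible `*`-representation. -/
def IsPrimitiveIdeal {Y : Type u} [NonUnitalNormedRing Y] [StarRing Y] [NormedSpace ℂ Y]
    (K : TwoSidedIdeal Y) : Prop :=
  ∃ ρ : IrreducibleRepOn Y, ∀ y, y ∈ K ↔ ρ.π y = 0

/-- A subset `K` of a ring is modular (as an ideal) if there is a relative unit `e`
with `x * e - x ∈ K` and `e * x - x ∈ K` for every `x`. -/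
def IsModularIdealSet {Y : Type u} [NonUnitalRing Y] (K : Set Y) : Prop :=
  ∃ e : Y, ∀ x : Y, x * e - x ∈ K ∧ e * x - x ∈ K

/-- A maximal modular (two-sided) ideal: a modular ideal which is proper and maximal among
proper two-sided ideals. -/
def IsMaximalModularIdeal {Y : Type u} [NonUnitalRing Y] (K : TwoSidedIdeal Y) : Prop :=
  IsModularIdealSet (K : Set Y) ∧ (K : Set Y) ≠ Set.univ ∧
    ∀ L : TwoSidedIdeal Y, (K : Set Y) ⊆ (L : Set Y) →
      (L : Set Y) = (K : Set Y) ∨ (L : Set Y) = Set.univ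

/-- The operator norm of a `p × p` matrix of bounded operators on a Hilbert space `H`,
viewed as an operator on the `ℓ²`-direct sum `H ⊕ ⋯ ⊕ H`. -/
noncomputable def opMatrixNorm {H : Type u} [NormedAddCommGroup H] [InnerProductSpace ℂ H]
    {p : ℕ} (T : Matrix (Fin p) (Fin p) (H →L[ℂ] H)) : ℝ :=
  sSup { r : ℝ | ∃ x : Fin p → H, (∑ i, ‖x i‖ ^ 2) ≤ 1 ∧
      r = Real.sqrt (∑ i, ‖∑ j, (T i j) (x j)‖ ^ 2) }

/-- An operator algebra structure on a Banach algebra `Y`: a bicontinuous algebra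
homomorphism of `Y` into the bounded operators on some Hilbert space. -/
structure OperatorAlgebraEmbedding (Y : Type u) [NonUnitalNormedRing Y] [NormedSpace ℂ Y] where
  H : Type u
  [normH : NormedAddCommGroup H]
  [ipsH : InnerProductSpace ℂ H]
  [csH : CompleteSpace H]
  ρ : Y →ₙₐ[ℂ] (H →L[ℂ] H)
  c : ℝ
  C : ℝ
  c_pos : 0 < c
  lower : ∀ y, c * ‖y‖ ≤ ‖ρ y‖
  upper : ∀ y, ‖ρ y‖ ≤ C * ‖y‖

/-- The matrix norms on `Y` induced by an operator algebra embedding, giving `Y` its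
operator space structure: the norm of `v ∈ M_p(Y)` is the operator norm of the matrix
of operators obtained by applying the embedding entrywise. -/
noncomputable def OperatorAlgebraEmbedding.matrixNorm {Y : Type u}
    [NonUnitalNormedRing Y] [NormedSpace ℂ Y] (e : OperatorAlgebraEmbedding Y)
    (p : ℕ) (v : Matrix (Fin p) (Fin p) Y) : ℝ :=
  letI := e.normH; letI := e.ipsH
  opMatrixNorm (v.map e.ρ)

/-- The Banach space projective tensor norm `‖·‖_γ` on the algebraic tensor product. -/
noncomputable def bsProjNorm {A B : Type u} [NonUnitalNormedRing A] [NormedSpace ℂ A]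
    [NonUnitalNormedRing B] [NormedSpace ℂ B] (u : A ⊗[ℂ] B) : ℝ :=
  sInf { r : ℝ | ∃ (n : ℕ) (a : Fin n → A) (b : Fin n → B),
      u = ∑ i, a i ⊗ₜ[ℂ] b i ∧ r = ∑ i, ‖a i‖ * ‖b i‖ }

/-- A C⋆-algebra `A` is subhomogeneous if there is `n : ℕ` bounding the (finite)
dimensions of all its irreducible `*`-representations. -/
def IsSubhomogeneous (A : Type u) [NonUnitalCStarAlgebra A] : Prop :=
  ∃ n : ℕ, ∀ ρ : IrreducibleRepOn A,
    letI := ρ.normH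
    letI := ρ.ipsH
    FiniteDimensional ℂ ρ.H ∧ Module.finrank ℂ ρ.H ≤ n


namespace SliceMap

namespace CN
variable {M : Type*} [NonUnitalRing M] [StarRing M] [Module ℂ M] {N : M → ℝ}

lemma zero (h : IsCStarNorm N) : N 0 = 0 := by
  have := h.smul_eq 0 0; simpa using this

lemma neg (h : IsCStarNorm N) (x : M) : N (-x) = N x := by
  have := h.smul_eq (-1) x; simpa using this

lemma nonneg (h : IsCStarNorm N) (x : M) : 0 ≤ N x := by
  have := h.add_le x (-x)
  rw [neg h, add_neg_cancel, zero h] at this; linarith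

lemma star_le (h : IsCStarNorm N) (x : M) : N x ≤ N (star x) := by
  have h1 := h.star_mul_self x
  have h2 := h.mul_le (star x) x
  have h3 := nonneg h x
  have h4 := nonneg h (star x)
  by_contra hc
  push Not at hc
  have : 0 < N x := lt_of_le_of_lt h4 hc
  nlinarith

lemma star_eq (h : IsCStarNorm N) (x : M) : N (star x) = N x :=
  le_antisymm (by simpa using star_le h (star x)) (star_le h x)

lemma mul_star_self (h : IsCStarNorm N) (x : M) : N (x * star x) = N x * N x := by
  have := h.star_mul_self (star x)
  rwa [star_star, star_eq h] at this

lemma eq_of_star_mul (h : IsCStarNorm N) {x y : M} (e : star x * x = star y * y) : N x = N y := by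
  have h1 := h.star_mul_self x
  rw [e, h.star_mul_self] at h1
  nlinarith [nonneg h x, nonneg h y, mul_self_eq_mul_self_iff.mp h1]

lemma le_of_star_mul (h : IsCStarNorm N) {x : M} {c : ℝ} (hc : 0 ≤ c)
    (e : N (star x * x) ≤ c * c) : N x ≤ c := by
  rw [h.star_mul_self] at e
  exact abs_le_of_sq_le_sq' (by nlinarith) hc |>.2
end CN

section
variable {A : Type*} [NonUnitalCStarAlgebra A] {N : A → ℝ}

lemma cn_sa_mul_le (hN : IsCStarNorm N) {h : A} (hs : IsSelfAdjoint h) (h1 : ‖h‖ ≤ 1) (a : A) :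
    N (h * a) ≤ N a := by
  set f : ℝ → ℝ := fun x => 1 - Real.sqrt (1 - x^2) with hf
  have hfc : Continuous f := by fun_prop
  have hf0 : f 0 = 0 := by simp [hf]
  set κ := cfcₙ f h with hκ
  have hκs : star κ = κ := (cfcₙ_predicate f h : IsSelfAdjoint κ)
  have hspec : ∀ x ∈ quasispectrum ℝ h, x^2 ≤ 1 := by
    intro x hx
    have := NonUnitalIsometricContinuousFunctionalCalculus.norm_quasispectrum_le h hx hs
    rw [Real.norm_eq_abs] at this
    exact (sq_le_one_iff_abs_le_one x).2 (this.trans h1)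
  have key : κ * κ - κ - κ + h * h = 0 := by
    have e1 : κ * κ = cfcₙ (fun x => f x * f x) h :=
      (cfcₙ_mul f f h hfc.continuousOn hf0 hfc.continuousOn hf0).symm
    have e2 : h * h = cfcₙ (fun x : ℝ => x * x) h := by
      conv_lhs => rw [← cfcₙ_id' ℝ h]
      rw [cfcₙ_mul (fun x : ℝ => x) (fun x : ℝ => x) h]
    rw [e1, e2, hκ, ← cfcₙ_sub _ _ h, ← cfcₙ_sub _ _ h, ← cfcₙ_add _ _ h]
    · rw [← cfcₙ_zero ℝ h]
      apply cfcₙ_congr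
      intro x hx
      have h2 := hspec x hx
      have h3 := Real.sq_sqrt (show 0 ≤ 1 - x^2 by linarith)
      simp only [hf]; simp; nlinarith
    all_goals first | (simp [hf]; done) | fun_prop
  have hs' : star h = h := hs
  have ex : ∀ z : ℂ, z * z = -1 → star z = -z → N (a - κ * a + z • (h * a)) = N a := by
    intro z hz hz'
    apply CN.eq_of_star_mul hN
    have : star (a - κ * a + z • (h * a)) * (a - κ * a + z • (h * a)) =
        star a * a + star a * ((κ * κ - κ - κ + h * h) * a) + z • (star a * ((κ * h - h * κ) * a))
          - (z * z + 1) • (star a * (h * h * a)) - z • (star a * ((κ * h - h * κ) * a)) 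
          + z • (star a * ((h * κ - κ * h) * a)):= by
      simp only [star_add, star_sub, star_mul, star_smul, hκs, hs', hz']
      simp only [mul_add, add_mul, mul_sub, sub_mul, smul_mul_assoc, mul_smul_comm, smul_add, smul_sub, mul_assoc, neg_mul, neg_smul, smul_neg, add_smul, mul_smul, one_smul]
      abel
    have hcomm : h * κ = κ * h := by
      have := cfcₙ_commute_cfcₙ (fun x => x) f h
      rw [cfcₙ_id' ℝ h] at this
      exact this
    rw [this, key, hz, hcomm]; simp
  have p1 := ex Complex.I (by simp) (by simp)
  have p2 := ex (-Complex.I) (by simp) (by simp)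
  have e : (2 * Complex.I) • (h * a) = (a - κ * a + Complex.I • (h * a)) + -(a - κ * a + (-Complex.I) • (h * a)) := by
    simp only [neg_smul, mul_smul, two_smul]; abel
  have := hN.smul_eq (2 * Complex.I) (h * a)
  rw [e] at this
  have h5 := hN.add_le (a - κ * a + Complex.I • (h * a)) (-(a - κ * a + (-Complex.I) • (h * a)))
  rw [CN.neg hN, p1, p2, this] at h5
  simp at h5
  linarith

lemma cn_le_norm (hN : IsCStarNorm N) (x : A) : N x ≤ ‖x‖ := by
  have sa1 : ∀ h : A, IsSelfAdjoint h → ‖h‖ ≤ 1 → N h ≤ 1 := by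
    intro h hs h1
    have := cn_sa_mul_le hN hs h1 h
    have e := hN.star_mul_self h
    rw [hs.star_eq] at e
    rw [e] at this
    nlinarith [CN.nonneg hN h]
  have sa : ∀ h : A, IsSelfAdjoint h → N h ≤ ‖h‖ := by
    intro h hs
    by_cases h0 : h = 0
    · simp [h0, CN.zero hN]
    have hp : 0 < ‖h‖ := norm_pos_iff.2 h0
    have hs2 : IsSelfAdjoint (((‖h‖⁻¹ : ℝ) : ℂ) • h) := by
      rw [isSelfAdjoint_iff, star_smul, hs.star_eq]; simp
    have := sa1 _ hs2 (by rw [norm_smul]; simp [hp.ne'])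
    rw [hN.smul_eq] at this
    simp only [Complex.norm_real, norm_inv, norm_norm] at this
    rwa [inv_mul_le_iff₀ hp, mul_one] at this
  apply CN.le_of_star_mul hN (norm_nonneg _)
  rw [← CStarRing.norm_star_mul_self]
  exact sa _ (IsSelfAdjoint.star_mul_self x)

lemma norm_le_cn (hN : IsCStarNorm N) (x : A) : ‖x‖ ≤ N x := by
  have pos : ∀ h : A, IsSelfAdjoint h → (∀ x ∈ quasispectrum ℝ h, 0 ≤ x) → ‖h‖ ≤ N h := by
    intro h hs hq
    by_contra hc
    push Not at hc
    obtain ⟨s, hs1, hs2⟩ := exists_between hc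
    have hs0 : 0 < s := lt_of_le_of_lt (CN.nonneg hN h) hs1
    set k : ℝ → ℝ := fun x => max (x - s) 0
    set m : ℝ → ℝ := fun x => x / (max x s)^2
    have hk : Continuous k := by fun_prop
    have hm : Continuous m := by
      apply Continuous.div continuous_id (by fun_prop)
      intro x; have : 0 < max x s := lt_max_of_lt_right hs0
      positivity
    have hk0 : k 0 = 0 := by simp [k, hs0.le]
    have hm0 : m 0 = 0 := by simp [m]
    set K := cfcₙ k h
    have e : K = cfcₙ m h * (h * K) := by
      conv_rhs => rw [← cfcₙ_id' ℝ h, cfcₙ_id' ℝ h]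
      have : h * K = cfcₙ (fun x => x * k x) h := by
        rw [cfcₙ_mul (fun x => x) k h, cfcₙ_id' ℝ h]
      rw [this, ← cfcₙ_mul m _ h hm.continuousOn hm0]
      apply cfcₙ_congr
      intro x hx
      simp only [k, m]
      rcases le_total x s with h | h
      · simp [h]
      · have : 0 < x := by linarith
        rw [max_eq_left h]; field_simp
    have hKne : K ≠ 0 := by
      intro h0
      have : h = cfcₙ (fun x => min x s) h := by
        have e2 : cfcₙ (fun x => min x s + k x) h = h := by
          conv_rhs => rw [← cfcₙ_id' ℝ h]
          apply cfcₙ_congr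
          intro x hx
          simp only [k]
          rcases le_total x s with h | h <;> simp [h]
        rw [cfcₙ_add _ k h (by fun_prop) (by simp [hs0.le]) hk.continuousOn hk0] at e2
        change _ + K = h at e2
        rw [h0, add_zero] at e2
        exact e2.symm
      have : ‖h‖ ≤ s := by
        rw [this]
        apply norm_cfcₙ_le
        intro x hx
        rw [Real.norm_eq_abs, abs_of_nonneg (le_min (hq x hx) hs0.le)]
        exact min_le_right _ _
      linarith
    have hmn : ‖cfcₙ m h‖ ≤ s⁻¹ := by
      apply norm_cfcₙ_le
      intro x hx
      have := hq x hx
      simp only [m]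
      rw [Real.norm_eq_abs, abs_of_nonneg (by positivity)]
      rcases le_total x s with h | h
      · rw [max_eq_right h, inv_eq_one_div, div_le_div_iff₀ (by positivity) hs0]; nlinarith
      · rw [max_eq_left h, inv_eq_one_div, div_le_div_iff₀ (by nlinarith) hs0]; nlinarith
    have hKp : 0 < N K := lt_of_le_of_ne (CN.nonneg hN _) (fun h => hKne (hN.eq_zero_of _ h.symm))
    have h1 : N K ≤ s⁻¹ * (N h * N K) := by
      conv_lhs => rw [e]
      refine (hN.mul_le _ _).trans ?_
      gcongr
      · exact CN.nonneg hN _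
      · exact (cn_le_norm hN _).trans hmn
      · exact hN.mul_le _ _
    have : s * N K ≤ N h * N K := by
      rw [inv_mul_eq_div, le_div_iff₀ hs0] at h1; linarith
    have := le_of_mul_le_mul_right this hKp
    linarith
  have : ‖star x * x‖ ≤ N (star x * x) := by
    apply pos _ (IsSelfAdjoint.star_mul_self x)
    let _ := CStarAlgebra.spectralOrder A
    let _ := CStarAlgebra.spectralOrderedRing A
    intro y hy
    exact quasispectrum_nonneg_of_nonneg _ (star_mul_self_nonneg x) y hy
  rw [CStarRing.norm_star_mul_self, hN.star_mul_self] at this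
  exact abs_le_of_sq_le_sq' (by nlinarith) (CN.nonneg hN _) |>.2

theorem cn_eq_norm (hN : IsCStarNorm N) (x : A) : N x = ‖x‖ :=
  le_antisymm (cn_le_norm hN x) (norm_le_cn hN x)

end
end SliceMap

namespace SliceMap

section
variable {A : Type*} [NonUnitalCStarAlgebra A] {n : Type*} [Fintype n] [DecidableEq n]
  {N : Matrix n n A → ℝ}

lemma cn_embed (hN : IsCStarNorm N) (c : n → ℂ) (hc : ∑ i, star (c i) * c i = 1) (a : A) :
    N (Matrix.of fun i i' => (star (c i) * c i') • a) = ‖a‖ := by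
  refine cn_eq_norm (N := fun a => N (Matrix.of fun i i' => (star (c i) * c i') • a)) ?_ a
  have hmul : ∀ x y : A, (Matrix.of fun i i' => (star (c i) * c i') • (x * y)) = 
      (Matrix.of fun i i' => (star (c i) * c i') • x) * (Matrix.of fun i i' => (star (c i) * c i') • y) := by
    intro x y
    ext i j
    simp only [Matrix.mul_apply, Matrix.of_apply, smul_mul_smul_comm]
    rw [← Finset.sum_smul]
    congr 1
    calc star (c i) * c j = star (c i) * c j * ∑ k, star (c k) * c k := by rw [hc, mul_one]
      _ = _ := by rw [Finset.mul_sum]; apply Finset.sum_congr rfl; intros; ring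
  have hstar : ∀ x : A, (Matrix.of fun i i' => (star (c i) * c i') • star x) = 
      star (Matrix.of fun i i' => (star (c i) * c i') • x) := by
    intro x
    ext i j
    simp only [Matrix.star_apply, Matrix.of_apply, star_smul, star_mul', star_star, mul_comm]
  constructor
  · intro x y
    convert hN.add_le _ _ using 2
    ext i j; simp
  · intro z x
    convert hN.smul_eq z _ using 2
    ext i j; simp [smul_smul, mul_comm]
  · intro x hx
    have h0 := hN.eq_zero_of _ hx
    have : ∑ i, (star (c i) * c i) • x = 0 := by
      apply Finset.sum_eq_zero
      intro i _
      have := congrFun (congrFun h0 i) i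
      simpa using this
    rwa [← Finset.sum_smul, hc, one_smul] at this
  · intro x y
    rw [hmul]; exact hN.mul_le _ _
  · intro x
    rw [hmul, hstar]; exact hN.star_mul_self _

lemma cn_diag_le (hN : IsCStarNorm N) (a : A) : N (Matrix.diagonal fun _ => a) ≤ ‖a‖ := by
  cases isEmpty_or_nonempty n
  · have : (Matrix.diagonal fun _ : n => a) = 0 := by ext i; exact isEmptyElim i
    rw [this, CN.zero hN]; exact norm_nonneg _
  refine (cn_eq_norm (N := fun a => N (Matrix.diagonal fun _ => a)) ?_ a).le
  constructor
  · intro x y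
    convert hN.add_le _ _ using 2
    simp [Matrix.diagonal_add]
  · intro z x
    convert hN.smul_eq z _ using 2
    ext i j; by_cases h : i = j <;> simp [Matrix.diagonal_apply, h]
  · intro x hx
    have h0 := hN.eq_zero_of _ hx
    obtain ⟨i⟩ := ‹Nonempty n›
    have := congrFun (congrFun h0 i) i
    simpa using this
  · intro x y
    convert hN.mul_le _ _ using 2
    simp
  · intro x
    rw [← hN.star_mul_self]
    congr 1
    rw [Matrix.star_eq_conjTranspose, Matrix.diagonal_conjTranspose]; simp

lemma cn_row (hN : IsCStarNorm N) (c : n → ℂ) (hc : ∑ i, star (c i) * c i = 1) (v : Matrix n n A) :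
    ‖∑ j, (∑ i, c i • v i j) * star (∑ i, c i • v i j)‖ ≤ N v * N v := by
  set ζ : n → A := fun j => ∑ i, c i • v i j with hζ
  set qv : Matrix n n A := Matrix.of fun i j => star (c i) • ζ j with hqv
  have h1 : N ((2:ℂ) • qv - v) = N v := by
    apply CN.eq_of_star_mul hN
    ext j l
    simp only [Matrix.mul_apply, Matrix.star_apply, Matrix.sub_apply, Matrix.smul_apply, hqv, Matrix.of_apply,
      star_sub, star_smul, star_star, sub_mul, mul_sub, Finset.sum_sub_distrib, smul_mul_smul_comm, smul_smul]
    have e1 : ∑ x, (star 2 * c x * (2 * star (c x))) • (star (ζ j) * ζ l) = (4:ℂ) • (star (ζ j) * ζ l) := by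
      rw [← Finset.sum_smul]; congr 1
      calc _ = 4 * ∑ i, star (c i) * c i := by
            rw [Finset.mul_sum]; apply Finset.sum_congr rfl; intros; simp; ring
        _ = 4 := by rw [hc, mul_one]
    have e2 : ∑ x, (star 2 * c x) • star (ζ j) * v x l = (2:ℂ) • (star (ζ j) * ζ l) := by
      rw [hζ, Finset.mul_sum, Finset.smul_sum]; apply Finset.sum_congr rfl; intros
      simp [smul_mul_assoc, mul_smul_comm, smul_smul]
    have e3 : ∑ x, star (v x j) * (2 * star (c x)) • ζ l = (2:ℂ) • (star (ζ j) * ζ l) := by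
      conv_rhs => rw [show ζ j = ∑ i, c i • v i j from rfl, star_sum, Finset.sum_mul, Finset.smul_sum]
      apply Finset.sum_congr rfl; intros
      simp [smul_mul_assoc, mul_smul_comm, smul_smul]
    try simp only [star_smul, star_star] at *
    rw [e1, e2, e3, show (4:ℂ) = 2 + 2 by norm_num, add_smul]; abel
  have h2 : N qv ≤ N v := by
    have e : (2:ℂ) • qv = ((2:ℂ) • qv - v) + v := by abel
    have := hN.add_le ((2:ℂ) • qv - v) v
    rw [← e, hN.smul_eq, h1] at this
    simp at this; linarith
  have h3 : qv * star qv = Matrix.of fun i i' => (star (c i) * c i') • ∑ j, ζ j * star (ζ j) := by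
    ext i j
    simp [Matrix.mul_apply, hqv, Matrix.star_apply, Finset.smul_sum, smul_mul_smul_comm]
  rw [← cn_embed hN c hc, ← h3, CN.mul_star_self hN]
  have := CN.nonneg hN qv
  gcongr
  exact CN.nonneg hN _

lemma cn_col (hN : IsCStarNorm N) (c : n → ℂ) (hc : ∑ i, star (c i) * c i = 1) (v : Matrix n n A) :
    ‖∑ i, star (∑ j, c j • v i j) * (∑ j, c j • v i j)‖ ≤ N v * N v := by
  have := cn_row hN (fun i => star (c i)) (by rw [← hc]; simp [mul_comm]) (star v)
  rw [CN.star_eq hN] at this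
  convert this using 3
  simp [star_sum, Matrix.star_apply]
end
end SliceMap

namespace SliceMap

section V
variable {K L : Type*} [TopologicalSpace K] [TopologicalSpace L]

def csqrt (f : C(K, ℝ)) : C(K, ℝ) := ⟨fun x => Real.sqrt (f x), by fun_prop⟩
@[simp] lemma csqrt_apply (f : C(K, ℝ)) (x : K) : csqrt f x = Real.sqrt (f x) := rfl

structure VH (Gr Gi : C(K, ℝ) →ₗ[ℝ] C(L, ℝ) →ₗ[ℝ] ℝ) (N δ : ℝ) : Prop where
  H : ∀ f₁ f₂ g₁ g₂, f₁ ^ 2 + f₂ ^ 2 = 1 → g₁ ^ 2 + g₂ ^ 2 = 1 →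
    Gr f₁ g₁ - Gr f₂ g₂ - Gi f₁ g₂ - Gi f₂ g₁ ≤ N
  hδ : N - δ ≤ Gr 1 1
  δ0 : 0 < δ
  δ1 : δ ≤ 1

namespace VH
variable {Gr Gi : C(K, ℝ) →ₗ[ℝ] C(L, ℝ) →ₗ[ℝ] ℝ} {N δ : ℝ}

lemma flip (h : VH Gr Gi N δ) : VH Gr.flip Gi.flip N δ :=
  ⟨fun f₁ f₂ g₁ g₂ hf hg => by
    have := h.H g₁ g₂ f₁ f₂ hg hf
    simp only [LinearMap.flip_apply]; linarith, h.hδ, h.δ0, h.δ1⟩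

lemma sgn {f₁ f₂ : C(K, ℝ)} (h : f₁ ^ 2 + f₂ ^ 2 = 1) : f₁ ^ 2 + (-f₂) ^ 2 = 1 := by
  rw [neg_sq, h]

lemma pair_of_sq_le {f : C(K, ℝ)} (hf : ∀ x, |f x| ≤ 1) : f ^ 2 + (csqrt (1 - f ^ 2)) ^ 2 = 1 := by
  ext x
  have : 0 ≤ 1 - f x ^ 2 := by
    have := (sq_le_one_iff_abs_le_one (f x)).2 (hf x); linarith
  simp [Real.sq_sqrt this]

lemma N0 (h : VH Gr Gi N δ) : 0 ≤ N := by
  have h1 := h.H 1 0 1 0 (by simp) (by simp)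
  have h2 := h.H (-1) 0 1 0 (by simp) (by simp)
  simp at h1 h2; linarith

/-- boundedness -/
lemma bdr (h : VH Gr Gi N δ) {f : C(K, ℝ)} {g : C(L, ℝ)} (hf : ∀ x, |f x| ≤ 1)
    (hg : ∀ x, |g x| ≤ 1) : |Gr f g| ≤ N := by
  have pf := pair_of_sq_le hf
  have pg := pair_of_sq_le hg
  set f2 := csqrt (1 - f ^ 2)
  set g2 := csqrt (1 - g ^ 2)
  have pf' : (-f) ^ 2 + f2 ^ 2 = 1 := by rw [neg_sq, pf]
  have a1 := h.H f f2 g g2 pf pg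
  have a2 := h.H f (-f2) g g2 (sgn pf) pg
  have a3 := h.H f f2 g (-g2) pf (sgn pg)
  have a4 := h.H f (-f2) g (-g2) (sgn pf) (sgn pg)
  have b1 := h.H (-f) f2 g g2 pf' pg
  have b2 := h.H (-f) (-f2) g g2 (sgn pf') pg
  have b3 := h.H (-f) f2 g (-g2) pf' (sgn pg)
  have b4 := h.H (-f) (-f2) g (-g2) (sgn pf') (sgn pg)
  simp only [map_neg, LinearMap.neg_apply] at *
  rw [abs_le]; constructor <;> linarith

lemma var (h : VH Gr Gi N δ) {κ a : C(K, ℝ)} {l b : C(L, ℝ)}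
    (p : κ ^ 2 + a ^ 2 = 2 * κ) (q : l ^ 2 + b ^ 2 = 2 * l) :
    Gr κ l + Gi κ b + Gi a l - Gr a b ≤ δ + Gr κ 1 + Gr 1 l + Gi a 1 + Gi 1 b := by
  have := h.H (1 - κ) a (1 - l) b (by linear_combination p) (by linear_combination q)
  have h2 := h.hδ
  simp only [map_sub, LinearMap.sub_apply] at this
  linarith

lemma psgn {f₁ f₂ : C(K, ℝ)} (h : f₁ ^ 2 + f₂ ^ 2 = 2 * f₁) : f₁ ^ 2 + (-f₂) ^ 2 = 2 * f₁ := by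
  rw [neg_sq, h]

lemma A (h : VH Gr Gi N δ) {κ a : C(K, ℝ)} {l b : C(L, ℝ)}
    (p : κ ^ 2 + a ^ 2 = 2 * κ) (q : l ^ 2 + b ^ 2 = 2 * l) :
    |Gr a b| + Gr κ l ≤ δ + Gr κ 1 + Gr 1 l := by
  have a1 := h.var p q
  have a2 := h.var (psgn p) q
  have a3 := h.var p (psgn q)
  have a4 := h.var (psgn p) (psgn q)
  simp only [map_neg, LinearMap.neg_apply] at *
  have : |Gr a b| ≤ δ + Gr κ 1 + Gr 1 l - Gr κ l := by
    rw [abs_le]; constructor <;> linarith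
  linarith

lemma B (h : VH Gr Gi N δ) {κ a : C(K, ℝ)} {l b : C(L, ℝ)}
    (p : κ ^ 2 + a ^ 2 = 2 * κ) (q : l ^ 2 + b ^ 2 = 2 * l) :
    |Gi κ b| + Gr κ l ≤ 2 * δ + Gr κ 1 + 2 * Gr 1 l := by
  have a1 := h.var p q
  have a2 := h.var (psgn p) q
  have a3 := h.var p (psgn q)
  have a4 := h.var (psgn p) (psgn q)
  have z : (0 : C(K, ℝ)) ^ 2 + 0 ^ 2 = 2 * 0 := by simp
  have c1 := h.var z q
  have c2 := h.var z (psgn q)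
  simp only [map_neg, LinearMap.neg_apply, map_zero, LinearMap.zero_apply] at *
  have : |Gi κ b| ≤ 2 * δ + Gr κ 1 + 2 * Gr 1 l - Gr κ l := by
    rw [abs_le]; constructor <;> linarith
  linarith

lemma pair_of01 {κ : C(K, ℝ)} (h0 : ∀ x, 0 ≤ κ x) (h1 : ∀ x, κ x ≤ 1) :
    κ ^ 2 + (csqrt (κ * (2 - κ))) ^ 2 = 2 * κ := by
  ext x
  have : 0 ≤ κ x * (2 - κ x) := mul_nonneg (h0 x) (by linarith [h1 x])
  have e := Real.sq_sqrt this
  have : (csqrt (κ * (2 - κ))) x ^ 2 = κ x * (2 - κ x) := e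
  simp only [ContinuousMap.add_apply, ContinuousMap.pow_apply, ContinuousMap.mul_apply, this]
  change _ = 2 * κ x
  ring

lemma pair_of_abs {f : C(K, ℝ)} (hf : ∀ x, |f x| ≤ 1) :
    (1 - csqrt (1 - f ^ 2)) ^ 2 + f ^ 2 = 2 * (1 - csqrt (1 - f ^ 2)) := by
  linear_combination pair_of_sq_le hf

lemma pos1 (h : VH Gr Gi N δ) {κ : C(K, ℝ)} (h0 : ∀ x, 0 ≤ κ x) (h1 : ∀ x, κ x ≤ 1) :
    -δ ≤ Gr κ 1 := by
  have := h.A (pair_of01 h0 h1) (l := 0) (b := 0) (by simp)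
  simp at this; linarith

lemma pos (h : VH Gr Gi N δ) {κ : C(K, ℝ)} {r : ℝ} (hr : 0 < r) (h0 : ∀ x, 0 ≤ κ x) (h1 : ∀ x, κ x ≤ r) :
    -(r * δ) ≤ Gr κ 1 := by
  have := h.pos1 (κ := r⁻¹ • κ) (fun x => by simpa using mul_nonneg (by positivity) (h0 x))
    (fun x => by simpa [inv_mul_le_iff₀ hr] using h1 x)
  rw [map_smul, LinearMap.smul_apply, smul_eq_mul] at this
  have := mul_le_mul_of_nonneg_left this hr.le
  rw [mul_inv_cancel_left₀ hr.ne'] at this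
  linarith

lemma mono (h : VH Gr Gi N δ) {κ l : C(K, ℝ)} {r : ℝ} (hr : 0 < r) (h0 : ∀ x, κ x ≤ l x)
    (h1 : ∀ x, l x - κ x ≤ r) : Gr κ 1 ≤ Gr l 1 + r * δ := by
  have := h.pos (κ := l - κ) hr (fun x => by simpa using h0 x) (fun x => by simpa using h1 x)
  simp only [map_sub, LinearMap.sub_apply] at this
  linarith

lemma pos' (h : VH Gr Gi N δ) {κ : C(L, ℝ)} {r : ℝ} (hr : 0 < r) (h0 : ∀ x, 0 ≤ κ x) (h1 : ∀ x, κ x ≤ r) :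
    -(r * δ) ≤ Gr 1 κ := h.flip.pos hr h0 h1

lemma mono' (h : VH Gr Gi N δ) {κ l : C(L, ℝ)} {r : ℝ} (hr : 0 < r) (h0 : ∀ x, κ x ≤ l x)
    (h1 : ∀ x, l x - κ x ≤ r) : Gr 1 κ ≤ Gr 1 l + r * δ := h.flip.mono hr h0 h1

lemma one_sub_sqrt {y : ℝ} (h0 : 0 ≤ y) (h1 : y ≤ 1) :
    0 ≤ 1 - Real.sqrt (1 - y) ∧ 1 - Real.sqrt (1 - y) ≤ y := by
  have h2 : Real.sqrt (1 - y) ≤ 1 := Real.sqrt_le_one.2 (by linarith)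
  have h3 := Real.sq_sqrt (show 0 ≤ 1 - y by linarith)
  have h4 := Real.sqrt_nonneg (1 - y)
  constructor <;> nlinarith

/-- The kappa attached to `f`. -/
def kap (f : C(K, ℝ)) : C(K, ℝ) := 1 - csqrt (1 - f ^ 2)
lemma kap_bd {f : C(K, ℝ)} (hf : ∀ x, |f x| ≤ 1) (x : K) : 0 ≤ kap f x ∧ kap f x ≤ f x ^ 2 := by
  have := (sq_le_one_iff_abs_le_one (f x)).2 (hf x)
  exact one_sub_sqrt (sq_nonneg _) this

lemma R (h : VH Gr Gi N δ) {f : C(K, ℝ)} {g : C(L, ℝ)} (hf : ∀ x, |f x| ≤ 1)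
    (hg : ∀ x, |g x| ≤ 1) : |Gr f g| ≤ Gr (f ^ 2) 1 + Gr 1 (g ^ 2) + (3 + N) * Real.sqrt δ := by
  set s := Real.sqrt δ with hs
  have hs0 : 0 < s := Real.sqrt_pos.2 h.δ0
  have hs1 : s ≤ 1 := Real.sqrt_le_one.2 h.δ1
  have hss : s ^ 2 = δ := Real.sq_sqrt h.δ0.le
  set t := Real.sqrt s
  have ht0 : 0 < t := Real.sqrt_pos.2 hs0
  have ht1 : t ≤ 1 := Real.sqrt_le_one.2 hs1
  have htt : t ^ 2 = s := Real.sq_sqrt hs0.le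
  have tf : ∀ x, |(t • f) x| ≤ 1 := fun x => by
    simp only [ContinuousMap.smul_apply, smul_eq_mul, abs_mul, abs_of_pos ht0]
    exact mul_le_one₀ ht1 (abs_nonneg _) (hf x)
  have tg : ∀ x, |(t • g) x| ≤ 1 := fun x => by
    simp only [ContinuousMap.smul_apply, smul_eq_mul, abs_mul, abs_of_pos ht0]
    exact mul_le_one₀ ht1 (abs_nonneg _) (hg x)
  have a1 := h.A (pair_of_abs tf) (pair_of_abs tg)
  change _ + Gr (kap (t • f)) (kap (t • g)) ≤ δ + Gr (kap (t • f)) 1 + Gr 1 (kap (t • g)) at a1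
  have kf := fun x => kap_bd tf x
  have kg := fun x => kap_bd tg x
  set κ := kap (t • f)
  set l := kap (t • g)
  have e : ∀ x, (t • f) x ^ 2 = s * f x ^ 2 := fun x => by simp [mul_pow, htt]
  have e' : ∀ x, (t • g) x ^ 2 = s * g x ^ 2 := fun x => by simp [mul_pow, htt]
  simp only [e, e'] at kf kg
  have sf := fun x => (sq_le_one_iff_abs_le_one (f x)).2 (hf x)
  have sg := fun x => (sq_le_one_iff_abs_le_one (g x)).2 (hg x)
  have m1 : Gr κ 1 ≤ Gr (s • f ^ 2) 1 + 1 * δ := h.mono one_pos (fun x => by simpa using (kf x).2)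
    (fun x => by simp; nlinarith [kf x, sf x])
  have m2 : Gr 1 l ≤ Gr 1 (s • g ^ 2) + 1 * δ := h.mono' one_pos (fun x => by simpa using (kg x).2)
    (fun x => by simp; nlinarith [kg x, sg x])
  have b : |Gr (s⁻¹ • κ) (s⁻¹ • l)| ≤ N := by
    apply h.bdr
    · intro x
      simp only [ContinuousMap.smul_apply, smul_eq_mul, abs_mul, abs_of_pos (inv_pos.2 hs0)]
      rw [inv_mul_le_iff₀ hs0, abs_of_nonneg (kf x).1]; nlinarith [kf x, sf x]
    · intro x
      simp only [ContinuousMap.smul_apply, smul_eq_mul, abs_mul, abs_of_pos (inv_pos.2 hs0)]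
      rw [inv_mul_le_iff₀ hs0, abs_of_nonneg (kg x).1]; nlinarith [kg x, sg x]
  have b2 : |Gr κ l| ≤ s * s * N := by
    have : Gr κ l = s * s * Gr (s⁻¹ • κ) (s⁻¹ • l) := by
      simp only [map_smul, LinearMap.smul_apply, smul_eq_mul]; field_simp
    rw [this, abs_mul, abs_of_pos (by positivity)]
    gcongr
  simp only [map_smul, LinearMap.smul_apply, smul_eq_mul, one_mul] at m1 m2 a1
  have e3 : |t * (t * Gr f g)| = s * |Gr f g| := by
    rw [← mul_assoc, ← sq, htt, abs_mul, abs_of_pos hs0]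
  rw [e3] at a1
  have b3 := neg_le_of_abs_le b2
  have : s * |Gr f g| ≤ s * (Gr (f ^ 2) 1 + Gr 1 (g ^ 2) + (3 + N) * s) := by nlinarith
  exact le_of_mul_le_mul_left this hs0

end VH
end V
end SliceMap

namespace SliceMap

section V
variable {K L : Type*} [TopologicalSpace K] [TopologicalSpace L]
namespace VH
variable {Gr Gi : C(K, ℝ) →ₗ[ℝ] C(L, ℝ) →ₗ[ℝ] ℝ} {N δ : ℝ}

lemma d (h : VH Gr Gi N δ) {c : C(K, ℝ)} {s : C(L, ℝ)} (c0 : ∀ x, 0 ≤ c x) (c1 : ∀ x, c x ≤ 1)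
    (s0 : ∀ x, 0 ≤ s x) (s1 : ∀ x, s x ≤ 1) {t : ℝ} (t0 : 0 < t) (t1 : t ≤ 1) :
    t * (|Gr c s| + |Gi c s|) ≤ 4 * (Gr c 1 + t ^ 2 * Gr 1 s) + (17 + 2 * N) * Real.sqrt δ := by
  have hδ0 := h.δ0
  have hδr : δ ≤ Real.sqrt δ := by
    have h1 := Real.sq_sqrt h.δ0.le
    have h2 : Real.sqrt δ ≤ 1 := Real.sqrt_le_one.2 h.δ1
    nlinarith [Real.sqrt_nonneg δ]
  set r := Real.sqrt δ
  have hN := h.N0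
  have ts : ∀ x, |(t • s) x| ≤ 1 := fun x => by
    simp only [ContinuousMap.smul_apply, smul_eq_mul]
    rw [abs_of_nonneg (mul_nonneg t0.le (s0 x))]
    exact mul_le_one₀ t1 (s0 x) (s1 x)
  have ca : ∀ x, |c x| ≤ 1 := fun x => by rw [abs_of_nonneg (c0 x)]; exact c1 x
  have tt : t ^ 2 ≤ 1 := by nlinarith
  have tt0 : 0 < t ^ 2 := by positivity
  have q1 : Gr (c ^ 2) 1 ≤ Gr c 1 + 1 * δ := h.mono one_pos (fun x => by simp; nlinarith [c0 x, c1 x])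
    (fun x => by simp; nlinarith [c0 x, c1 x])
  have q2 : Gr 1 ((t • s) ^ 2) ≤ Gr 1 (t ^ 2 • s) + 1 * δ := h.mono' one_pos
    (fun x => by simp [mul_pow]; gcongr; nlinarith [s0 x, s1 x])
    (fun x => by simp [mul_pow]; nlinarith [s0 x, s1 x, mul_le_mul tt (s1 x) (s0 x) zero_le_one, mul_nonneg tt0.le (sq_nonneg (s x))])
  have r1 := h.R ca ts
  have kb := fun x => kap_bd ts x
  have kb2 : ∀ x, kap (t • s) x ≤ t ^ 2 * s x := fun x => by
    refine (kb x).2.trans ?_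
    simp only [ContinuousMap.smul_apply, smul_eq_mul, mul_pow]; gcongr; nlinarith [s0 x, s1 x]
  have b1 := h.B (pair_of01 c0 c1) (pair_of_abs ts)
  change _ + Gr c (kap (t • s)) ≤ _ + 2 * Gr 1 (kap (t • s)) at b1
  set l := kap (t • s)
  have tsle : ∀ x, t ^ 2 * s x ≤ 1 := fun x => mul_le_one₀ tt (s0 x) (s1 x)
  have l1 : ∀ x, l x ≤ 1 := fun x => (kb2 x).trans (tsle x)
  have la : ∀ x, |l x| ≤ 1 := fun x => by rw [abs_of_nonneg (kb x).1]; exact l1 x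
  have q3 : Gr 1 l ≤ Gr 1 (t ^ 2 • s) + 1 * δ := h.mono' one_pos
    (fun x => by simpa using kb2 x)
    (fun x => by simp; linarith [(kb x).1, tsle x])
  have q4 : Gr 1 (l ^ 2) ≤ Gr 1 (t ^ 2 • s) + 1 * δ := h.mono' one_pos
    (fun x => by simp; nlinarith [(kb x).1, kb2 x, l1 x])
    (fun x => by simp; nlinarith [(kb x).1, tsle x])
  have r2 := h.R ca la
  have p1 := h.pos1 c0 c1
  have r3 := neg_le_of_abs_le r2
  simp only [map_smul, LinearMap.smul_apply, smul_eq_mul, one_mul, abs_mul, abs_of_pos t0] at *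
  nlinarith

/-- truncation -/
def cut (p : C(K, ℝ)) (m : ℕ) : C(K, ℝ) := ⟨fun x => min (p x) (2 ^ m), by fun_prop⟩
def piece (p : C(K, ℝ)) : ℕ → C(K, ℝ)
  | 0 => cut p 0
  | m + 1 => ((2 : ℝ) ^ (m + 1))⁻¹ • (cut p (m + 1) - cut p m)

lemma sum_piece (p : C(K, ℝ)) (M : ℕ) : ∑ m ∈ Finset.range (M + 1), (2 : ℝ) ^ m • piece p m = cut p M := by
  induction M with
  | zero => simp [piece]
  | succ M ih =>
    rw [Finset.sum_range_succ, ih, piece, smul_smul, mul_inv_cancel₀ (by positivity), one_smul]; abel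

lemma cut_eq {p : C(K, ℝ)} {M : ℕ} (h : ∀ x, p x ≤ 2 ^ M) : cut p M = p := by
  ext x; exact min_eq_left (h x)

lemma piece_bd {p : C(K, ℝ)} (h : ∀ x, 0 ≤ p x) (m : ℕ) (x : K) : 0 ≤ piece p m x ∧ piece p m x ≤ 1 := by
  cases m with
  | zero => simp [piece, cut, h x]
  | succ m =>
    have h2 : (0:ℝ) < 2 ^ m := by positivity
    have h1 : (2:ℝ) ^ m ≤ 2 ^ (m + 1) := by rw [pow_succ]; linarith
    have e : piece p (m+1) x = ((2 : ℝ) ^ (m + 1))⁻¹ * (min (p x) (2 ^ (m + 1)) - min (p x) (2 ^ m)) := rfl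
    rw [e]
    constructor
    · apply mul_nonneg (by positivity)
      rw [sub_nonneg]; exact min_le_min_left _ h1
    · rw [inv_mul_le_iff₀ (by positivity), mul_one]
      have : min (p x) (2 ^ (m + 1)) ≤ (2:ℝ) ^ (m + 1) := min_le_right _ _
      have : 0 ≤ min (p x) (2 ^ m) := le_min (h x) h2.le
      linarith

lemma piece_le {p : C(K, ℝ)} (h : ∀ x, 0 ≤ p x) (m : ℕ) (x : K) :
    piece p (m + 1) x ≤ 16 / 16 ^ (m + 1) * p x ^ 4 := by
  have h2 : (0:ℝ) < 2 ^ m := by positivity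
  have h1 : (2:ℝ) ^ m ≤ 2 ^ (m + 1) := by rw [pow_succ]; linarith
  by_cases hp : p x ≤ 2 ^ m
  · have e : piece p (m+1) x = ((2 : ℝ) ^ (m + 1))⁻¹ * (min (p x) (2 ^ (m + 1)) - min (p x) (2 ^ m)) := rfl
    rw [e, min_eq_left hp, min_eq_left (hp.trans h1), sub_self, mul_zero]
    have := h x
    positivity
  · push Not at hp
    refine (piece_bd h (m+1) x).2.trans ?_
    have : ((2:ℝ) ^ m) ^ 4 ≤ p x ^ 4 := pow_le_pow_left₀ h2.le hp.le 4
    have e : ((2:ℝ) ^ m) ^ 4 = 16 ^ m := by rw [← pow_mul, mul_comm, pow_mul]; norm_num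
    rw [e] at this
    rw [pow_succ, div_mul_eq_mul_div, le_div_iff₀ (by positivity)]; nlinarith

lemma phi_piece (h : VH Gr Gi N δ) {p : C(K, ℝ)} (h0 : ∀ x, 0 ≤ p x) {M : ℕ} (h1 : ∀ x, p x ≤ 2 ^ M)
    (h4 : Gr (p ^ 4) 1 ≤ 2 * N + 16 ^ M * δ) (m : ℕ) : 
    Gr (piece p m) 1 ≤ 32 * N / 16 ^ m + 2 * 16 ^ (M + 1) * δ := by
  have hN := h.N0
  have hδ := h.δ0
  have h16 : (1:ℝ) ≤ 16 ^ (M+1) := one_le_pow₀ (by norm_num)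
  cases m with
  | zero =>
    have := h.mono (κ := piece p 0) (l := 1) one_pos (fun x => (piece_bd h0 0 x).2)
      (fun x => by simp [(piece_bd h0 0 x).1])
    have h2 := h.H 1 0 1 0 (by simp) (by simp)
    simp at h2
    simp
    nlinarith
  | succ m =>
    have hd : (16:ℝ) / 16 ^ (m + 1) ≤ 16 := div_le_self (by norm_num) (one_le_pow₀ (by norm_num))
    have hd0 : (0:ℝ) ≤ 16 / 16 ^ (m + 1) := by positivity
    have := h.mono (κ := piece p (m+1)) (l := ((16:ℝ) / 16 ^ (m + 1)) • p ^ 4) (r := 16 ^ (M + 1))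
      (by positivity) (fun x => by simpa using piece_le h0 m x)
      (fun x => by
        simp only [ContinuousMap.smul_apply, smul_eq_mul, ContinuousMap.pow_apply]
        have a1 := (piece_bd h0 (m+1) x).1
        have a2 : p x ^ 4 ≤ 16 ^ M := by
          have := pow_le_pow_left₀ (h0 x) (h1 x) 4
          rwa [← pow_mul, mul_comm, pow_mul, show (2:ℝ)^4 = 16 by norm_num] at this
        have a3 := mul_le_mul hd a2 (by have := h0 x; positivity) (by norm_num)
        rw [pow_succ (16:ℝ) M]; linarith)
    simp only [map_smul, LinearMap.smul_apply, smul_eq_mul] at this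
    have a := mul_le_mul_of_nonneg_left h4 hd0
    have e : (16:ℝ) / 16 ^ (m + 1) * (2 * N + 16 ^ M * δ) = 32 * N / 16 ^ (m + 1) + 16 / 16 ^ (m + 1) * (16 ^ M * δ) := by ring
    have e2 : (16:ℝ) / 16 ^ (m + 1) * (16 ^ M * δ) ≤ 16 ^ (M + 1) * δ := by
      rw [pow_succ (16:ℝ) M, mul_comm ((16:ℝ) ^ M) 16, mul_assoc]; gcongr
    linarith

def KM (M : ℕ) (N : ℝ) : ℝ := 16 ^ M * (16 * 16 ^ (M + 1) + 17 + 2 * N)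

lemma pair_est (h : VH Gr Gi N δ) {p : C(K, ℝ)} (h0 : ∀ x, 0 ≤ p x) {M : ℕ} (h1 : ∀ x, p x ≤ 2 ^ M)
    (h4 : Gr (p ^ 4) 1 ≤ 2 * N + 16 ^ M * δ) {q : C(L, ℝ)} (k0 : ∀ x, 0 ≤ q x) (k1 : ∀ x, q x ≤ 2 ^ M)
    (k4 : Gr 1 (q ^ 4) ≤ 2 * N + 16 ^ M * δ) {m n : ℕ} (hm : m ≤ M) (hn : n ≤ m) :
    2 ^ m * 2 ^ n * (|Gr (piece p m) (piece q n)| + |Gi (piece p m) (piece q n)|) ≤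
     256 * N * (1/2) ^ m * (1/2) ^ n + KM M N * Real.sqrt δ := by
  have hδr : δ ≤ Real.sqrt δ := by
    have h1 := Real.sq_sqrt h.δ0.le
    have h2 : Real.sqrt δ ≤ 1 := Real.sqrt_le_one.2 h.δ1
    nlinarith [Real.sqrt_nonneg δ]
  have hN := h.N0
  have hδ0 := h.δ0
  have p1 := h.phi_piece h0 h1 h4 m
  have p2 : Gr 1 (piece q n) ≤ 32 * N / 16 ^ n + 2 * 16 ^ (M + 1) * δ := h.flip.phi_piece k0 k1 k4 n
  have t1 : (4:ℝ) ^ n / 4 ^ m ≤ 1 := by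
    rw [div_le_one (by positivity)]; exact pow_le_pow_right₀ (by norm_num) hn
  have dd := h.d (fun x => (piece_bd h0 m x).1) (fun x => (piece_bd h0 m x).2) 
    (fun x => (piece_bd k0 n x).1) (fun x => (piece_bd k0 n x).2) (t := 4 ^ n / 4 ^ m) (by positivity) t1
  set W := |Gr (piece p m) (piece q n)| + |Gi (piece p m) (piece q n)|
  set r := Real.sqrt δ
  set t : ℝ := 4 ^ n / 4 ^ m with ht
  have t0 : 0 < t := by positivity
  have hr0 : 0 ≤ r := Real.sqrt_nonneg _
  have hE : (0:ℝ) ≤ 16 ^ (M+1) := by positivity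
  have step : t * W ≤ 4 * (32 * N / 16 ^ m + t ^ 2 * (32 * N / 16 ^ n)) + (16 * 16 ^ (M + 1) + 17 + 2 * N) * r := by
    have s1 := mul_le_mul_of_nonneg_left p2 (sq_nonneg t)
    have s2 : t ^ 2 * (2 * 16 ^ (M + 1) * δ) ≤ 2 * 16 ^ (M + 1) * r := by
      have : t ^ 2 ≤ 1 := by nlinarith
      calc _ ≤ 1 * (2 * 16 ^ (M + 1) * δ) := by gcongr
        _ ≤ _ := by rw [one_mul]; gcongr
    have s3 := mul_le_mul_of_nonneg_left hδr hE
    linarith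
  have c : 2 ^ m * 2 ^ n * W = (2 ^ m * 2 ^ n / t) * (t * W) := by field_simp
  have f : (2:ℝ) ^ m * 2 ^ n / t ≤ 16 ^ M := by
    have e : (2:ℝ) ^ m * 2 ^ n / t = 8 ^ m / 2 ^ n := by
      rw [ht, show (8:ℝ) = 2 * 4 by norm_num, mul_pow, show (4:ℝ) ^ n = 2 ^ n * 2 ^ n by rw [← mul_pow]; norm_num]
      field_simp
    rw [e]
    calc (8:ℝ) ^ m / 2 ^ n ≤ 8 ^ m := div_le_self (by positivity) (one_le_pow₀ (by norm_num))
      _ ≤ 16 ^ m := pow_le_pow_left₀ (by norm_num) (by norm_num) m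
      _ ≤ 16 ^ M := pow_le_pow_right₀ (by norm_num) hm
  rw [c]
  calc _ ≤ 2 ^ m * 2 ^ n / t * (4 * (32 * N / 16 ^ m + t ^ 2 * (32 * N / 16 ^ n)) + (16 * 16 ^ (M + 1) + 17 + 2 * N) * r) := by
        gcongr
    _ = 2 ^ m * 2 ^ n / t * (4 * (32 * N / 16 ^ m + t ^ 2 * (32 * N / 16 ^ n))) + 2 ^ m * 2 ^ n / t * ((16 * 16 ^ (M + 1) + 17 + 2 * N) * r) := by ring
    _ ≤ _ := by
        apply add_le_add
        · apply le_of_eq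
          have e16 : ∀ k : ℕ, (16:ℝ) ^ k = (2 ^ k) ^ 4 := fun k => by rw [← pow_mul, mul_comm, pow_mul]; norm_num
          have e4 : ∀ k : ℕ, (4:ℝ) ^ k = (2 ^ k) ^ 2 := fun k => by rw [← pow_mul, mul_comm, pow_mul]; norm_num
          rw [ht, e16, e16, e4, e4, one_div, inv_pow, inv_pow]
          have : (2:ℝ) ^ m ≠ 0 := by positivity
          have : (2:ℝ) ^ n ≠ 0 := by positivity
          field_simp
          ring
        · rw [KM, mul_assoc]
          gcongr

lemma e_pos (h : VH Gr Gi N δ) {p : C(K, ℝ)} (h0 : ∀ x, 0 ≤ p x) {M : ℕ} (h1 : ∀ x, p x ≤ 2 ^ M)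
    (h4 : Gr (p ^ 4) 1 ≤ 2 * N + 16 ^ M * δ) {q : C(L, ℝ)} (k0 : ∀ x, 0 ≤ q x) (k1 : ∀ x, q x ≤ 2 ^ M)
    (k4 : Gr 1 (q ^ 4) ≤ 2 * N + 16 ^ M * δ) :
    |Gr p q| + |Gi p q| ≤ 1024 * N + (M + 1) ^ 2 * KM M N * Real.sqrt δ := by
  have hN := h.N0
  have est : ∀ m ∈ Finset.range (M+1), ∀ n ∈ Finset.range (M+1), 
      2 ^ m * 2 ^ n * (|Gr (piece p m) (piece q n)| + |Gi (piece p m) (piece q n)|) ≤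
        256 * N * (1/2) ^ m * (1/2) ^ n + KM M N * Real.sqrt δ := by
    intro m hm n hn
    rw [Finset.mem_range, Nat.lt_succ_iff] at hm hn
    rcases le_total n m with hh | hh
    · exact h.pair_est h0 h1 h4 k0 k1 k4 hm hh
    · have := h.flip.pair_est k0 k1 k4 h0 h1 h4 hn hh
      simp only [LinearMap.flip_apply] at this
      linarith
  have ex : ∀ G : C(K, ℝ) →ₗ[ℝ] C(L, ℝ) →ₗ[ℝ] ℝ, |G p q| ≤ ∑ m ∈ Finset.range (M+1), ∑ n ∈ Finset.range (M+1),
      2 ^ m * 2 ^ n * |G (piece p m) (piece q n)| := by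
    intro G
    have : G p q = ∑ m ∈ Finset.range (M+1), ∑ n ∈ Finset.range (M+1),
      2 ^ m * 2 ^ n * G (piece p m) (piece q n) := by
      conv_lhs => rw [← cut_eq h1, ← sum_piece, ← cut_eq k1, ← sum_piece]
      simp only [map_sum, LinearMap.sum_apply, map_smul, LinearMap.smul_apply, smul_eq_mul, Finset.mul_sum, mul_assoc]
      rw [Finset.sum_comm]
      refine Finset.sum_congr rfl fun m _ => Finset.sum_congr rfl fun n _ => by ring
    rw [this]
    refine (Finset.abs_sum_le_sum_abs _ _).trans (Finset.sum_le_sum fun m _ => ?_)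
    refine (Finset.abs_sum_le_sum_abs _ _).trans (Finset.sum_le_sum fun n _ => ?_)
    rw [abs_mul, abs_of_pos (by positivity)]
  refine (add_le_add (ex Gr) (ex Gi)).trans ?_
  rw [← Finset.sum_add_distrib]
  simp_rw [← Finset.sum_add_distrib, ← mul_add]
  refine (Finset.sum_le_sum fun m hm => Finset.sum_le_sum fun n hn => est m hm n hn).trans ?_
  simp only [Finset.sum_add_distrib, ← Finset.mul_sum, Finset.sum_const, Finset.card_range, nsmul_eq_mul, ← Finset.sum_mul]
  have g : ∑ m ∈ Finset.range (M+1), ((1:ℝ)/2) ^ m ≤ 2 := by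
    rw [geom_sum_eq (by norm_num)]
    have : (0:ℝ) ≤ (1/2) ^ (M+1) := by positivity
    rw [div_le_iff_of_neg (by norm_num)]; linarith
  have g0 : 0 ≤ ∑ m ∈ Finset.range (M+1), ((1:ℝ)/2) ^ m := Finset.sum_nonneg fun m _ => by positivity
  set S := ∑ m ∈ Finset.range (M+1), ((1:ℝ)/2) ^ m
  have : 256 * N * S * S ≤ 1024 * N := by nlinarith [mul_le_mul g g g0 (by norm_num)]
  push_cast
  nlinarith

lemma posneg {S : Type*} [TopologicalSpace S] (M : ℕ) (p : C(S, ℝ)) (hp : ∀ x, |p x| ≤ 2 ^ M) :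
      ∃ a b : C(S, ℝ), p = a - b ∧ (∀ x, 0 ≤ a x ∧ a x ≤ 2 ^ M ∧ 0 ≤ p x ^ 4 - a x ^ 4 ∧ p x ^ 4 - a x ^ 4 ≤ 16 ^ M)
        ∧ (∀ x, 0 ≤ b x ∧ b x ≤ 2 ^ M ∧ 0 ≤ p x ^ 4 - b x ^ 4 ∧ p x ^ 4 - b x ^ 4 ≤ 16 ^ M) := by
  refine ⟨⟨fun x => max (p x) 0, by fun_prop⟩, ⟨fun x => max (-p x) 0, by fun_prop⟩, ?_, ?_, ?_⟩
  · ext x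
    change p x = max (p x) 0 - max (-p x) 0
    rcases le_total (p x) 0 with h | h <;> simp [h]
  all_goals
    intro x
    have h4 : p x ^ 4 ≤ 16 ^ M := by
      have := pow_le_pow_left₀ (abs_nonneg _) (hp x) 4
      rwa [← pow_mul, mul_comm, pow_mul, show (2:ℝ)^4 = 16 by norm_num, Even.pow_abs (by decide)] at this
    have h2 := abs_le.1 (hp x)
    have h40 : 0 ≤ p x ^ 4 := by positivity
    have h2M : (0:ℝ) ≤ 2 ^ M := by positivity
    have h16M : (0:ℝ) ≤ 16 ^ M := by positivity
    have hev : (-p x) ^ 4 = p x ^ 4 := Even.neg_pow (by decide) _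
    simp only [ContinuousMap.coe_mk]
    rcases le_total (p x) 0 with h | h
    · simp [h, hev]; first | linarith | (constructor <;> linarith)
    · simp [h, hev]; first | linarith | (constructor <;> linarith)

theorem e_all (h : VH Gr Gi N δ) {p : C(K, ℝ)} {M : ℕ} (h1 : ∀ x, |p x| ≤ 2 ^ M)
    (h4 : Gr (p ^ 4) 1 ≤ 2 * N) {q : C(L, ℝ)} (k1 : ∀ x, |q x| ≤ 2 ^ M)
    (k4 : Gr 1 (q ^ 4) ≤ 2 * N) :
    |Gr p q| + |Gi p q| ≤ 4 * (1024 * N + (M + 1) ^ 2 * KM M N * Real.sqrt δ) := by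
  obtain ⟨a, b, e, ha, hb⟩ := posneg M p h1
  obtain ⟨c, d, e', hc, hd⟩ := posneg M q k1
  have fm : ∀ a : C(K, ℝ), (∀ x, 0 ≤ a x ∧ a x ≤ 2 ^ M ∧ 0 ≤ p x ^ 4 - a x ^ 4 ∧ p x ^ 4 - a x ^ 4 ≤ 16 ^ M) →
      Gr (a ^ 4) 1 ≤ 2 * N + 16 ^ M * δ := by
    intro a ha
    have := h.mono (κ := a ^ 4) (l := p ^ 4) (r := 16 ^ M) (by positivity)
      (fun x => by simpa using (ha x).2.2.1) (fun x => by simpa using (ha x).2.2.2)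
    linarith
  have fm' : ∀ a : C(L, ℝ), (∀ x, 0 ≤ a x ∧ a x ≤ 2 ^ M ∧ 0 ≤ q x ^ 4 - a x ^ 4 ∧ q x ^ 4 - a x ^ 4 ≤ 16 ^ M) →
      Gr 1 (a ^ 4) ≤ 2 * N + 16 ^ M * δ := by
    intro a ha
    have := h.mono' (κ := a ^ 4) (l := q ^ 4) (r := 16 ^ M) (by positivity)
      (fun x => by simpa using (ha x).2.2.1) (fun x => by simpa using (ha x).2.2.2)
    linarith
  have e1 := h.e_pos (fun x => (ha x).1) (fun x => (ha x).2.1) (fm a ha) (fun x => (hc x).1) (fun x => (hc x).2.1) (fm' c hc)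
  have e2 := h.e_pos (fun x => (ha x).1) (fun x => (ha x).2.1) (fm a ha) (fun x => (hd x).1) (fun x => (hd x).2.1) (fm' d hd)
  have e3 := h.e_pos (fun x => (hb x).1) (fun x => (hb x).2.1) (fm b hb) (fun x => (hc x).1) (fun x => (hc x).2.1) (fm' c hc)
  have e4 := h.e_pos (fun x => (hb x).1) (fun x => (hb x).2.1) (fm b hb) (fun x => (hd x).1) (fun x => (hd x).2.1) (fm' d hd)
  have ab : ∀ x y z w : ℝ, |x - y - (z - w)| ≤ |x| + |y| + |z| + |w| := by
    intro x y z w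
    calc _ ≤ |x - y| + |z - w| := abs_sub _ _
      _ ≤ _ := by linarith [abs_sub x y, abs_sub z w]
  rw [e, e']
  simp only [map_sub, LinearMap.sub_apply]
  have f1 := ab (Gr a c) (Gr b c) (Gr a d) (Gr b d)
  have f2 := ab (Gi a c) (Gi b c) (Gi a d) (Gi b d)
  linarith
end VH
end V
end SliceMap

namespace SliceMap

theorem lemV {𝒜 ℬ : Type*} [CStarAlgebra 𝒜] [CStarAlgebra ℬ] (Γ : 𝒜 →ₗ[ℂ] ℬ →ₗ[ℂ] ℂ) {N δ : ℝ}
    (hU : ∀ U ∈ unitary 𝒜, ∀ U' ∈ unitary ℬ, (Γ U U').re ≤ N) (hδ : N - δ ≤ (Γ 1 1).re)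
    (δ0 : 0 < δ) (δ1 : δ ≤ 1) (M : ℕ) {T : 𝒜} {S : ℬ} (hT : IsSelfAdjoint T) (hS : IsSelfAdjoint S)
    (nT : ‖T‖ ≤ 2 ^ M) (nS : ‖S‖ ≤ 2 ^ M) (T4 : (Γ (T ^ 4) 1).re ≤ 2 * N)
    (S4 : (Γ 1 (S ^ 4)).re ≤ 2 * N) :
    ‖Γ T S‖ ≤ 4 * (1024 * N + (M + 1) ^ 2 * VH.KM M N * Real.sqrt δ) := by
  set cT : C(spectrum ℝ T, ℝ) →⋆ₐ[ℝ] 𝒜 := cfcHom hT with hcT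
  set cS : C(spectrum ℝ S, ℝ) →⋆ₐ[ℝ] ℬ := cfcHom hS with hcS
  let Gr : C(spectrum ℝ T, ℝ) →ₗ[ℝ] C(spectrum ℝ S, ℝ) →ₗ[ℝ] ℝ :=
    LinearMap.mk₂ ℝ (fun f g => (Γ (cT f) (cS g)).re) (by simp) (by simp) (by simp) (by simp)
  let Gi : C(spectrum ℝ T, ℝ) →ₗ[ℝ] C(spectrum ℝ S, ℝ) →ₗ[ℝ] ℝ :=
    LinearMap.mk₂ ℝ (fun f g => (Γ (cT f) (cS g)).im) (by simp) (by simp) (by simp) (by simp)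
  have uT : ∀ f₁ f₂, f₁ ^ 2 + f₂ ^ 2 = 1 → cT f₁ + Complex.I • cT f₂ ∈ unitary 𝒜 := by
    intro f₁ f₂ h
    have s1 : star (cT f₁) = cT f₁ := by rw [← map_star]; congr 1
    have s2 : star (cT f₂) = cT f₂ := by rw [← map_star]; congr 1
    have cm : cT f₁ * cT f₂ = cT f₂ * cT f₁ := by rw [← map_mul, mul_comm, map_mul]
    have e : cT f₁ * cT f₁ + cT f₂ * cT f₂ = 1 := by
      rw [← map_mul, ← map_mul, ← map_add, ← sq, ← sq, h, map_one]
    rw [Unitary.mem_iff]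
    constructor
    · simp only [star_add, star_smul, s1, s2, add_mul, mul_add, smul_mul_smul_comm, cm,
        smul_mul_assoc, mul_smul_comm]
      simp [← e, smul_smul]
    · simp only [star_add, star_smul, s1, s2, add_mul, mul_add, smul_mul_smul_comm, cm,
        smul_mul_assoc, mul_smul_comm]
      simp [← e, smul_smul]
  have uS : ∀ f₁ f₂, f₁ ^ 2 + f₂ ^ 2 = 1 → cS f₁ + Complex.I • cS f₂ ∈ unitary ℬ := by
    intro f₁ f₂ h
    have s1 : star (cS f₁) = cS f₁ := by rw [← map_star]; congr 1
    have s2 : star (cS f₂) = cS f₂ := by rw [← map_star]; congr 1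
    have cm : cS f₁ * cS f₂ = cS f₂ * cS f₁ := by rw [← map_mul, mul_comm, map_mul]
    have e : cS f₁ * cS f₁ + cS f₂ * cS f₂ = 1 := by
      rw [← map_mul, ← map_mul, ← map_add, ← sq, ← sq, h, map_one]
    rw [Unitary.mem_iff]
    constructor
    · simp only [star_add, star_smul, s1, s2, add_mul, mul_add, smul_mul_smul_comm, cm,
        smul_mul_assoc, mul_smul_comm]
      simp [← e, smul_smul]
    · simp only [star_add, star_smul, s1, s2, add_mul, mul_add, smul_mul_smul_comm, cm,
        smul_mul_assoc, mul_smul_comm]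
      simp [← e, smul_smul]
  have vh : VH Gr Gi N δ := by
    refine ⟨?_, ?_, δ0, δ1⟩
    · intro f₁ f₂ g₁ g₂ hf hg
      have := hU _ (uT f₁ f₂ hf) _ (uS g₁ g₂ hg)
      simp [Gr, Gi] at this ⊢
      linarith
    · simpa [Gr] using hδ
  have iT : cT (ContinuousMap.restrict (spectrum ℝ T) (ContinuousMap.id ℝ)) = T := cfcHom_id hT
  have iS : cS (ContinuousMap.restrict (spectrum ℝ S) (ContinuousMap.id ℝ)) = S := cfcHom_id hS
  have := vh.e_all (p := ContinuousMap.restrict (spectrum ℝ T) (ContinuousMap.id ℝ)) (M := M)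
    (q := ContinuousMap.restrict (spectrum ℝ S) (ContinuousMap.id ℝ))
    (fun x => (IsometricContinuousFunctionalCalculus.norm_spectrum_le T x.2 hT).trans nT)
    (by simpa [Gr, iT] using T4)
    (fun x => (IsometricContinuousFunctionalCalculus.norm_spectrum_le S x.2 hS).trans nS)
    (by simpa [Gr, iS] using S4)
  refine (Complex.norm_le_abs_re_add_abs_im _).trans ?_
  simpa [Gr, Gi, iT, iS] using this

end SliceMap

namespace SliceMap

lemma cstarMatrix_single_norm {A n : Type*} [CStarAlgebra A] [PartialOrder A] [StarOrderedRing A] [Fintype n] [DecidableEq n]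
    (i j : n) (a : A) : ‖CStarMatrix.ofMatrix (Matrix.single i j a)‖ = ‖a‖ := by
  have h1 : ∀ a : A, ‖CStarMatrix.ofMatrix (Matrix.single j j a)‖ = ‖a‖ := by
    intro a
    refine cn_eq_norm (N := fun a => ‖CStarMatrix.ofMatrix (Matrix.single j j a)‖) ?_ a
    have hm : ∀ x y : A, CStarMatrix.ofMatrix (Matrix.single j j (x * y)) = CStarMatrix.ofMatrix (Matrix.single j j x) * CStarMatrix.ofMatrix (Matrix.single j j y) := by
      intro x y
      rw [← Matrix.single_mul_single_same (c := x) j j j y]; rfl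
    have hs : ∀ x : A, CStarMatrix.ofMatrix (Matrix.single j j (star x)) = star (CStarMatrix.ofMatrix (Matrix.single j j x)) := by
      intro x
      rw [← Matrix.conjTranspose_single]; rfl
    constructor
    · intro x y
      rw [Matrix.single_add]; exact norm_add_le _ _
    · intro z x
      rw [← norm_smul]; congr 1; rw [← Matrix.smul_single]; rfl
    · intro x hx
      have := congrArg (fun X : CStarMatrix n n A => X j j) (norm_eq_zero.1 hx)
      simpa using this
    · intro x y
      rw [hm]; exact norm_mul_le _ _
    · intro x
      rw [hm, hs]; exact CStarRing.norm_star_mul_self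
  have h2 : star (CStarMatrix.ofMatrix (Matrix.single i j a)) * CStarMatrix.ofMatrix (Matrix.single i j a)
      = CStarMatrix.ofMatrix (Matrix.single j j (star a * a)) := by
    rw [← Matrix.single_mul_single_same (c := star a) j i j a, ← Matrix.conjTranspose_single]; rfl
  have h3 := CStarRing.norm_star_mul_self (x := CStarMatrix.ofMatrix (Matrix.single i j a))
  rw [h2, h1, CStarRing.norm_star_mul_self] at h3
  exact ((mul_self_inj (norm_nonneg _) (norm_nonneg _)).1 h3).symm

lemma cstarMatrix_norm_le {A n : Type*} [CStarAlgebra A] [PartialOrder A] [StarOrderedRing A] [Fintype n] [DecidableEq n]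
    (X : CStarMatrix n n A) : ‖X‖ ≤ ∑ i, ∑ j, ‖X i j‖ := by
  have : X = ∑ i, ∑ j, CStarMatrix.ofMatrix (Matrix.single i j (X i j)) :=
    Matrix.matrix_eq_sum_single (CStarMatrix.ofMatrix.symm X)
  conv_lhs => rw [this]
  refine (norm_sum_le _ _).trans (Finset.sum_le_sum fun i _ => (norm_sum_le _ _).trans (Finset.sum_le_sum fun j _ => ?_))
  rw [cstarMatrix_single_norm]

end SliceMap

namespace SliceMap
open Matrix

section HC
variable {𝒟 : Type*} [Ring 𝒟] [StarRing 𝒟] [Algebra ℝ 𝒟] [StarModule ℝ 𝒟]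
variable {m : Type} [Fintype m] [DecidableEq m]

def hE (t : m → ℝ) (Z : Matrix m m 𝒟) : 𝒟 := ∑ i, (t i)^2 • Z i i

def hD (m : Type) [DecidableEq m] (x : 𝒟) : Matrix m m 𝒟 := Matrix.diagonal fun _ => x

lemma hE_add (t : m → ℝ) (Z W : Matrix m m 𝒟) : hE t (Z + W) = hE t Z + hE t W := by
  simp [hE, Finset.sum_add_distrib]

lemma hE_D_mul (t : m → ℝ) (x : 𝒟) (Z : Matrix m m 𝒟) : hE t (hD m x * Z) = x * hE t Z := by
  simp [hE, hD, Finset.mul_sum]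

lemma hE_mul_D (t : m → ℝ) (x : 𝒟) (Z : Matrix m m 𝒟) : hE t (Z * hD m x) = hE t Z * x := by
  simp [hE, hD, Finset.sum_mul]

lemma hE_D (t : m → ℝ) (ht : ∑ i, (t i)^2 = 1) (x : 𝒟) : hE t (hD m x) = x := by
  simp [hE, hD, ← Finset.sum_smul, ht]

lemma hD_add (x y : 𝒟) : hD m (x + y) = hD m x + hD m y := by
  simp [hD]

lemma hD_smul (c : ℝ) (y : 𝒟) : hD m (c • y) = c • hD m y := by
  ext i j; by_cases h : i = j <;> simp [hD, h]

lemma hE_smul (t : m → ℝ) (c : ℝ) (Z : Matrix m m 𝒟) : hE t (c • Z) = c • hE t Z := by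
  simp [hE, Finset.smul_sum, smul_comm c]

lemma hD_mul (x y : 𝒟) : hD m x * hD m y = hD m (x * y) := by
  simp [hD]

lemma hD_star (x : 𝒟) : (hD m x)ᴴ = hD m (star x) := by
  simp [hD, Matrix.diagonal_conjTranspose]

def hw (μ ν : ℝ) (t : m → ℝ) : m ⊕ m → ℝ := Sum.elim (fun i => √μ * t i) (fun i => √ν * t i)

lemma hE_blocks {μ ν : ℝ} (hμ : 0 ≤ μ) (hν : 0 ≤ ν) (t : m → ℝ) (Z W Y V : Matrix m m 𝒟) :
    hE (hw μ ν t) (fromBlocks Z W Y V) = μ • hE t Z + ν • hE t V := by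
  simp [hE, hw, mul_pow, Real.sq_sqrt hμ, Real.sq_sqrt hν, Finset.smul_sum, mul_smul]

lemma hw_sum {μ ν : ℝ} (hμ : 0 ≤ μ) (hν : 0 ≤ ν) (h1 : μ + ν = 1) (t : m → ℝ) (ht : ∑ i, (t i)^2 = 1) :
    ∑ i, (hw μ ν t i)^2 = 1 := by
  simp [hw, mul_pow, Real.sq_sqrt hμ, Real.sq_sqrt hν, ← Finset.mul_sum, ht, h1]

def hsA (L : List (ℝ × ℝ × 𝒟)) (x : 𝒟) : 𝒟 := (L.map fun p => p.1 • (p.2.2 * x * star p.2.2)).sum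
def hsB (L : List (ℝ × ℝ × 𝒟)) (x : 𝒟) : 𝒟 := (L.map fun p => p.2.1 • (star p.2.2 * x * p.2.2)).sum

structure HC (t : m → ℝ) (T : Matrix m m 𝒟) (L : List (ℝ × ℝ × 𝒟)) : Prop where
  a : ∀ x, hE t (T * hD m x * Tᴴ) = hsA L x
  b : ∀ x, hE t (Tᴴ * hD m x * T) = hsB L x
  c : hE t (T * Tᴴ * (T * Tᴴ)) = hsA L 1 * hsA L 1 + hsA L (hsB L 1)
  d : hE t (Tᴴ * T * (Tᴴ * T)) = hsB L 1 * hsB L 1 + hsB L (hsA L 1)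

lemma HC.a1 {t : m → ℝ} {T : Matrix m m 𝒟} {L} (h : HC t T L) : hE t (T * Tᴴ) = hsA L 1 := by
  rw [← h.a]; simp [hD]
lemma HC.b1 {t : m → ℝ} {T : Matrix m m 𝒟} {L} (h : HC t T L) : hE t (Tᴴ * T) = hsB L 1 := by
  rw [← h.b]; simp [hD]

def hStep (T : Matrix m m 𝒟) (y : 𝒟) : Matrix (m ⊕ m) (m ⊕ m) 𝒟 := fromBlocks T (hD m y) 0 T

lemma hD_blocks (x : 𝒟) : hD (m ⊕ m) x = fromBlocks (hD m x) 0 0 (hD m x) := by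
  simp [hD, Matrix.fromBlocks_diagonal]

lemma hsA_add (L : List (ℝ × ℝ × 𝒟)) (x y : 𝒟) : hsA L (x + y) = hsA L x + hsA L y := by
  induction L with
  | nil => simp [hsA]
  | cons p L ih =>
    simp only [hsA, List.map_cons, List.sum_cons, mul_add, add_mul, smul_add] at *
    rw [ih]; abel
lemma hsB_add (L : List (ℝ × ℝ × 𝒟)) (x y : 𝒟) : hsB L (x + y) = hsB L x + hsB L y := by
  induction L with
  | nil => simp [hsB]
  | cons p L ih =>
    simp only [hsB, List.map_cons, List.sum_cons, mul_add, add_mul, smul_add] at *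
    rw [ih]; abel
lemma hsA_smul (L : List (ℝ × ℝ × 𝒟)) (c : ℝ) (y : 𝒟) : hsA L (c • y) = c • hsA L y := by
  induction L with
  | nil => simp [hsA]
  | cons p L ih =>
    simp only [hsA, List.map_cons, List.sum_cons, smul_add] at *
    rw [ih]; simp [smul_comm c]
lemma hsB_smul (L : List (ℝ × ℝ × 𝒟)) (c : ℝ) (y : 𝒟) : hsB L (c • y) = c • hsB L y := by
  induction L with
  | nil => simp [hsB]
  | cons p L ih =>
    simp only [hsB, List.map_cons, List.sum_cons, smul_add] at *
    rw [ih]; simp [smul_comm c]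

lemma hsA_cons (L : List (ℝ × ℝ × 𝒟)) (A B : ℝ) (a x : 𝒟) : hsA ((A, B, a) :: L) x = hsA L x + A • (a * x * star a) := by
  simp [hsA, add_comm]
lemma hsB_cons (L : List (ℝ × ℝ × 𝒟)) (A B : ℝ) (a x : 𝒟) : hsB ((A, B, a) :: L) x = hsB L x + B • (star a * x * a) := by
  simp [hsB, add_comm]

lemma HC.step {t : m → ℝ} {T : Matrix m m 𝒟} {L} (h : HC t T L) (ht : ∑ i, (t i)^2 = 1) {μ ν : ℝ}
    (hμ : 0 ≤ μ) (hν : 0 ≤ ν) (h1 : μ + ν = 1) (c : ℝ) (a : 𝒟) :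
    HC (hw μ ν t) (hStep T (c • a)) ((μ * c^2, ν * c^2, a) :: L) := by
  have hν' : ν = 1 - μ := by linarith
  have hH : (hStep T (c • a))ᴴ = fromBlocks Tᴴ 0 (c • hD m (star a)) Tᴴ := by
    rw [hStep, fromBlocks_conjTranspose, hD_star, star_smul, ← hD_smul]; simp
  have hT : hStep T (c • a) = fromBlocks T (c • hD m a) 0 T := by rw [hStep, hD_smul]
  have hEm : ∀ (x y : 𝒟) (Z : Matrix m m 𝒟), hE t (hD m x * Z * hD m y) = x * hE t Z * y := by
    intro x y Z; rw [hE_mul_D, hE_D_mul]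
  have e2 : ∀ x : 𝒟, μ • x + ν • x = x := by intro x; rw [← add_smul, h1, one_smul]
  refine ⟨fun x => ?_, fun x => ?_, ?_, ?_⟩
  · rw [hH, hT, hD_blocks, fromBlocks_multiply, fromBlocks_multiply, hE_blocks hμ hν, hsA_cons]
    simp only [Matrix.mul_zero, Matrix.zero_mul, smul_zero, add_zero, zero_add, hE_add, smul_mul_assoc, mul_smul_comm,
      hE_smul, hD_mul, hE_D t ht, h.a, smul_add, Matrix.smul_mul, Matrix.mul_smul]
    rw [hν']
    module
  · rw [hH, hT, hD_blocks, fromBlocks_multiply, fromBlocks_multiply, hE_blocks hμ hν, hsB_cons]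
    simp only [Matrix.mul_zero, Matrix.zero_mul, smul_zero, add_zero, zero_add, hE_add, smul_mul_assoc, mul_smul_comm,
      hE_smul, hD_mul, hE_D t ht, h.b, smul_add, Matrix.smul_mul, Matrix.mul_smul]
    rw [hν']
    module
  · have k1 : hE t (hD m a * Tᴴ * (T * hD m (star a))) = a * hsB L 1 * star a := by
      rw [← h.b1, ← hEm]; simp only [Matrix.mul_assoc]
    have k2 : hE t (T * hD m (star a) * (hD m a * Tᴴ)) = hsA L (star a * a) := by
      rw [← h.a, ← hD_mul]; simp only [Matrix.mul_assoc]
    rw [hH, hT, fromBlocks_multiply, fromBlocks_multiply, hE_blocks hμ hν]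
    simp only [Matrix.mul_zero, Matrix.zero_mul, smul_zero, add_zero, zero_add, hE_add, smul_mul_assoc, mul_smul_comm,
      hE_smul, hD_mul, hE_D t ht, h.c, smul_add, Matrix.smul_mul, Matrix.mul_smul, Matrix.mul_add, Matrix.add_mul,
      hE_mul_D, hE_D_mul, k1, k2, h.a1, hsA_cons, hsB_cons, hsA_add, hsA_smul, mul_add, add_mul, mul_one]
    rw [hν']
    simp only [mul_assoc]
    module
  · have k1 : hE t (hD m (star a) * T * (Tᴴ * hD m a)) = star a * hsA L 1 * a := by
      rw [← h.a1, ← hEm]; simp only [Matrix.mul_assoc]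
    have k2 : hE t (Tᴴ * hD m a * (hD m (star a) * T)) = hsB L (a * star a) := by
      rw [← h.b, ← hD_mul]; simp only [Matrix.mul_assoc]
    rw [hH, hT, fromBlocks_multiply, fromBlocks_multiply, hE_blocks hμ hν]
    simp only [Matrix.mul_zero, Matrix.zero_mul, smul_zero, add_zero, zero_add, hE_add, smul_mul_assoc, mul_smul_comm,
      hE_smul, hD_mul, hE_D t ht, h.d, smul_add, Matrix.smul_mul, Matrix.mul_smul, Matrix.mul_add, Matrix.add_mul,
      hE_mul_D, hE_D_mul, k1, k2, h.b1, hsA_cons, hsB_cons, hsB_add, hsB_smul, mul_add, add_mul, mul_one]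
    rw [hν']
    simp only [mul_assoc]
    module
end HC

end SliceMap

namespace SliceMap
open Matrix

lemma hypercube {𝒟 ℰ : Type*} [CStarAlgebra 𝒟] [CStarAlgebra ℰ] (l : List (𝒟 × ℰ × ℝ)) (hl : ∀ p ∈ l, 0 < p.2.2) :
    ∃ (m : Type) (_ : Fintype m) (_ : DecidableEq m) (t : m → ℝ) (T : Matrix m m 𝒟) (S : Matrix m m ℰ),
      ∑ i, (t i)^2 = 1 ∧ HC t T (l.map fun p => (1, p.2.2^2, p.1)) ∧
      HC t S (l.map fun p => ((p.2.2^2)⁻¹, 1, p.2.1)) ∧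
      (∀ Γ : 𝒟 →ₗ[ℂ] ℰ →ₗ[ℂ] ℂ, ∑ i, ∑ j, ((t i * t j : ℝ) : ℂ) * Γ (T i j) (S i j) = (l.map fun p => Γ p.1 p.2.1).sum) ∧
      Fintype.card m = 2 ^ l.length ∧
      (∀ i j, ‖T i j‖ ≤ (l.map fun p => (1 + p.2.2 + p.2.2⁻¹) * ‖p.1‖).sum) ∧
      (∀ i j, ‖S i j‖ ≤ (l.map fun p => (1 + p.2.2 + p.2.2⁻¹) * ‖p.2.1‖).sum) := by
  induction l with
  | nil =>
    refine ⟨Unit, inferInstance, inferInstance, fun _ => 1, 0, 0, by simp, ?_, ?_, ?_, by simp, by simp, by simp⟩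
    · constructor <;> simp [hE, hsA, hsB]
    · constructor <;> simp [hE, hsA, hsB]
    · intro Γ; simp
  | cons p l ih =>
    obtain ⟨m, i1, i2, t, T, S, ht, hT, hS, hΓ, hc, bT, bS⟩ := ih (fun q hq => hl q (List.mem_cons_of_mem _ hq))
    obtain ⟨a, b, τ⟩ := p
    have hτ : 0 < τ := hl (a, b, τ) List.mem_cons_self
    have hp : 0 < 1 + τ^2 := by positivity
    set μ : ℝ := 1 / (1 + τ^2) with hμ
    set ν : ℝ := τ^2 / (1 + τ^2) with hν
    have m0 : 0 ≤ μ := by positivity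
    have n0 : 0 ≤ ν := by positivity
    have mn : μ + ν = 1 := by rw [hμ, hν]; field_simp
    set c : ℝ := √(1 + τ^2) with hcd
    set c' : ℝ := c / τ with hcd'
    have cs : c^2 = 1 + τ^2 := Real.sq_sqrt hp.le
    have cpos : 0 < c := Real.sqrt_pos.2 hp
    have k1 : μ * c^2 = 1 := by rw [cs, hμ]; field_simp
    have k2 : ν * c^2 = τ^2 := by rw [cs, hν]; field_simp
    have k3 : μ * c'^2 = (τ^2)⁻¹ := by rw [hcd', div_pow, cs, hμ]; field_simp
    have k4 : ν * c'^2 = 1 := by rw [hcd', div_pow, cs, hν]; field_simp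
    have k5 : √μ * √ν * (c * c') = 1 := by
      rw [hcd', hμ, hν, Real.sqrt_div (by positivity), Real.sqrt_div (by positivity), Real.sqrt_sq hτ.le, ← hcd, Real.sqrt_one]
      field_simp
    have k6 : c ≤ 1 + τ := by
      rw [hcd]; apply Real.sqrt_le_iff.2; constructor
      · positivity
      · nlinarith
    have k7 : c' ≤ 1 + τ⁻¹ := by
      rw [hcd', div_le_iff₀ hτ]; field_simp; linarith
    have c'pos : 0 < c' := by positivity
    refine ⟨m ⊕ m, inferInstance, inferInstance, hw μ ν t, hStep T (c • a), hStep S (c' • b), hw_sum m0 n0 mn t ht, ?_, ?_, ?_, ?_, ?_, ?_⟩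
    · have := hT.step ht m0 n0 mn c a
      rw [k1, k2] at this; exact this
    · have := hS.step ht m0 n0 mn c' b
      rw [k3, k4] at this; exact this
    · intro Γ
      rw [List.map_cons, List.sum_cons, ← hΓ]
      simp only [Fintype.sum_sum_type, hStep, fromBlocks_apply₁₁, fromBlocks_apply₁₂, fromBlocks_apply₂₁, fromBlocks_apply₂₂, hw, Sum.elim_inl, Sum.elim_inr]
      have e1 : ∀ i, ∑ j, ((√μ * t i * (√ν * t j) : ℝ) : ℂ) * Γ (hD m (c • a) i j) (hD m (c' • b) i j) = ((t i ^2 : ℝ) : ℂ) * Γ a b := by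
        intro i
        rw [Finset.sum_eq_single i]
        · have : Γ (hD m (c • a) i i) (hD m (c' • b) i i) = ((c * c' : ℝ) : ℂ) * Γ a b := by
            simp only [hD, diagonal_apply_eq]
            rw [← Complex.coe_smul, ← Complex.coe_smul]
            simp [mul_assoc]
          rw [this, ← mul_assoc, ← Complex.ofReal_mul]
          congr 2
          linear_combination (t i ^2) * k5
        · intro j _ hj; simp [hD, hj.symm]
        · simp
      have e2 : ∀ i j, ((√μ * t i * (√μ * t j) : ℝ) : ℂ) = (μ : ℂ) * ((t i * t j : ℝ) : ℂ) := by
        intro i j; rw [← Complex.ofReal_mul]; congr 1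
        linear_combination (t i * t j) * Real.mul_self_sqrt m0
      have e3 : ∀ i j, ((√ν * t i * (√ν * t j) : ℝ) : ℂ) = (ν : ℂ) * ((t i * t j : ℝ) : ℂ) := by
        intro i j; rw [← Complex.ofReal_mul]; congr 1
        linear_combination (t i * t j) * Real.mul_self_sqrt n0
      simp only [Finset.sum_add_distrib, e1, e2, e3]
      simp only [mul_assoc (μ : ℂ), mul_assoc (ν : ℂ), ← Finset.mul_sum, ← Finset.sum_mul, ← Complex.ofReal_sum, ht]
      have : (μ : ℂ) + ν = 1 := by exact_mod_cast mn
      simp only [Complex.ofReal_one, one_mul, Matrix.zero_apply, map_zero, mul_zero, Finset.sum_const_zero]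
      linear_combination (∑ i, ∑ j, ((t i * t j : ℝ) : ℂ) * Γ (T i j) (S i j)) * this
    · simp [hc, pow_succ]; ring
    · have n1 : 0 ≤ (l.map fun p => (1 + p.2.2 + p.2.2⁻¹) * ‖p.1‖).sum := by
        apply List.sum_nonneg; intro x hx
        obtain ⟨q, hq, rfl⟩ := List.mem_map.1 hx
        have := hl q (List.mem_cons_of_mem _ hq)
        positivity
      have n2 : ‖c • a‖ ≤ (1 + τ + τ⁻¹) * ‖a‖ := by
        rw [norm_smul, Real.norm_of_nonneg cpos.le]
        have : 0 ≤ τ⁻¹ := by positivity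
        gcongr; linarith
      have n3 : 0 ≤ (1 + τ + τ⁻¹) * ‖a‖ := by positivity
      rw [List.map_cons, List.sum_cons]
      rintro (i | i) (j | j) <;> simp only [hStep, fromBlocks_apply₁₁, fromBlocks_apply₁₂, fromBlocks_apply₂₁, fromBlocks_apply₂₂]
      · linarith [bT i j]
      · by_cases h : i = j
        · simp only [hD, h, diagonal_apply_eq]; linarith
        · simp only [hD, diagonal_apply_ne _ h, norm_zero]; linarith
      · simp only [Matrix.zero_apply, norm_zero]; linarith
      · linarith [bT i j]
    · have n1 : 0 ≤ (l.map fun p => (1 + p.2.2 + p.2.2⁻¹) * ‖p.2.1‖).sum := by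
        apply List.sum_nonneg; intro x hx
        obtain ⟨q, hq, rfl⟩ := List.mem_map.1 hx
        have := hl q (List.mem_cons_of_mem _ hq)
        positivity
      have n2 : ‖c' • b‖ ≤ (1 + τ + τ⁻¹) * ‖b‖ := by
        rw [norm_smul, Real.norm_of_nonneg c'pos.le]
        gcongr; linarith
      have n3 : 0 ≤ (1 + τ + τ⁻¹) * ‖b‖ := by positivity
      rw [List.map_cons, List.sum_cons]
      rintro (i | i) (j | j) <;> simp only [hStep, fromBlocks_apply₁₁, fromBlocks_apply₁₂, fromBlocks_apply₂₁, fromBlocks_apply₂₂]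
      · linarith [bS i j]
      · by_cases h : i = j
        · simp only [hD, h, diagonal_apply_eq]; linarith
        · simp only [hD, diagonal_apply_ne _ h, norm_zero]; linarith
      · simp only [Matrix.zero_apply, norm_zero]; linarith
      · linarith [bS i j]

section ord
variable {𝒟 : Type*} [CStarAlgebra 𝒟] [PartialOrder 𝒟] [StarOrderedRing 𝒟]

lemma hsA_mono (L : List (ℝ × ℝ × 𝒟)) (hL : ∀ p ∈ L, 0 ≤ p.1) {x y : 𝒟} (h : x ≤ y) : hsA L x ≤ hsA L y := by
  apply List.sum_le_sum
  intro p hp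
  exact smul_le_smul_of_nonneg_left (star_right_conjugate_le_conjugate h _) (hL p hp)

lemma hsB_mono (L : List (ℝ × ℝ × 𝒟)) (hL : ∀ p ∈ L, 0 ≤ p.2.1) {x y : 𝒟} (h : x ≤ y) : hsB L x ≤ hsB L y := by
  apply List.sum_le_sum
  intro p hp
  exact smul_le_smul_of_nonneg_left (star_left_conjugate_le_conjugate h _) (hL p hp)

lemma hsA_norm (L : List (ℝ × ℝ × 𝒟)) (hL : ∀ p ∈ L, 0 ≤ p.1) {x : 𝒟} (h : 0 ≤ x) (hx : ‖x‖ ≤ 1) (h1 : ‖hsA L 1‖ ≤ 1) :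
    0 ≤ hsA L x ∧ ‖hsA L x‖ ≤ 1 := by
  have h0 : hsA L 0 ≤ hsA L x := hsA_mono L hL h
  have h2 : hsA L x ≤ hsA L 1 := hsA_mono L hL ((CStarAlgebra.norm_le_one_iff_of_nonneg x h).1 hx)
  have h3 : hsA L (0:𝒟) = 0 := by simp [hsA]
  rw [h3] at h0
  exact ⟨h0, (CStarAlgebra.norm_le_norm_of_nonneg_of_le h0 h2).trans h1⟩

lemma hsB_norm (L : List (ℝ × ℝ × 𝒟)) (hL : ∀ p ∈ L, 0 ≤ p.2.1) {x : 𝒟} (h : 0 ≤ x) (hx : ‖x‖ ≤ 1) (h1 : ‖hsB L 1‖ ≤ 1) :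
    0 ≤ hsB L x ∧ ‖hsB L x‖ ≤ 1 := by
  have h0 : hsB L 0 ≤ hsB L x := hsB_mono L hL h
  have h2 : hsB L x ≤ hsB L 1 := hsB_mono L hL ((CStarAlgebra.norm_le_one_iff_of_nonneg x h).1 hx)
  have h3 : hsB L (0:𝒟) = 0 := by simp [hsB]
  rw [h3] at h0
  exact ⟨h0, (CStarAlgebra.norm_le_norm_of_nonneg_of_le h0 h2).trans h1⟩

end ord

def hHat {m 𝒟 : Type*} [Star 𝒟] [Zero 𝒟] (T : Matrix m m 𝒟) : Matrix (m ⊕ m) (m ⊕ m) 𝒟 := fromBlocks 0 T Tᴴ 0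

lemma HC.hat4 {𝒟 : Type*} [CStarAlgebra 𝒟] {m : Type} [Fintype m] [DecidableEq m] {t : m → ℝ} {T : Matrix m m 𝒟} {L : List (ℝ × ℝ × 𝒟)}
    (h : HC t T L) (hL : ∀ p ∈ L, 0 ≤ p.1 ∧ 0 ≤ p.2.1) (hA : ‖hsA L 1‖ ≤ 1) (hB : ‖hsB L 1‖ ≤ 1) :
    IsSelfAdjoint (hE (hw (1/2) (1/2) t) (hHat T ^ 4)) ∧ ‖hE (hw (1/2) (1/2) t) (hHat T ^ 4)‖ ≤ 2 := by
  letI := CStarAlgebra.spectralOrder 𝒟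
  haveI := CStarAlgebra.spectralOrderedRing 𝒟
  have e4 : hHat T ^ 4 = fromBlocks (T * Tᴴ * (T * Tᴴ)) 0 0 (Tᴴ * T * (Tᴴ * T)) := by
    rw [show (4:ℕ) = 2 * 2 from rfl, pow_mul, pow_two, pow_two, hHat, fromBlocks_multiply, fromBlocks_multiply]
    simp
  rw [e4, hE_blocks (by norm_num) (by norm_num), h.c, h.d]
  rcases subsingleton_or_nontrivial 𝒟 with hs | hs
  · constructor
    · exact Subsingleton.elim _ _
    · rw [Subsingleton.elim (_ + _ : 𝒟) 0]; simp
  obtain ⟨p0, p1⟩ := hsA_norm L (fun p hp => (hL p hp).1) (x := 1) zero_le_one (by simp) hA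
  obtain ⟨q0, q1⟩ := hsB_norm L (fun p hp => (hL p hp).2) (x := 1) zero_le_one (by simp) hB
  obtain ⟨r0, r1⟩ := hsA_norm L (fun p hp => (hL p hp).1) q0 q1 hA
  obtain ⟨s0, s1⟩ := hsB_norm L (fun p hp => (hL p hp).2) p0 p1 hB
  set P := hsA L 1
  set Q := hsB L 1
  have sq : ∀ x : 𝒟, 0 ≤ x → IsSelfAdjoint (x * x) := fun x hx => by
    have := IsSelfAdjoint.of_nonneg hx
    exact this.commute_iff this |>.1 (Commute.refl x)
  constructor
  · refine IsSelfAdjoint.add ?_ ?_ <;> refine IsSelfAdjoint.smul (by simp [IsSelfAdjoint]) ?_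
    · exact (sq P p0).add (IsSelfAdjoint.of_nonneg r0)
    · exact (sq Q q0).add (IsSelfAdjoint.of_nonneg s0)
  · have mm : ∀ x : 𝒟, ‖x‖ ≤ 1 → ‖x * x‖ ≤ 1 := fun x hx => (norm_mul_le _ _).trans (mul_le_one₀ hx (norm_nonneg _) hx)
    refine (norm_add_le _ _).trans ?_
    rw [norm_smul, norm_smul]
    have a1 := norm_add_le (P * P) (hsA L Q)
    have a2 := norm_add_le (Q * Q) (hsB L P)
    have := mm P p1
    have := mm Q q1
    norm_num
    linarith

end SliceMap

namespace SliceMap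
open Matrix

lemma re_sa_le {𝒟 : Type*} [CStarAlgebra 𝒟] (f : 𝒟 →ₗ[ℂ] ℂ) {N : ℝ} (hf : ∀ U ∈ unitary 𝒟, (f U).re ≤ N) {z : 𝒟}
    (hz : IsSelfAdjoint z) (h2 : ‖z‖ ≤ 2) : (f z).re ≤ 2 * N := by
  letI := CStarAlgebra.spectralOrder 𝒟
  haveI := CStarAlgebra.spectralOrderedRing 𝒟
  have ha : IsSelfAdjoint ((1/2:ℝ) • z) := IsSelfAdjoint.smul (by simp [IsSelfAdjoint]) hz
  have hn : ‖(1/2:ℝ) • z‖ ≤ 1 := by rw [norm_smul]; norm_num; linarith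
  have hn' : ‖-((1/2:ℝ) • z)‖ ≤ 1 := by rwa [norm_neg]
  have h1 := ha.self_add_I_smul_cfcSqrt_sub_sq_mem_unitary _ hn
  have h1' := Unitary.star_mem h1
  have h3 : z = ((1/2:ℝ) • z + Complex.I • CFC.sqrt (1 - ((1/2:ℝ) • z)^2)) + star ((1/2:ℝ) • z + Complex.I • CFC.sqrt (1 - ((1/2:ℝ) • z)^2)) := by
    have hq : star (CFC.sqrt (1 - ((1/2:ℝ) • z) ^ 2)) = CFC.sqrt (1 - ((1/2:ℝ) • z) ^ 2) := (IsSelfAdjoint.of_nonneg (CFC.sqrt_nonneg (1 - ((1/2:ℝ) • z) ^ 2))).star_eq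
    rw [star_add, ha.star_eq, star_smul Complex.I (CFC.sqrt _), hq]
    simp
    module
  rw [h3, map_add, Complex.add_re]
  linarith [hf _ h1, hf _ h1']

section
variable {𝒟 ℰ : Type*} [CStarAlgebra 𝒟] [CStarAlgebra ℰ]
  {m : Type} [Fintype m] [DecidableEq m]

def gAmp (Γ0 : 𝒟 →ₗ[ℂ] ℰ →ₗ[ℂ] ℂ) (t : m → ℝ) : CStarMatrix m m 𝒟 →ₗ[ℂ] CStarMatrix m m ℰ →ₗ[ℂ] ℂ :=
  LinearMap.mk₂ ℂ (fun X Y => ∑ i, ∑ j, ((t i * t j : ℝ) : ℂ) * Γ0 (X i j) (Y i j))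
    (by intro x y z; simp only [CStarMatrix.add_apply, map_add, LinearMap.add_apply, mul_add, Finset.sum_add_distrib])
    (by intro c x z; simp only [CStarMatrix.smul_apply, map_smul, LinearMap.smul_apply, smul_eq_mul, Finset.mul_sum, mul_left_comm c])
    (by intro x y z; simp only [CStarMatrix.add_apply, map_add, mul_add, Finset.sum_add_distrib])
    (by intro c x z; simp only [CStarMatrix.smul_apply, map_smul, smul_eq_mul, Finset.mul_sum, mul_left_comm c])

lemma gAmp_apply (Γ0 : 𝒟 →ₗ[ℂ] ℰ →ₗ[ℂ] ℂ) (t : m → ℝ) (X : CStarMatrix m m 𝒟) (Y : CStarMatrix m m ℰ) :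
    gAmp Γ0 t X Y = ∑ i, ∑ j, ((t i * t j : ℝ) : ℂ) * Γ0 (X i j) (Y i j) := rfl

lemma gAmp_one_right (Γ0 : 𝒟 →ₗ[ℂ] ℰ →ₗ[ℂ] ℂ) (t : m → ℝ) (X : CStarMatrix m m 𝒟) :
    gAmp Γ0 t X 1 = Γ0 (hE t (CStarMatrix.ofMatrix.symm X)) 1 := by
  rw [gAmp_apply, hE, map_sum, LinearMap.sum_apply]
  refine Finset.sum_congr rfl fun i _ => ?_
  rw [Finset.sum_eq_single i]
  · rw [CStarMatrix.one_apply, if_pos rfl, ← Complex.coe_smul, map_smul, LinearMap.smul_apply, smul_eq_mul, pow_two]; rfl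
  · intro j _ hj; rw [CStarMatrix.one_apply, if_neg hj.symm]; simp
  · simp

lemma gAmp_one_left (Γ0 : 𝒟 →ₗ[ℂ] ℰ →ₗ[ℂ] ℂ) (t : m → ℝ) (Y : CStarMatrix m m ℰ) :
    gAmp Γ0 t 1 Y = Γ0 1 (hE t (CStarMatrix.ofMatrix.symm Y)) := by
  rw [gAmp_apply, hE, map_sum]
  refine Finset.sum_congr rfl fun i _ => ?_
  rw [Finset.sum_eq_single i]
  · rw [CStarMatrix.one_apply, if_pos rfl, ← Complex.coe_smul, map_smul, smul_eq_mul, pow_two]; rfl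
  · intro j _ hj; rw [CStarMatrix.one_apply, if_neg hj.symm]; simp
  · simp

lemma hat_norm [PartialOrder 𝒟] [StarOrderedRing 𝒟] (T : Matrix m m 𝒟) {R : ℝ} (h : ∀ i j, ‖T i j‖ ≤ R) :
    ‖CStarMatrix.ofMatrix (hHat T)‖ ≤ 2 * (Fintype.card m)^2 * R := by
  refine (cstarMatrix_norm_le _).trans ?_
  simp only [Fintype.sum_sum_type, CStarMatrix.ofMatrix_apply, hHat, fromBlocks_apply₁₁, fromBlocks_apply₁₂, fromBlocks_apply₂₁, fromBlocks_apply₂₂, Matrix.zero_apply, norm_zero, Finset.sum_const_zero, conjTranspose_apply, norm_star]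
  have : ∑ i, ∑ j, ‖T i j‖ ≤ (Fintype.card m)^2 * R := by
    refine (Finset.sum_le_sum fun i _ => Finset.sum_le_sum fun j _ => h i j).trans ?_
    simp; ring_nf; exact le_rfl
  have h2 : ∑ i, ∑ j, ‖T j i‖ ≤ (Fintype.card m)^2 * R := by
    rw [Finset.sum_comm]; exact this
  simp only [zero_add, add_zero]
  linarith

lemma hat_sa [PartialOrder 𝒟] [StarOrderedRing 𝒟] (T : Matrix m m 𝒟) : IsSelfAdjoint (CStarMatrix.ofMatrix (hHat T)) := by
  change CStarMatrix.ofMatrix (hHat T)ᴴ = _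
  rw [hHat, fromBlocks_conjTranspose]; simp

end

lemma lemU0 {𝒟 ℰ : Type*} [CStarAlgebra 𝒟] [CStarAlgebra ℰ] (Γ0 : 𝒟 →ₗ[ℂ] ℰ →ₗ[ℂ] ℂ) {N δ : ℝ}
    (hU : ∀ (m : Type) [Fintype m] [DecidableEq m] (t : m → ℝ), ∑ i, (t i)^2 = 1 → ∀ (V : Matrix m m 𝒟) (W : Matrix m m ℰ),
      Vᴴ * V = 1 → V * Vᴴ = 1 → Wᴴ * W = 1 → W * Wᴴ = 1 → (∑ i, ∑ j, ((t i * t j : ℝ) : ℂ) * Γ0 (V i j) (W i j)).re ≤ N)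
    (hδ : N - δ ≤ (Γ0 1 1).re) (δ0 : 0 < δ) (δ1 : δ ≤ 1) (l : List (𝒟 × ℰ × ℝ)) (hl : ∀ p ∈ l, 0 < p.2.2)
    (h1 : ‖hsA (l.map fun p => ((1:ℝ), p.2.2^2, p.1)) 1‖ ≤ 1)
    (h2 : ‖hsB (l.map fun p => ((1:ℝ), p.2.2^2, p.1)) 1‖ ≤ 1)
    (h3 : ‖hsA (l.map fun p => ((p.2.2^2)⁻¹, (1:ℝ), p.2.1)) 1‖ ≤ 1)
    (h4 : ‖hsB (l.map fun p => ((p.2.2^2)⁻¹, (1:ℝ), p.2.1)) 1‖ ≤ 1)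
    (M : ℕ) (hM1 : 2 * ((2:ℝ) ^ l.length)^2 * (l.map fun p => (1 + p.2.2 + p.2.2⁻¹) * ‖p.1‖).sum ≤ 2 ^ M)
    (hM2 : 2 * ((2:ℝ) ^ l.length)^2 * (l.map fun p => (1 + p.2.2 + p.2.2⁻¹) * ‖p.2.1‖).sum ≤ 2 ^ M) :
    ‖(l.map fun p => Γ0 p.1 p.2.1).sum‖ ≤ 8 * (1024 * N + (M+1)^2 * VH.KM M N * √δ) := by
  letI := CStarAlgebra.spectralOrder 𝒟
  haveI := CStarAlgebra.spectralOrderedRing 𝒟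
  letI := CStarAlgebra.spectralOrder ℰ
  haveI := CStarAlgebra.spectralOrderedRing ℰ
  obtain ⟨m, i1, i2, t, T, S, ht, hT, hS, hΓ, hc, bT, bS⟩ := hypercube l hl
  set th := hw (1/2) (1/2) t with hth
  have hth1 : ∑ i, (th i)^2 = 1 := hw_sum (by norm_num) (by norm_num) (by norm_num) t ht
  set Γ := gAmp Γ0 th (m := m ⊕ m) with hΓd
  have hUn : ∀ U ∈ unitary (CStarMatrix (m ⊕ m) (m ⊕ m) 𝒟), ∀ U' ∈ unitary (CStarMatrix (m ⊕ m) (m ⊕ m) ℰ), (Γ U U').re ≤ N := by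
    intro U hU1 U' hU2
    exact hU (m ⊕ m) th hth1 U U' hU1.1 hU1.2 hU2.1 hU2.2
  have hE1 : hE th (1 : Matrix (m ⊕ m) (m ⊕ m) 𝒟) = 1 := by
    have := hE_D th hth1 (1 : 𝒟)
    simpa [hD] using this
  have h11 : Γ 1 1 = Γ0 1 1 := by
    rw [hΓd, gAmp_one_right]
    congr 2
  have hf1 : ∀ U ∈ unitary 𝒟, (Γ0 U 1).re ≤ N := by
    intro U hU1
    have := hU Unit (fun _ => 1) (by simp) (Matrix.of fun _ _ => U) 1 (by ext; simpa [Matrix.mul_apply] using hU1.1) (by ext; simpa [Matrix.mul_apply] using hU1.2) (by simp) (by simp)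
    simpa using this
  have hf2 : ∀ U ∈ unitary ℰ, (Γ0 1 U).re ≤ N := by
    intro U hU1
    have := hU Unit (fun _ => 1) (by simp) 1 (Matrix.of fun _ _ => U) (by simp) (by simp) (by ext; simpa [Matrix.mul_apply] using hU1.1) (by ext; simpa [Matrix.mul_apply] using hU1.2)
    simpa using this
  have q1 := hT.hat4 (by
    intro p hp; obtain ⟨q, hq, rfl⟩ := List.mem_map.1 hp
    have := hl q hq
    constructor <;> positivity) h1 h2
  have q2 : ∀ S : Matrix m m ℰ, HC t S (l.map fun p => ((p.2.2^2)⁻¹, 1, p.2.1)) → IsSelfAdjoint (hE th (hHat S ^ 4)) ∧ ‖hE th (hHat S ^ 4)‖ ≤ 2 := fun S hS => hS.hat4 (by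
    intro p hp; obtain ⟨q, hq, rfl⟩ := List.mem_map.1 hp
    have := hl q hq
    constructor <;> positivity) h3 h4
  have nT : ‖CStarMatrix.ofMatrix (hHat T)‖ ≤ 2 ^ M := by
    refine (hat_norm T bT).trans (le_trans (le_of_eq ?_) hM1)
    rw [hc]; push_cast; ring
  have T4 : (Γ (CStarMatrix.ofMatrix (hHat T) ^ 4) 1).re ≤ 2 * N := by
    rw [hΓd, gAmp_one_right]
    exact re_sa_le (Γ0.flip 1) hf1 q1.1 q1.2
  have key : ∀ S' : Matrix m m ℰ, HC t S' (l.map fun p => ((p.2.2^2)⁻¹, 1, p.2.1)) → (∀ i j, ‖S' i j‖ = ‖S i j‖) →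
      ‖Γ (CStarMatrix.ofMatrix (hHat T)) (CStarMatrix.ofMatrix (hHat S'))‖ ≤ 4 * (1024 * N + (M+1)^2 * VH.KM M N * √δ) := by
    intro S' hS' hn
    refine lemV Γ hUn (by rw [h11]; exact hδ) δ0 δ1 M (hat_sa T) (hat_sa S') nT ?_ T4 ?_
    · refine (hat_norm S' (fun i j => (hn i j).le.trans (bS i j))).trans (le_trans (le_of_eq ?_) hM2)
      rw [hc]; push_cast; ring
    · rw [hΓd, gAmp_one_left]
      exact re_sa_le (Γ0 1) hf2 (q2 S' hS').1 (q2 S' hS').2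
  have hSi : HC t (Complex.I • S) (l.map fun p => ((p.2.2^2)⁻¹, 1, p.2.1)) := by
    have e1 : ∀ X : Matrix m m ℰ, Complex.I • S * X * (Complex.I • S)ᴴ = S * X * Sᴴ := by
      intro X; rw [conjTranspose_smul, Matrix.smul_mul, Matrix.smul_mul, Matrix.mul_smul, smul_smul]; simp
    have e2 : ∀ X : Matrix m m ℰ, (Complex.I • S)ᴴ * X * (Complex.I • S) = Sᴴ * X * S := by
      intro X; rw [conjTranspose_smul, Matrix.smul_mul, Matrix.smul_mul, Matrix.mul_smul, smul_smul]; simp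
    have e3 : Complex.I • S * (Complex.I • S)ᴴ = S * Sᴴ := by simpa using e1 1
    have e4 : (Complex.I • S)ᴴ * (Complex.I • S) = Sᴴ * S := by simpa using e2 1
    refine ⟨?_, ?_, ?_, ?_⟩
    · intro x; rw [e1, hS.a]
    · intro x; rw [e2, hS.b]
    · rw [e3, hS.c]
    · rw [e4, hS.d]
  have k1 := key S hS (fun _ _ => rfl)
  have k2 := key (Complex.I • S) hSi (fun i j => by simp [norm_smul])
  have hexp : ∀ S' : Matrix m m ℰ, Γ (CStarMatrix.ofMatrix (hHat T)) (CStarMatrix.ofMatrix (hHat S')) =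
      (1/2 : ℂ) * (∑ i, ∑ j, ((t i * t j : ℝ) : ℂ) * Γ0 (T i j) (S' i j)) + (1/2 : ℂ) * (∑ i, ∑ j, ((t i * t j : ℝ) : ℂ) * Γ0 (star (T j i)) (star (S' j i))) := by
    intro S'
    rw [hΓd, gAmp_apply]
    have e2 : ∀ i j, ((√(1/2) * t i * (√(1/2) * t j) : ℝ) : ℂ) = (1/2 : ℂ) * ((t i * t j : ℝ) : ℂ) := by
      intro i j
      rw [show (1/2 : ℂ) = ((1/2 : ℝ) : ℂ) by norm_num, ← Complex.ofReal_mul]; congr 1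
      linear_combination (t i * t j) * Real.mul_self_sqrt (show (0:ℝ) ≤ 1/2 by norm_num)
    simp only [Fintype.sum_sum_type, CStarMatrix.ofMatrix_apply, hHat, fromBlocks_apply₁₁, fromBlocks_apply₁₂, fromBlocks_apply₂₁, fromBlocks_apply₂₂, Matrix.zero_apply, map_zero, mul_zero, Finset.sum_const_zero, conjTranspose_apply, hth, hw, Sum.elim_inl, Sum.elim_inr, e2, zero_add, add_zero, mul_assoc (1/2 : ℂ), ← Finset.mul_sum]
  have hX : (l.map fun p => Γ0 p.1 p.2.1).sum = Γ (CStarMatrix.ofMatrix (hHat T)) (CStarMatrix.ofMatrix (hHat S)) - Complex.I * Γ (CStarMatrix.ofMatrix (hHat T)) (CStarMatrix.ofMatrix (hHat (Complex.I • S))) := by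
    rw [← hΓ Γ0, hexp, hexp]
    simp only [Matrix.smul_apply, map_smul, star_smul, smul_eq_mul, mul_left_comm _ Complex.I, mul_left_comm _ (star Complex.I), ← Finset.mul_sum]
    simp only [Complex.star_def, Complex.conj_I]
    ring_nf
    rw [Complex.I_sq]
    ring
  rw [hX]
  refine (norm_sub_le _ _).trans ?_
  rw [norm_mul, Complex.norm_I, one_mul]
  linarith

end SliceMap

namespace SliceMap
open Matrix

section
variable {A B : Type*} [CStarAlgebra A] [CStarAlgebra B] 
  {m n : Type} [Fintype m] [DecidableEq m] [Fintype n] [DecidableEq n]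

lemma comp_unitary1 [PartialOrder A] [StarOrderedRing A] {X Y : Matrix m m (CStarMatrix n n A)} (h : X * Y = 1) :
    (Matrix.of fun p q : m × n => X p.1 q.1 p.2 q.2) * (Matrix.of fun p q : m × n => Y p.1 q.1 p.2 q.2) = 1 := by
  ext ⟨i, k⟩ ⟨j, l⟩
  have h1 : (X * Y) i j k l = (1 : Matrix m m (CStarMatrix n n A)) i j k l := by rw [h]
  have hs : ∀ (f : m → CStarMatrix n n A), (∑ p, f p) k l = ∑ p, f p k l := by
    intro f
    exact Matrix.sum_apply k l Finset.univ (fun p => CStarMatrix.ofMatrix.symm (f p))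
  rw [Matrix.mul_apply, hs] at h1
  rw [Matrix.mul_apply, Fintype.sum_prod_type]
  simp only [CStarMatrix.mul_apply] at h1
  simp only [Matrix.of_apply, h1, Matrix.one_apply]
  by_cases h : i = j
  · by_cases h' : k = l
    · simp [h, h', CStarMatrix.one_apply]
    · simp [h, h', CStarMatrix.one_apply]
  · simp [h]

lemma cstar_isCN [PartialOrder A] [StarOrderedRing A] : IsCStarNorm (fun X : Matrix n n A => ‖CStarMatrix.ofMatrix X‖) where
  add_le x y := norm_add_le (CStarMatrix.ofMatrix x) (CStarMatrix.ofMatrix y)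
  smul_eq c x := norm_smul c (CStarMatrix.ofMatrix x)
  eq_zero_of x h := (norm_eq_zero (a := CStarMatrix.ofMatrix x)).1 h
  mul_le x y := norm_mul_le (CStarMatrix.ofMatrix x) (CStarMatrix.ofMatrix y)
  star_mul_self x := CStarRing.norm_star_mul_self (x := CStarMatrix.ofMatrix x)

def cD (n : Type) [Fintype n] [DecidableEq n] (a : A) : CStarMatrix n n A := CStarMatrix.ofMatrix (Matrix.diagonal fun _ => a)

lemma cD_mul [PartialOrder A] [StarOrderedRing A] (a b : A) : cD n a * cD n b = cD n (a * b) := by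
  change CStarMatrix.ofMatrix (Matrix.diagonal _ * Matrix.diagonal _) = _
  simp [cD]
lemma cD_star [PartialOrder A] [StarOrderedRing A] (a : A) : star (cD n a) = cD n (star a) := by
  change CStarMatrix.ofMatrix (Matrix.diagonal _)ᴴ = _
  rw [Matrix.diagonal_conjTranspose]; rfl
lemma cD_add [PartialOrder A] [StarOrderedRing A] (a b : A) : cD n (a + b) = cD n a + cD n b := by
  change _ = CStarMatrix.ofMatrix ((Matrix.diagonal fun _ => a) + Matrix.diagonal fun _ => b)
  simp [cD]
lemma cD_smul [PartialOrder A] [StarOrderedRing A] (r : ℝ) (a : A) : cD n (r • a) = r • cD n a := by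
  change _ = CStarMatrix.ofMatrix (r • Matrix.diagonal fun _ => a)
  rw [← Matrix.diagonal_smul]; rfl
lemma cD_norm [PartialOrder A] [StarOrderedRing A] (a : A) : ‖cD n a‖ ≤ ‖a‖ := cn_diag_le cstar_isCN a

lemma hs_cD [PartialOrder A] [StarOrderedRing A] (v : CStarMatrix n n A) (h1 : star v * v = 1) (h2 : v * star v = 1) (L : List (ℝ × ℝ × A)) :
    hsA (L.map fun p => (p.1, p.2.1, star v * cD n p.2.2)) 1 = star v * cD n (hsA L 1) * v ∧
    hsB (L.map fun p => (p.1, p.2.1, star v * cD n p.2.2)) 1 = cD n (hsB L 1) := by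
  induction L with
  | nil => simp [hsA, hsB, cD]
  | cons p L ih =>
    obtain ⟨r, s, a⟩ := p
    rw [List.map_cons, hsA_cons, hsB_cons, hsA_cons, hsB_cons, ih.1, ih.2, cD_add, cD_add, cD_smul, cD_smul]
    constructor
    · rw [mul_add, add_mul, star_mul, star_star, mul_one, mul_one, ← cD_mul, cD_star, mul_smul_comm, smul_mul_assoc]
      simp only [mul_assoc]
    · rw [star_mul, star_star, mul_one, mul_one, ← cD_mul, cD_star]
      simp only [mul_assoc]
      rw [← mul_assoc v, h2, one_mul]

lemma hs_cD_norm [PartialOrder A] [StarOrderedRing A] (v : CStarMatrix n n A) (h1 : star v * v = 1) (h2 : v * star v = 1) (L : List (ℝ × ℝ × A))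
    (k1 : ‖hsA L 1‖ ≤ 1) (k2 : ‖hsB L 1‖ ≤ 1) :
    ‖hsA (L.map fun p => (p.1, p.2.1, star v * cD n p.2.2)) 1‖ ≤ 1 ∧
    ‖hsB (L.map fun p => (p.1, p.2.1, star v * cD n p.2.2)) 1‖ ≤ 1 := by
  have hv : v ∈ unitary (CStarMatrix n n A) := ⟨h1, h2⟩
  have hv' := Unitary.star_mem hv
  rw [(hs_cD v h1 h2 L).1, (hs_cD v h1 h2 L).2]
  constructor
  · rw [CStarRing.norm_mul_mem_unitary _ hv, CStarRing.norm_mem_unitary_mul _ hv']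
    exact (cD_norm _).trans k1
  · exact (cD_norm _).trans k2
end

def UBound {A B : Type*} [CStarAlgebra A] [CStarAlgebra B] (F : A →ₗ[ℂ] B →ₗ[ℂ] ℂ) (K : ℝ) : Prop :=
  ∀ (n : Type) [Fintype n] [DecidableEq n] (s : n → ℝ), ∑ i, (s i)^2 = 1 → ∀ (v : Matrix n n A) (w : Matrix n n B),
      vᴴ * v = 1 → v * vᴴ = 1 → wᴴ * w = 1 → w * wᴴ = 1 → (∑ i, ∑ j, ((s i * s j : ℝ) : ℂ) * F (v i j) (w i j)).re ≤ K

def G0 {A B : Type*} [CStarAlgebra A] [CStarAlgebra B] [PartialOrder A] [StarOrderedRing A] [PartialOrder B] [StarOrderedRing B]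
    (F : A →ₗ[ℂ] B →ₗ[ℂ] ℂ)
    {n : Type} [Fintype n] [DecidableEq n] (s : n → ℝ) (v : CStarMatrix n n A) (w : CStarMatrix n n B) :
    CStarMatrix n n A →ₗ[ℂ] CStarMatrix n n B →ₗ[ℂ] ℂ :=
  (gAmp F s).compl₁₂ (LinearMap.mulLeft ℂ v) (LinearMap.mulLeft ℂ w)

lemma hDv_unitary {A : Type*} [CStarAlgebra A] [PartialOrder A] [StarOrderedRing A] {m n : Type} [Fintype m] [DecidableEq m] [Fintype n] [DecidableEq n]
    {v : CStarMatrix n n A} {V : Matrix m m (CStarMatrix n n A)} (h1 : star v * v = 1) (h2 : v * star v = 1) (e1 : Vᴴ * V = 1) (e2 : V * Vᴴ = 1) :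
    (hD m v * V)ᴴ * (hD m v * V) = 1 ∧ (hD m v * V) * (hD m v * V)ᴴ = 1 := by
  have d1 : hD m (1 : CStarMatrix n n A) = 1 := by simp [hD]
  rw [conjTranspose_mul, hD_star]
  constructor
  · rw [Matrix.mul_assoc, ← Matrix.mul_assoc (hD m (star v)), hD_mul, h1, d1, Matrix.one_mul, e1]
  · rw [Matrix.mul_assoc, ← Matrix.mul_assoc V, e2, Matrix.one_mul, hD_mul, h2, d1]

lemma hDv_apply {A : Type*} [CStarAlgebra A] [PartialOrder A] [StarOrderedRing A] {m n : Type} [Fintype m] [DecidableEq m] [Fintype n] [DecidableEq n]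
    (v : CStarMatrix n n A) (V : Matrix m m (CStarMatrix n n A)) (i j : m) : (hD m v * V) i j = v * V i j := by
  simp [hD]

lemma UBound.amp {A B : Type*} [CStarAlgebra A] [CStarAlgebra B] [PartialOrder A] [StarOrderedRing A] [PartialOrder B] [StarOrderedRing B]
    {F : A →ₗ[ℂ] B →ₗ[ℂ] ℂ} {N : ℝ}
    (hN : UBound F N) {n : Type} [Fintype n] [DecidableEq n] (s : n → ℝ) (hs : ∑ i, (s i)^2 = 1)
    {v : CStarMatrix n n A} {w : CStarMatrix n n B} (h1 : star v * v = 1) (h2 : v * star v = 1) (h3 : star w * w = 1) (h4 : w * star w = 1) :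
    UBound (G0 F s v w) N := by
  intro m _ _ t ht V W e1 e2 e3 e4
  obtain ⟨a1, a2⟩ := hDv_unitary h1 h2 e1 e2
  obtain ⟨b1, b2⟩ := hDv_unitary h3 h4 e3 e4
  have hk := hN (m × n) (fun p => t p.1 * s p.2)
    (by simp only [Fintype.sum_prod_type, mul_pow, ← Finset.mul_sum, hs, mul_one, ht])
    (Matrix.of fun p q : m × n => (hD m v * V) p.1 q.1 p.2 q.2) (Matrix.of fun p q : m × n => (hD m w * W) p.1 q.1 p.2 q.2)
    (comp_unitary1 a1) (comp_unitary1 a2) (comp_unitary1 b1) (comp_unitary1 b2)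
  refine le_of_eq_of_le (congrArg Complex.re ?_) hk
  simp only [Fintype.sum_prod_type, G0, LinearMap.compl₁₂_apply, gAmp_apply, LinearMap.mulLeft_apply, Matrix.of_apply, Finset.mul_sum]
  refine Finset.sum_congr rfl fun i _ => ?_
  rw [Finset.sum_comm]
  refine Finset.sum_congr rfl fun k _ => Finset.sum_congr rfl fun j _ => Finset.sum_congr rfl fun l _ => ?_
  rw [← mul_assoc]
  rw [hDv_apply v V, hDv_apply w W]
  congr 1
  push_cast; ring

end SliceMap

namespace SliceMap
open Matrix

/-- the set of values attained in `UBound`. -/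
def USet {A B : Type*} [CStarAlgebra A] [CStarAlgebra B] (F : A →ₗ[ℂ] B →ₗ[ℂ] ℂ) : Set ℝ :=
  {r | ∃ (n : Type) (_ : Fintype n) (_ : DecidableEq n) (s : n → ℝ) (v : Matrix n n A) (w : Matrix n n B),
    ∑ i, (s i)^2 = 1 ∧ vᴴ * v = 1 ∧ v * vᴴ = 1 ∧ wᴴ * w = 1 ∧ w * wᴴ = 1 ∧
    r = (∑ i, ∑ j, ((s i * s j : ℝ) : ℂ) * F (v i j) (w i j)).re}

lemma list_sum_le {X : Type*} (l : List X) (f g : X → ℝ) (h : ∀ p ∈ l, f p ≤ g p) : (l.map f).sum ≤ (l.map g).sum :=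
  List.sum_le_sum h

theorem thmU {A B : Type*} [CStarAlgebra A] [CStarAlgebra B] {F : A →ₗ[ℂ] B →ₗ[ℂ] ℂ} {K : ℝ} (hK : UBound F K)
    (l : List (A × B × ℝ)) (hl : ∀ p ∈ l, 0 < p.2.2)
    (h1 : ‖hsA (l.map fun p => ((1:ℝ), p.2.2^2, p.1)) 1‖ ≤ 1)
    (h2 : ‖hsB (l.map fun p => ((1:ℝ), p.2.2^2, p.1)) 1‖ ≤ 1)
    (h3 : ‖hsA (l.map fun p => ((p.2.2^2)⁻¹, (1:ℝ), p.2.1)) 1‖ ≤ 1)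
    (h4 : ‖hsB (l.map fun p => ((p.2.2^2)⁻¹, (1:ℝ), p.2.1)) 1‖ ≤ 1) :
    ‖(l.map fun p => F p.1 p.2.1).sum‖ ≤ 8192 * K := by
  letI := CStarAlgebra.spectralOrder A
  haveI := CStarAlgebra.spectralOrderedRing A
  letI := CStarAlgebra.spectralOrder B
  haveI := CStarAlgebra.spectralOrderedRing B
  set N := sSup (USet F) with hN
  have bdd : BddAbove (USet F) := by
    refine ⟨K, ?_⟩
    rintro r ⟨n, _, _, s, v, w, hs, a1, a2, a3, a4, rfl⟩
    exact hK n s hs v w a1 a2 a3 a4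
  have ne : (USet F).Nonempty := ⟨_, Unit, inferInstance, inferInstance, fun _ => 1, 1, 1, by simp, by simp, by simp, by simp, by simp, rfl⟩
  have NK : N ≤ K := by
    apply csSup_le ne
    rintro r ⟨n, _, _, s, v, w, hs, a1, a2, a3, a4, rfl⟩
    exact hK n s hs v w a1 a2 a3 a4
  have hUN : UBound F N := by
    intro n _ _ s hs v w a1 a2 a3 a4
    exact le_csSup bdd ⟨n, _, _, s, v, w, hs, a1, a2, a3, a4, rfl⟩
  obtain ⟨M1, hM1⟩ := pow_unbounded_of_one_lt (2 * ((2:ℝ) ^ l.length)^2 * (l.map fun p => (1 + p.2.2 + p.2.2⁻¹) * ‖p.1‖).sum) (one_lt_two)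
  obtain ⟨M2, hM2⟩ := pow_unbounded_of_one_lt (2 * ((2:ℝ) ^ l.length)^2 * (l.map fun p => (1 + p.2.2 + p.2.2⁻¹) * ‖p.2.1‖).sum) (one_lt_two)
  set M := max M1 M2
  have hM1' : (2:ℝ)^M1 ≤ 2^M := pow_le_pow_right₀ one_le_two (le_max_left _ _)
  have hM2' : (2:ℝ)^M2 ≤ 2^M := pow_le_pow_right₀ one_le_two (le_max_right _ _)
  have main : ∀ δ : ℝ, 0 < δ → δ ≤ 1 → ‖(l.map fun p => F p.1 p.2.1).sum‖ ≤ 8 * (1024 * N + (M+1)^2 * VH.KM M N * √δ) := by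
    intro δ δ0 δ1
    obtain ⟨r, ⟨n, _, _, s, v, w, hs, a1, a2, a3, a4, rfl⟩, hr⟩ := exists_lt_of_lt_csSup ne (show N - δ < sSup (USet F) by linarith)
    let v' : CStarMatrix n n A := CStarMatrix.ofMatrix v
    let w' : CStarMatrix n n B := CStarMatrix.ofMatrix w
    have b1 : star v' * v' = 1 := a1
    have b2 : v' * star v' = 1 := a2
    have b3 : star w' * w' = 1 := a3
    have b4 : w' * star w' = 1 := a4
    have hv : v' ∈ unitary (CStarMatrix n n A) := ⟨b1, b2⟩
    have hw : w' ∈ unitary (CStarMatrix n n B) := ⟨b3, b4⟩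
    have e11 : G0 F s v' w' 1 1 = ∑ i, ∑ j, ((s i * s j : ℝ) : ℂ) * F (v i j) (w i j) := by
      simp only [G0, LinearMap.compl₁₂_apply, LinearMap.mulLeft_apply, mul_one]; rfl
    have eF : ∀ (a : A) (b : B), G0 F s v' w' (star v' * cD n a) (star w' * cD n b) = F a b := by
      intro a b
      simp only [G0, LinearMap.compl₁₂_apply, LinearMap.mulLeft_apply, ← mul_assoc, b2, b4, one_mul, gAmp_apply]
      have : ∀ i, ∑ j, ((s i * s j : ℝ) : ℂ) * F (cD n a i j) (cD n b i j) = ((s i ^ 2 : ℝ) : ℂ) * F a b := by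
        intro i
        rw [Finset.sum_eq_single i]
        · simp [cD, pow_two]
        · intro j _ hj; simp [cD, hj.symm]
        · simp
      simp only [this, ← Finset.sum_mul, ← Complex.ofReal_sum, hs, Complex.ofReal_one, one_mul]
    set l' : List (CStarMatrix n n A × CStarMatrix n n B × ℝ) := l.map fun p => (star v' * cD n p.1, star w' * cD n p.2.1, p.2.2) with hl'
    have r1 := hs_cD_norm v' b1 b2 _ h1 h2
    have r2 := hs_cD_norm w' b3 b4 _ h3 h4
    rw [List.map_map] at r1 r2
    have := lemU0 (G0 F s v' w') (hUN.amp s hs b1 b2 b3 b4) (by rw [e11]; exact hr.le) δ0 δ1 l'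
      (by intro p hp; obtain ⟨q, hq, rfl⟩ := List.mem_map.1 hp; exact hl q hq)
      (by rw [hl', List.map_map]; exact r1.1) (by rw [hl', List.map_map]; exact r1.2)
      (by rw [hl', List.map_map]; exact r2.1) (by rw [hl', List.map_map]; exact r2.2) M
      (by
        rw [hl', List.map_map, List.length_map]
        refine le_trans ?_ (hM1.le.trans hM1')
        refine mul_le_mul_of_nonneg_left (List.sum_le_sum ?_) (by positivity)
        intro p hp
        have := hl p hp
        simp only [Function.comp]
        rw [CStarRing.norm_mem_unitary_mul _ (Unitary.star_mem hv)]
        gcongr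
        exact cD_norm _)
      (by
        rw [hl', List.map_map, List.length_map]
        refine le_trans ?_ (hM2.le.trans hM2')
        refine mul_le_mul_of_nonneg_left (List.sum_le_sum ?_) (by positivity)
        intro p hp
        have := hl p hp
        simp only [Function.comp]
        rw [CStarRing.norm_mem_unitary_mul _ (Unitary.star_mem hw)]
        gcongr
        exact cD_norm _)
    rw [hl', List.map_map] at this
    simpa only [Function.comp_def, eF] using this
  have lim : Filter.Tendsto (fun δ : ℝ => 8 * (1024 * N + (M+1)^2 * VH.KM M N * √δ)) (nhdsWithin 0 (Set.Ioi 0)) (nhds (8 * (1024 * N + (M+1)^2 * VH.KM M N * √0))) := by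
    apply Filter.Tendsto.mono_left _ nhdsWithin_le_nhds
    apply Continuous.tendsto
    fun_prop
  have := ge_of_tendsto lim (by
    filter_upwards [Ioc_mem_nhdsGT (show (0:ℝ) < 1 by norm_num)] with δ hδ
    exact main δ hδ.1 hδ.2)
  rw [Real.sqrt_zero, mul_zero, add_zero] at this
  linarith

end SliceMap

namespace SliceMap
open Matrix

def OSB {A B : Type*} [NonUnitalCStarAlgebra A] [NonUnitalCStarAlgebra B]
    (NA : ∀ p : ℕ, Matrix (Fin p) (Fin p) A → ℝ) (NB : ∀ q : ℕ, Matrix (Fin q) (Fin q) B → ℝ)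
    (f : A →ₗ[ℂ] B →ₗ[ℂ] ℂ) (K : ℝ) : Prop :=
  ∀ (p : ℕ) (s : Fin p → ℝ) (v : Matrix (Fin p) (Fin p) A) (w : Matrix (Fin p) (Fin p) B), ∑ i, (s i)^2 = 1 →
    ‖∑ i, ∑ j, ((s i * s j : ℝ) : ℂ) * f (v i j) (w i j)‖ ≤ K * NA p v * NB p w

lemma osProjNorm_bdd {A B : Type u} [NonUnitalCStarAlgebra A] [NonUnitalCStarAlgebra B]
    {NA : ∀ p : ℕ, Matrix (Fin p) (Fin p) A → ℝ} {NB : ∀ q : ℕ, Matrix (Fin q) (Fin q) B → ℝ}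
    (hNA : ∀ p, IsCStarNorm (NA p)) (hNB : ∀ q, IsCStarNorm (NB q))
    {p q : ℕ} (α : Fin p × Fin q → ℂ) (v : Matrix (Fin p) (Fin p) A)
      (w : Matrix (Fin q) (Fin q) B) (β : Fin p × Fin q → ℂ) :
    osProjNorm NA NB (∑ ik : Fin p × Fin q, ∑ jl : Fin p × Fin q,
            (α ik * β jl) • (v ik.1 jl.1 ⊗ₜ[ℂ] w ik.2 jl.2)) ≤ Real.sqrt (∑ ik, ‖α ik‖ ^ 2) * NA p v * NB q w *
            Real.sqrt (∑ jl, ‖β jl‖ ^ 2) := by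
  apply csInf_le
  · refine ⟨0, ?_⟩
    rintro r ⟨p, q, α, v, w, β, -, rfl⟩
    have := CN.nonneg (hNA p) v
    have := CN.nonneg (hNB q) w
    positivity
  · exact ⟨p, q, α, v, w, β, rfl, rfl⟩

lemma osb_of_tensor {A B X : Type u} [NonUnitalCStarAlgebra A] [NonUnitalCStarAlgebra B]
    [NonUnitalNormedRing X] [StarRing X] [NormedSpace ℂ X] [CompleteSpace X]
    {NA : ∀ p : ℕ, Matrix (Fin p) (Fin p) A → ℝ} {NB : ∀ q : ℕ, Matrix (Fin q) (Fin q) B → ℝ}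
    (hNA : ∀ p, IsCStarNorm (NA p)) (hNB : ∀ q, IsCStarNorm (NB q))
    (ι : A ⊗[ℂ] B →ₗ[ℂ] X) (hX : IsTensorCompletion (osProjNorm NA NB) X ι) (F : X →L[ℂ] ℂ) :
    OSB NA NB ((TensorProduct.mk ℂ A B).compr₂ ((F : X →ₗ[ℂ] ℂ) ∘ₗ ι)) ‖F‖ := by
  intro p s v w hs
  let α : Fin p × Fin p → ℂ := fun ik => if ik.1 = ik.2 then (s ik.1 : ℂ) else 0
  have hα : ∑ ik, ‖α ik‖^2 = 1 := by
    rw [Fintype.sum_prod_type, ← hs]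
    refine Finset.sum_congr rfl fun i _ => ?_
    rw [Finset.sum_eq_single i]
    · simp [α]
    · intro j _ hj; simp [α, hj.symm]
    · simp
  have hu : ∑ ik : Fin p × Fin p, ∑ jl : Fin p × Fin p, (α ik * α jl) • (v ik.1 jl.1 ⊗ₜ[ℂ] w ik.2 jl.2) =
      ∑ i, ∑ j, ((s i * s j : ℝ) : ℂ) • (v i j ⊗ₜ[ℂ] w i j) := by
    rw [Fintype.sum_prod_type]
    refine Finset.sum_congr rfl fun i _ => ?_
    rw [Finset.sum_eq_single i]
    · rw [Fintype.sum_prod_type]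
      refine Finset.sum_congr rfl fun j _ => ?_
      rw [Finset.sum_eq_single j]
      · simp [α]
      · intro k _ hk; simp [α, hk.symm]
      · simp
    · intro j _ hj; simp [α, hj.symm]
    · simp
  have h1 := osProjNorm_bdd hNA hNB α v w α
  rw [hα, Real.sqrt_one, one_mul, mul_one, hu, ← hX.norm_eq] at h1
  have h2 := F.le_opNorm (ι (∑ i, ∑ j, ((s i * s j : ℝ) : ℂ) • (v i j ⊗ₜ[ℂ] w i j)))
  have h3 : F (ι (∑ i, ∑ j, ((s i * s j : ℝ) : ℂ) • (v i j ⊗ₜ[ℂ] w i j))) =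
      ∑ i, ∑ j, ((s i * s j : ℝ) : ℂ) * ((TensorProduct.mk ℂ A B).compr₂ ((F : X →ₗ[ℂ] ℂ) ∘ₗ ι)) (v i j) (w i j) := by
    simp only [map_sum, map_smul, smul_eq_mul]; rfl
  rw [← h3, mul_assoc]
  exact h2.trans (mul_le_mul_of_nonneg_left h1 (norm_nonneg _))

lemma OSB.bound {A B : Type*} [NonUnitalCStarAlgebra A] [NonUnitalCStarAlgebra B]
    {NA : ∀ p : ℕ, Matrix (Fin p) (Fin p) A → ℝ} {NB : ∀ q : ℕ, Matrix (Fin q) (Fin q) B → ℝ}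
    (hNA : ∀ p, IsCStarNorm (NA p)) (hNB : ∀ q, IsCStarNorm (NB q)) {f : A →ₗ[ℂ] B →ₗ[ℂ] ℂ} {K : ℝ} (hK : 0 ≤ K)
    (h : OSB NA NB f K) (a : A) (b : B) : ‖f a b‖ ≤ K * ‖a‖ * ‖b‖ := by
  have := h 1 (fun _ => 1) (Matrix.diagonal fun _ => a) (Matrix.diagonal fun _ => b) (by simp)
  simp only [Finset.univ_unique, Finset.sum_singleton, diagonal_apply_eq] at this
  norm_num at this
  refine this.trans ?_
  have := cn_diag_le (hNA 1) a
  have := cn_diag_le (hNB 1) b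
  have := CN.nonneg (hNB 1) (Matrix.diagonal fun _ => b)
  gcongr

def rhoE {A : Type*} [NonUnitalCStarAlgebra A] (e : A) : Unitization ℂ A →ₗ[ℂ] A where
  toFun x := x.fst • e + x.snd * e
  map_add' x y := by simp [add_smul, add_mul]; abel
  map_smul' c x := by simp [mul_smul, smul_mul_assoc]

lemma inr_rhoE {A : Type*} [NonUnitalCStarAlgebra A] (e : A) (x : Unitization ℂ A) : (Unitization.inr (rhoE e x) : Unitization ℂ A) = x * (Unitization.inr e) := by
  ext <;> simp [rhoE]

lemma rhoE_inr {A : Type*} [NonUnitalCStarAlgebra A] (e a : A) : rhoE e (Unitization.inr a) = a * e := by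
  simp [rhoE]

lemma rhoE_cn {A : Type*} [NonUnitalCStarAlgebra A] {n : Type} [Fintype n] [DecidableEq n] {N : Matrix n n A → ℝ} (hN : IsCStarNorm N)
    (e : A) (he : ‖e‖ ≤ 1) (v : Matrix n n (Unitization ℂ A)) (hv : vᴴ * v = 1) : N (v.map (rhoE e)) ≤ 1 := by
  have key : star (v.map (rhoE e)) * v.map (rhoE e) = Matrix.diagonal fun _ => star e * e := by
    ext i j
    apply Unitization.inr_injective (R := ℂ)
    have h1 : (vᴴ * v) i j = (1 : Matrix n n (Unitization ℂ A)) i j := by rw [hv]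
    rw [Matrix.mul_apply] at h1
    simp only [conjTranspose_apply] at h1
    rw [Matrix.mul_apply]
    have h2 : ∀ g : n → A, (Unitization.inr (∑ k, g k) : Unitization ℂ A) = ∑ k, Unitization.inr (g k) :=
      fun g => map_sum (Unitization.inrHom ℂ ℂ A) g Finset.univ
    rw [h2]
    have h3 : ∀ k, (Unitization.inr (star (v.map (rhoE e)) i k * v.map (rhoE e) k j) : Unitization ℂ A) =
      star (Unitization.inr e : Unitization ℂ A) * (star (v k i) * v k j) * Unitization.inr e := by
      intro k
      simp only [Matrix.star_apply, Matrix.map_apply, Unitization.inr_mul, Unitization.inr_star, inr_rhoE, star_mul, mul_assoc]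
    simp only [h3, ← Finset.mul_sum, ← Finset.sum_mul, h1]
    by_cases h : i = j
    · rw [h, Matrix.one_apply_eq, Matrix.diagonal_apply_eq]; simp
    · rw [Matrix.one_apply_ne h, Matrix.diagonal_apply_ne _ h]; simp
  have h2 := hN.star_mul_self (v.map (rhoE e))
  rw [key] at h2
  have h3 := cn_diag_le hN (star e * e)
  rw [CStarRing.norm_star_mul_self] at h3
  have h0 := CN.nonneg hN (v.map (rhoE e))
  nlinarith [norm_nonneg e]

def fE {A B : Type*} [NonUnitalCStarAlgebra A] [NonUnitalCStarAlgebra B] (f : A →ₗ[ℂ] B →ₗ[ℂ] ℂ) (e : A) (e' : B) :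
    Unitization ℂ A →ₗ[ℂ] Unitization ℂ B →ₗ[ℂ] ℂ := f.compl₁₂ (rhoE e) (rhoE e')

lemma ubound_fE {A B : Type*} [NonUnitalCStarAlgebra A] [NonUnitalCStarAlgebra B]
    {NA : ∀ p : ℕ, Matrix (Fin p) (Fin p) A → ℝ} {NB : ∀ q : ℕ, Matrix (Fin q) (Fin q) B → ℝ}
    (hNA : ∀ p, IsCStarNorm (NA p)) (hNB : ∀ q, IsCStarNorm (NB q)) {f : A →ₗ[ℂ] B →ₗ[ℂ] ℂ} {K : ℝ} (hK : 0 ≤ K)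
    (h : OSB NA NB f K) (e : A) (he : ‖e‖ ≤ 1) (e' : B) (he' : ‖e'‖ ≤ 1) : UBound (fE f e e') K := by
  intro n _ _ s hs v w h1 h2 h3 h4
  let q := Fintype.equivFin n
  have hq : ∀ {A : Type _} [CStarAlgebra A] (v : Matrix n n A), vᴴ * v = 1 → (v.submatrix q.symm q.symm)ᴴ * (v.submatrix q.symm q.symm) = 1 := by
    intro A _ v hv
    rw [conjTranspose_submatrix, submatrix_mul_equiv, hv, submatrix_one_equiv]
  have hq' : (w.submatrix q.symm q.symm)ᴴ * (w.submatrix q.symm q.symm) = 1 := by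
    rw [conjTranspose_submatrix, submatrix_mul_equiv, h3, submatrix_one_equiv]
  have k1 := rhoE_cn (hNA _) e he _ (hq v h1)
  have k2 := rhoE_cn (hNB _) e' he' _ hq'
  have := h _ (s ∘ q.symm) ((v.submatrix q.symm q.symm).map (rhoE e)) ((w.submatrix q.symm q.symm).map (rhoE e'))
    (by rw [← hs]; exact Equiv.sum_comp q.symm (fun i => s i ^ 2))
  refine (Complex.re_le_norm _).trans (le_trans (le_of_eq ?_) (this.trans ?_))
  · congr 1
    rw [← Equiv.sum_comp q.symm]
    refine Finset.sum_congr rfl fun i _ => ?_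
    rw [← Equiv.sum_comp q.symm]
    rfl
  · have := CN.nonneg (hNA _) ((v.submatrix q.symm q.symm).map (rhoE e))
    have := CN.nonneg (hNB _) ((w.submatrix q.symm q.symm).map (rhoE e'))
    rw [mul_assoc]
    exact mul_le_of_le_one_right hK (mul_le_one₀ k1 this k2)

end SliceMap

namespace SliceMap
open Matrix

section
variable {A B : Type*} [NonUnitalCStarAlgebra A] [NonUnitalCStarAlgebra B]

def q1 (l : List (A × B × ℝ)) : A := (l.map fun p => p.1 * star p.1).sum
def q2 (l : List (A × B × ℝ)) : A := (l.map fun p => (p.2.2^2) • (star p.1 * p.1)).sum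
def q3 (l : List (A × B × ℝ)) : B := (l.map fun p => (p.2.2^2)⁻¹ • (p.2.1 * star p.2.1)).sum
def q4 (l : List (A × B × ℝ)) : B := (l.map fun p => star p.2.1 * p.2.1).sum

def uzl (l : List (A × B × ℝ)) : List (Unitization ℂ A × Unitization ℂ B × ℝ) :=
  l.map fun p => (Unitization.inr p.1, Unitization.inr p.2.1, p.2.2)

lemma inr_rsmul (r : ℝ) (a : A) : (Unitization.inr (r • a) : Unitization ℂ A) = r • Unitization.inr a := by
  rw [← Complex.coe_smul, ← Complex.coe_smul, Unitization.inr_smul]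

lemma uz1 (l : List (A × B × ℝ)) : hsA ((uzl l).map fun p => ((1:ℝ), p.2.2^2, p.1)) 1 = Unitization.inr (q1 l) := by
  induction l with
  | nil => simp [hsA, q1, uzl]
  | cons p l ih =>
    simp only [hsA, q1, uzl, List.map_cons, List.sum_cons, Unitization.inr_add, Unitization.inr_mul, Unitization.inr_star, one_smul, mul_one] at *
    rw [ih]

lemma uz2 (l : List (A × B × ℝ)) : hsB ((uzl l).map fun p => ((1:ℝ), p.2.2^2, p.1)) 1 = Unitization.inr (q2 l) := by
  induction l with
  | nil => simp [hsB, q2, uzl]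
  | cons p l ih =>
    simp only [hsB, q2, uzl, List.map_cons, List.sum_cons, Unitization.inr_add, inr_rsmul, Unitization.inr_mul, Unitization.inr_star, mul_one] at *
    rw [ih]

lemma uz3 (l : List (A × B × ℝ)) : hsA ((uzl l).map fun p => ((p.2.2^2)⁻¹, (1:ℝ), p.2.1)) 1 = Unitization.inr (q3 l) := by
  induction l with
  | nil => simp [hsA, q3, uzl]
  | cons p l ih =>
    simp only [hsA, q3, uzl, List.map_cons, List.sum_cons, Unitization.inr_add, inr_rsmul, Unitization.inr_mul, Unitization.inr_star, mul_one] at *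
    rw [ih]

lemma uz4 (l : List (A × B × ℝ)) : hsB ((uzl l).map fun p => ((p.2.2^2)⁻¹, (1:ℝ), p.2.1)) 1 = Unitization.inr (q4 l) := by
  induction l with
  | nil => simp [hsB, q4, uzl]
  | cons p l ih =>
    simp only [hsB, q4, uzl, List.map_cons, List.sum_cons, Unitization.inr_add, Unitization.inr_mul, Unitization.inr_star, one_smul, mul_one] at *
    rw [ih]

lemma limL1 {NA : ∀ p : ℕ, Matrix (Fin p) (Fin p) A → ℝ} {NB : ∀ q : ℕ, Matrix (Fin q) (Fin q) B → ℝ}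
    (hNA : ∀ p, IsCStarNorm (NA p)) (hNB : ∀ q, IsCStarNorm (NB q)) {f : A →ₗ[ℂ] B →ₗ[ℂ] ℂ} {K : ℝ} (hK : 0 ≤ K)
    (h : OSB NA NB f K) (l : List (A × B × ℝ)) (hl : ∀ p ∈ l, 0 < p.2.2)
    (h1 : ‖q1 l‖ ≤ 1) (h2 : ‖q2 l‖ ≤ 1) (h3 : ‖q3 l‖ ≤ 1) (h4 : ‖q4 l‖ ≤ 1) :
    ‖(l.map fun p => f p.1 p.2.1).sum‖ ≤ 8192 * K := by
  letI := CStarAlgebra.spectralOrder A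
  haveI := CStarAlgebra.spectralOrderedRing A
  letI := CStarAlgebra.spectralOrder B
  haveI := CStarAlgebra.spectralOrderedRing B
  have key : ∀ e : A, ‖e‖ ≤ 1 → ∀ e' : B, ‖e'‖ ≤ 1 → ‖(l.map fun p => f (p.1 * e) (p.2.1 * e')).sum‖ ≤ 8192 * K := by
    intro e he e' he'
    have := thmU (ubound_fE hNA hNB hK h e he e' he') (uzl l) (by
      intro p hp
      obtain ⟨q, hq, rfl⟩ := List.mem_map.1 hp
      exact hl q hq)
      (by rw [uz1, Unitization.norm_inr (𝕜 := ℂ)]; exact h1)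
      (by rw [uz2, Unitization.norm_inr (𝕜 := ℂ)]; exact h2)
      (by rw [uz3, Unitization.norm_inr (𝕜 := ℂ)]; exact h3)
      (by rw [uz4, Unitization.norm_inr (𝕜 := ℂ)]; exact h4)
    simpa [uzl, fE, Function.comp_def, rhoE_inr] using this
  let LA := CStarAlgebra.approximateUnit A
  let LB := CStarAlgebra.approximateUnit B
  have hA := CStarAlgebra.increasingApproximateUnit A
  have hB := CStarAlgebra.increasingApproximateUnit B
  have hc : Continuous fun z : A × B => f z.1 z.2 := by
    have : Continuous fun z : A × B => (LinearMap.mkContinuous₂ f K (fun a b => h.bound hNA hNB hK a b)) z.1 z.2 := by fun_prop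
    exact this
  have hte : Filter.Tendsto (fun z : A × B => (l.map fun p => f (p.1 * z.1) (p.2.1 * z.2)).sum) (LA ×ˢ LB)
      (nhds (l.map fun p => f p.1 p.2.1).sum) := by
    apply tendsto_list_sum
    intro p _
    have t1 : Filter.Tendsto (fun z : A × B => (p.1 * z.1, p.2.1 * z.2)) (LA ×ˢ LB) (nhds (p.1, p.2.1)) :=
      ((hA.tendsto_mul_left p.1).comp Filter.tendsto_fst).prodMk_nhds ((hB.tendsto_mul_left p.2.1).comp Filter.tendsto_snd)
    exact (hc.tendsto (p.1, p.2.1)).comp t1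
  haveI := hA.neBot
  haveI := hB.neBot
  refine le_of_tendsto hte.norm ?_
  filter_upwards [Filter.tendsto_fst.eventually hA.eventually_norm, Filter.tendsto_snd.eventually hB.eventually_norm] with z hz hz'
  exact key _ hz _ hz'

lemma q_scale (c : ℝ) (hc : 0 ≤ c) (l : List (A × B × ℝ)) (f : A →ₗ[ℂ] B →ₗ[ℂ] ℂ) :
    let l' : List (A × B × ℝ) := l.map fun p => (Real.sqrt c • p.1, Real.sqrt c • p.2.1, p.2.2)
    q1 l' = c • q1 l ∧ q2 l' = c • q2 l ∧ q3 l' = c • q3 l ∧ q4 l' = c • q4 l ∧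
      (l'.map fun p => f p.1 p.2.1).sum = c • (l.map fun p => f p.1 p.2.1).sum := by
  intro l'
  have hs : Real.sqrt c * Real.sqrt c = c := Real.mul_self_sqrt hc
  have hf : ∀ a b, f (Real.sqrt c • a) (Real.sqrt c • b) = c • f a b := by
    intro a b
    rw [← Complex.coe_smul, ← Complex.coe_smul, ← Complex.coe_smul, map_smul (f _), map_smul f, LinearMap.smul_apply, smul_smul, ← Complex.ofReal_mul, hs]
  have e : (l.map fun p => ((Real.sqrt c • p.1, Real.sqrt c • p.2.1, p.2.2) : A × B × ℝ)) = l' := rfl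
  clear_value l'
  subst e
  induction l with
  | nil => simp [q1, q2, q3, q4]
  | cons p l ih =>
    obtain ⟨i1, i2, i3, i4, i5⟩ := ih
    simp only [q1, q2, q3, q4, List.map_cons, List.sum_cons, star_smul, smul_mul_smul_comm, star_trivial, hs, hf, smul_add, smul_comm _ c] at *
    rw [i1, i2, i3, i4, i5]
    simp

lemma limL {NA : ∀ p : ℕ, Matrix (Fin p) (Fin p) A → ℝ} {NB : ∀ q : ℕ, Matrix (Fin q) (Fin q) B → ℝ}
    (hNA : ∀ p, IsCStarNorm (NA p)) (hNB : ∀ q, IsCStarNorm (NB q)) {f : A →ₗ[ℂ] B →ₗ[ℂ] ℂ} {K : ℝ} (hK : 0 ≤ K)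
    (h : OSB NA NB f K) (l : List (A × B × ℝ)) (hl : ∀ p ∈ l, 0 < p.2.2)  :
    ‖(l.map fun p => f p.1 p.2.1).sum‖ ≤ 8192 * K * (‖q1 l‖ + ‖q2 l‖ + ‖q3 l‖ + ‖q4 l‖) := by
  set R := ‖q1 l‖ + ‖q2 l‖ + ‖q3 l‖ + ‖q4 l‖ with hR
  have n1 := norm_nonneg (q1 l)
  have n2 := norm_nonneg (q2 l)
  have n3 := norm_nonneg (q3 l)
  have n4 := norm_nonneg (q4 l)
  have hR0 : 0 ≤ R := by positivity
  refine le_of_forall_pos_le_add fun ε hε => ?_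
  have hδ : ∃ δ : ℝ, 0 < δ ∧ 8192 * K * δ ≤ ε := by
    refine ⟨ε / (8192 * K + 1), by positivity, ?_⟩
    rw [mul_div_assoc', div_le_iff₀ (by positivity)]
    nlinarith
  obtain ⟨δ, hδ, hd⟩ := hδ
  have hc : 0 < R + δ := by positivity
  obtain ⟨i1, i2, i3, i4, i5⟩ := q_scale (R + δ)⁻¹ (by positivity) l f
  have hn : ∀ x : ℝ, x ≤ R → ‖(R + δ)⁻¹‖ * x ≤ 1 := by
    intro x hx
    rw [Real.norm_of_nonneg (by positivity), inv_mul_le_iff₀ hc]; linarith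
  have := limL1 hNA hNB hK h (l.map fun p => (Real.sqrt (R + δ)⁻¹ • p.1, Real.sqrt (R + δ)⁻¹ • p.2.1, p.2.2)) (by
      intro p hp
      obtain ⟨q, hq, rfl⟩ := List.mem_map.1 hp
      exact hl q hq) (by rw [i1, norm_smul]; apply hn; linarith)
        (by rw [i2, norm_smul]; apply hn; linarith) (by rw [i3, norm_smul]; apply hn; linarith) (by rw [i4, norm_smul]; apply hn; linarith)
  rw [i5, norm_smul, Real.norm_of_nonneg (by positivity), inv_mul_le_iff₀ hc] at this
  nlinarith
end
end SliceMap

namespace SliceMap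
open Matrix

section
variable {A B : Type*} [NonUnitalCStarAlgebra A] [NonUnitalCStarAlgebra B]

lemma q_append (l l' : List (A × B × ℝ)) : q1 (l ++ l') = q1 l + q1 l' ∧ q2 (l ++ l') = q2 l + q2 l' ∧
   q3 (l ++ l') = q3 l + q3 l' ∧ q4 (l ++ l') = q4 l + q4 l' := by
  simp [q1, q2, q3, q4]

lemma herm_ext (h : A →L[ℝ] ℝ) : ∃ f : A →L[ℂ] ℂ, (∀ x, f (star x) = star (f x)) ∧ ∀ x, IsSelfAdjoint x → (f x).re = h x := by
  let H : A →L[ℂ] ℂ := StrongDual.extendRCLike (𝕜 := ℂ) h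
  let G : A →ₗ[ℂ] ℂ :=
    { toFun := fun x => (1/2 : ℂ) * (H x + star (H (star x)))
      map_add' := by intro x y; simp only [star_add, map_add]; ring
      map_smul' := by intro c x; simp only [star_smul, map_smul, smul_eq_mul, star_mul', star_star, RingHom.id_apply]; ring }
  refine ⟨⟨G, ?_⟩, ?_, ?_⟩
  · change Continuous fun x => (1/2 : ℂ) * (H x + star (H (star x)))
    fun_prop
  · intro x
    change (1/2 : ℂ) * (H (star x) + star (H (star (star x)))) = star ((1/2 : ℂ) * (H x + star (H (star x))))
    simp only [star_mul', star_add, star_star]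
    have : star (1/2 : ℂ) = 1/2 := by norm_num
    rw [this]; ring
  · intro x hx
    change ((1/2 : ℂ) * (H x + star (H (star x)))).re = _
    rw [hx.star_eq]
    have : (H x).re = h x := StrongDual.re_extendRCLike_apply (𝕜 := ℂ) h x
    rw [← this]
    have : (1/2:ℂ) = ((1/2:ℝ):ℂ) := by norm_num
    rw [this, Complex.re_ofReal_mul]
    simp
    ring

lemma conv_norm {E : Type*} [NormedAddCommGroup E] [NormedSpace ℝ E] {a b : ℝ} (ha : 0 ≤ a) (hb : 0 ≤ b) (u v : E) :
    ‖a • u + b • v‖ ≤ a * ‖u‖ + b * ‖v‖ := by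
  refine (norm_add_le _ _).trans ?_
  rw [norm_smul, norm_smul, Real.norm_of_nonneg ha, Real.norm_of_nonneg hb]

lemma partD_real {NA : ∀ p : ℕ, Matrix (Fin p) (Fin p) A → ℝ} {NB : ∀ q : ℕ, Matrix (Fin q) (Fin q) B → ℝ}
    (hNA : ∀ p, IsCStarNorm (NA p)) (hNB : ∀ q, IsCStarNorm (NB q)) {f : A →ₗ[ℂ] B →ₗ[ℂ] ℂ} {K : ℝ} (hK : 0 ≤ K)
    (h : OSB NA NB f K) : ∃ (f1 f2 : A →L[ℝ] ℝ) (g1 g2 : B →L[ℝ] ℝ), ∀ a b, ∀ τ : ℝ, 0 < τ →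
      (f a b).re ≤ f1 (a * star a) + τ^2 * f2 (star a * a) + (τ^2)⁻¹ * g2 (b * star b) + g1 (star b * b) := by
  let C := 8192 * K
  let O : Set (A × A × B × B × ℝ) := {z | C * (‖z.1‖ + ‖z.2.1‖ + ‖z.2.2.1‖ + ‖z.2.2.2.1‖) < z.2.2.2.2}
  let W : Set (A × A × B × B × ℝ) := {z | ∃ l : List (A × B × ℝ), (∀ p ∈ l, 0 < p.2.2) ∧ z = (q1 l, q2 l, q3 l, q4 l, ((l.map fun p => f p.1 p.2.1).sum).re)}
  have hC : 0 ≤ C := by positivity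
  have hO : IsOpen O := by
    apply isOpen_lt <;> fun_prop
  have hOc : Convex ℝ O := by
    intro x hx y hy a b ha hb hab
    simp only [O, Set.mem_setOf_eq, Prod.fst_add, Prod.snd_add, Prod.smul_fst, Prod.smul_snd, smul_eq_mul] at *
    calc _ ≤ C * ((a * ‖x.1‖ + b * ‖y.1‖) + (a * ‖x.2.1‖ + b * ‖y.2.1‖) + (a * ‖x.2.2.1‖ + b * ‖y.2.2.1‖) + (a * ‖x.2.2.2.1‖ + b * ‖y.2.2.2.1‖)) := by
          gcongr
          · exact conv_norm ha hb _ _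
          · exact conv_norm ha hb _ _
          · exact conv_norm ha hb _ _
          · exact conv_norm ha hb _ _
      _ = a * (C * (‖x.1‖ + ‖x.2.1‖ + ‖x.2.2.1‖ + ‖x.2.2.2.1‖)) + b * (C * (‖y.1‖ + ‖y.2.1‖ + ‖y.2.2.1‖ + ‖y.2.2.2.1‖)) := by ring
      _ < _ := by
        rcases eq_or_lt_of_le ha with rfl | ha
        · obtain rfl : b = 1 := by linarith
          simpa using hy
        · nlinarith [mul_lt_mul_of_pos_left hx ha, mul_le_mul_of_nonneg_left hy.le hb]
  have hsm : ∀ c : ℝ, 0 ≤ c → ∀ x ∈ W, c • x ∈ W := by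
    rintro c hc x ⟨l, hl, rfl⟩
    obtain ⟨i1, i2, i3, i4, i5⟩ := q_scale c hc l f
    refine ⟨l.map fun p => (Real.sqrt c • p.1, Real.sqrt c • p.2.1, p.2.2), ?_, ?_⟩
    · intro p hp
      obtain ⟨q, hq, rfl⟩ := List.mem_map.1 hp
      exact hl q hq
    · rw [i1, i2, i3, i4, i5]
      simp
  have hadd : ∀ x ∈ W, ∀ y ∈ W, x + y ∈ W := by
    rintro x ⟨l, hl, rfl⟩ y ⟨l', hl', rfl⟩
    obtain ⟨i1, i2, i3, i4⟩ := q_append l l'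
    refine ⟨l ++ l', ?_, ?_⟩
    · intro p hp
      rcases List.mem_append.1 hp with hp | hp
      · exact hl p hp
      · exact hl' p hp
    · rw [i1, i2, i3, i4]; simp
  have hWc : Convex ℝ W := by
    intro x hx y hy a b ha hb hab
    exact hadd _ (hsm a ha x hx) _ (hsm b hb y hy)
  have hdis : Disjoint O W := by
    rw [Set.disjoint_left]
    rintro x hx ⟨l, hl, rfl⟩
    have := limL hNA hNB hK h l hl
    simp only [O, Set.mem_setOf_eq] at hx
    have h2 := Complex.re_le_norm ((l.map fun p => f p.1 p.2.1).sum)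
    linarith
  obtain ⟨Λ, s, h1, h2⟩ := geometric_hahn_banach_open hOc hO hWc hdis
  have h0W : (0 : (A × A × B × B × ℝ)) ∈ W := ⟨[], by simp, by simp [q1, q2, q3, q4]; rfl⟩
  have hs : s ≤ 0 := by simpa using h2 0 h0W
  have hW0 : ∀ x ∈ W, 0 ≤ Λ x := by
    intro x hx
    by_contra hc
    push Not at hc
    have := h2 _ (hsm ((s - 1) / Λ x) (div_nonneg_of_nonpos (by linarith) hc.le) x hx)
    rw [map_smul, smul_eq_mul, div_mul_cancel₀ _ hc.ne] at this
    linarith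
  let c := -Λ (0,0,0,0,1)
  have hc : 0 < c := by
    have : ((0,0,0,0,1) : (A × A × B × B × ℝ)) ∈ O := by simp [O]
    have := h1 _ this
    simp only [c]; linarith
  let i1 : A →L[ℝ] (A × A × B × B × ℝ) := ContinuousLinearMap.inl ℝ A _
  let i2 : A →L[ℝ] (A × A × B × B × ℝ) := (ContinuousLinearMap.inr ℝ A _).comp (ContinuousLinearMap.inl ℝ A _)
  let i3 : B →L[ℝ] (A × A × B × B × ℝ) := (ContinuousLinearMap.inr ℝ A _).comp ((ContinuousLinearMap.inr ℝ A _).comp (ContinuousLinearMap.inl ℝ B _))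
  let i4 : B →L[ℝ] (A × A × B × B × ℝ) := (ContinuousLinearMap.inr ℝ A _).comp ((ContinuousLinearMap.inr ℝ A _).comp ((ContinuousLinearMap.inr ℝ B _).comp (ContinuousLinearMap.inl ℝ B _)))
  refine ⟨c⁻¹ • Λ.comp i1, c⁻¹ • Λ.comp i2, c⁻¹ • Λ.comp i4, c⁻¹ • Λ.comp i3, fun a b τ hτ => ?_⟩
  have := hW0 _ ⟨[(a,b,τ)], by simpa using hτ, rfl⟩
  simp only [q1, q2, q3, q4, List.map_cons, List.map_nil, List.sum_cons, List.sum_nil, add_zero] at this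
  have e : ((a * star a, τ^2 • (star a * a), (τ^2)⁻¹ • (b * star b), star b * b, (f a b).re) : (A × A × B × B × ℝ)) =
     i1 (a * star a) + τ^2 • i2 (star a * a) + (τ^2)⁻¹ • i3 (b * star b) + i4 (star b * b) + (f a b).re • ((0,0,0,0,1) : (A × A × B × B × ℝ)) := by
    simp [i1, i2, i3, i4]
  rw [e, map_add, map_add, map_add, map_add, map_smul, map_smul, map_smul] at this
  simp only [ContinuousLinearMap.smul_apply, ContinuousLinearMap.comp_apply, smul_eq_mul] at this ⊢
  have e2 : Λ (0,0,0,0,1) = -c := by simp [c]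
  rw [e2] at this
  rw [← mul_le_mul_iff_right₀ hc]
  calc _ ≤ Λ (i1 (a * star a)) + τ^2 * Λ (i2 (star a * a)) + (τ^2)⁻¹ * Λ (i3 (b * star b)) + Λ (i4 (star b * b)) := by linarith
    _ = _ := by field_simp

theorem partD {NA : ∀ p : ℕ, Matrix (Fin p) (Fin p) A → ℝ} {NB : ∀ q : ℕ, Matrix (Fin q) (Fin q) B → ℝ}
    (hNA : ∀ p, IsCStarNorm (NA p)) (hNB : ∀ q, IsCStarNorm (NB q)) {f : A →ₗ[ℂ] B →ₗ[ℂ] ℂ} {K : ℝ} (hK : 0 ≤ K)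
    (h : OSB NA NB f K) : ∃ (f1 f2 : A →L[ℂ] ℂ) (g1 g2 : B →L[ℂ] ℂ),
      (∀ x, f1 (star x) = star (f1 x)) ∧ (∀ x, f2 (star x) = star (f2 x)) ∧
      (∀ x, g1 (star x) = star (g1 x)) ∧ (∀ x, g2 (star x) = star (g2 x)) ∧
      (∀ a, 0 ≤ (f1 (a * star a)).re) ∧ (∀ a, 0 ≤ (f2 (star a * a)).re) ∧
      (∀ b, 0 ≤ (g1 (star b * b)).re) ∧ (∀ b, 0 ≤ (g2 (b * star b)).re) ∧
      ∀ a b, ∀ τ : ℝ, 0 < τ →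
      (f a b).re ≤ (f1 (a * star a)).re + τ^2 * (f2 (star a * a)).re + (τ^2)⁻¹ * (g2 (b * star b)).re + (g1 (star b * b)).re := by
  obtain ⟨f1, f2, g1, g2, hh⟩ := partD_real hNA hNB hK h
  obtain ⟨F1, a1, b1⟩ := herm_ext f1
  obtain ⟨F2, a2, b2⟩ := herm_ext f2
  obtain ⟨G1, a3, b3⟩ := herm_ext g1
  obtain ⟨G2, a4, b4⟩ := herm_ext g2
  have lim : ∀ u v : ℝ, (∀ t : ℝ, 0 < t → 0 ≤ u + t^2 * v) → 0 ≤ u ∧ 0 ≤ v := by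
    intro u v huv
    constructor
    · have : Filter.Tendsto (fun t : ℝ => u + t^2 * v) (nhdsWithin 0 (Set.Ioi 0)) (nhds (u + 0^2 * v)) := by
        apply Filter.Tendsto.mono_left _ nhdsWithin_le_nhds
        apply Continuous.tendsto (by fun_prop)
      have := ge_of_tendsto this (by filter_upwards [self_mem_nhdsWithin] with t ht using huv t ht)
      simpa using this
    · by_contra hv
      push Not at hv
      have := huv (Real.sqrt ((|u| + 1) / (-v))) (by apply Real.sqrt_pos.2; apply div_pos; positivity; linarith)
      rw [Real.sq_sqrt (by apply div_nonneg; positivity; linarith)] at this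
      have e : (|u| + 1) / (-v) * v = -(|u|+1) := by rw [div_neg, neg_mul, div_mul_cancel₀ _ hv.ne]
      rw [e] at this
      have := le_abs_self u
      linarith
  have s1 : ∀ a : A, IsSelfAdjoint (a * star a) := fun a => IsSelfAdjoint.mul_star_self a
  have s2 : ∀ a : A, IsSelfAdjoint (star a * a) := fun a => IsSelfAdjoint.star_mul_self a
  have s3 : ∀ a : B, IsSelfAdjoint (a * star a) := fun a => IsSelfAdjoint.mul_star_self a
  have s4 : ∀ a : B, IsSelfAdjoint (star a * a) := fun a => IsSelfAdjoint.star_mul_self a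
  simp only [← b1 _ (s1 _), ← b2 _ (s2 _), ← b3 _ (s4 _), ← b4 _ (s3 _)] at hh
  have c1 := fun a => lim (F1 (a * star a)).re (F2 (star a * a)).re (fun t ht => by simpa using hh a 0 t ht)
  have c2 := fun b => lim (G1 (star b * b)).re (G2 (b * star b)).re (fun t ht => by
    have := hh 0 b t⁻¹ (by positivity)
    simp at this
    linarith)
  exact ⟨F1, F2, G1, G2, a1, a2, a3, a4, fun a => (c1 a).1, fun a => (c1 a).2, fun a => (c2 a).1, fun a => (c2 a).2, hh⟩
end
end SliceMap

namespace SliceMap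

section
variable {H : Type*} [NormedAddCommGroup H] [InnerProductSpace ℂ H] [CompleteSpace H]

lemma inner_comm_sa {T : H →L[ℂ] H} (hT : IsSelfAdjoint T) (x y : H) : inner ℂ (T x) y = inner ℂ x (T y) := by
  conv_lhs => rw [← hT.star_eq, ContinuousLinearMap.star_eq_adjoint, ContinuousLinearMap.adjoint_inner_left]

lemma kry_sum {p : ℕ → (H →L[ℂ] H)} (hsa : ∀ i, IsSelfAdjoint (p i)) (hn : ∀ i, ‖p i‖ ≤ 1) (hid : ∀ i, p i * p i = p i)
    (hle : ∀ i, p (i+1) * p i = p i) (y : ℕ → H) (n : ℕ) :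
    p n (∑ i ∈ Finset.range n, (p (i+1) - p i) (y i)) = ∑ i ∈ Finset.range n, (p (i+1) - p i) (y i) ∧
    ‖∑ i ∈ Finset.range n, (p (i+1) - p i) (y i)‖^2 ≤ ∑ i ∈ Finset.range n, ‖y i‖^2 := by
  have hle' : ∀ i, p i * p (i+1) = p i := by
    intro i
    have := congrArg star (hle i)
    rwa [star_mul, (hsa i).star_eq, (hsa (i+1)).star_eq] at this
  have hb : ∀ i x, ‖p i x‖ ≤ ‖x‖ := fun i x => by
    simpa using (p i).le_of_opNorm_le (hn i) x
  induction n with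
  | zero => simp
  | succ n ih =>
    rw [Finset.sum_range_succ, Finset.sum_range_succ]
    set s := ∑ i ∈ Finset.range n, (p (i+1) - p i) (y i)
    have e1 : p (n+1) s = s := by
      rw [← ih.1]
      exact congrArg (fun T : H →L[ℂ] H => T s) (hle n)
    have e2 : p (n+1) ((p (n+1) - p n) (y n)) = (p (n+1) - p n) (y n) := by
      have : p (n+1) * (p (n+1) - p n) = p (n+1) - p n := by rw [mul_sub, hid, hle]
      exact congrArg (fun T : H →L[ℂ] H => T (y n)) this
    have e3 : p n ((p (n+1) - p n) (y n)) = 0 := by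
      have : p n * (p (n+1) - p n) = 0 := by rw [mul_sub, hid, hle', sub_self]
      exact congrArg (fun T : H →L[ℂ] H => T (y n)) this
    have e4 : ‖(p (n+1) - p n) (y n)‖ ≤ ‖y n‖ := by
      have a1 : (p (n+1) - p n) (y n) = p (n+1) (y n - p n (y n)) := by
        have : p (n+1) - p n = p (n+1) * (1 - p n) := by rw [mul_sub, mul_one, hle]
        exact congrArg (fun T : H →L[ℂ] H => T (y n)) this
      rw [a1]
      refine (hb _ _).trans ?_
      have a2 : inner ℂ (y n - p n (y n)) (p n (y n)) = 0 := by
        rw [← inner_comm_sa (hsa n)]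
        have : p n * (1 - p n) = 0 := by rw [mul_sub, mul_one, hid, sub_self]
        have : p n (y n - p n (y n)) = 0 := congrArg (fun T : H →L[ℂ] H => T (y n)) this
        rw [this, inner_zero_left]
      have := norm_add_sq_eq_norm_sq_add_norm_sq_of_inner_eq_zero _ _ a2
      rw [sub_add_cancel] at this
      nlinarith [norm_nonneg (p n (y n)), norm_nonneg (y n), norm_nonneg (y n - p n (y n))]
    have e5 : inner ℂ s ((p (n+1) - p n) (y n)) = 0 := by
      rw [← ih.1, inner_comm_sa (hsa n), e3, inner_zero_right]
    refine ⟨by rw [map_add, e1, e2], ?_⟩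
    have := norm_add_sq_eq_norm_sq_add_norm_sq_of_inner_eq_zero _ _ e5
    nlinarith [ih.2, norm_nonneg ((p (n+1) - p n) (y n))]

lemma kry_comm {p : ℕ → (H →L[ℂ] H)} (hsa : ∀ i, IsSelfAdjoint (p i)) (hn : ∀ i, ‖p i‖ ≤ 1) (hid : ∀ i, p i * p i = p i)
    (hle : ∀ i, p (i+1) * p i = p i) {r : H →L[ℂ] H} (hr : IsSelfAdjoint r) (hr1 : ‖r‖ ≤ 1)
    (hrp : ∀ i, p (i+1) * (r * p i) = r * p i) (n : ℕ) :
    ‖r * (∑ i ∈ Finset.range n, p i) - (∑ i ∈ Finset.range n, p i) * r‖ ≤ 2 * Real.sqrt n := by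
  set M := ∑ i ∈ Finset.range n, (p (i+1) - p i) * (r * p i) with hM
  have hMn : ‖M‖ ≤ Real.sqrt n := by
    refine ContinuousLinearMap.opNorm_le_bound _ (Real.sqrt_nonneg _) fun x => ?_
    have := (kry_sum hsa hn hid hle (fun i => r (p i x)) n).2
    have e : M x = ∑ i ∈ Finset.range n, (p (i+1) - p i) (r (p i x)) := by
      simp [hM]
    rw [← e] at this
    have b : ∀ i, ‖r (p i x)‖ ≤ ‖x‖ := by
      intro i
      have := r.le_of_opNorm_le hr1 (p i x)
      have := (p i).le_of_opNorm_le (hn i) x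
      linarith
    have : ‖M x‖^2 ≤ n * ‖x‖^2 := by
      refine this.trans ((Finset.sum_le_sum fun i _ => pow_le_pow_left₀ (norm_nonneg _) (b i) 2).trans ?_)
      simp
    refine (pow_le_pow_iff_left₀ (norm_nonneg _) (by positivity) (two_ne_zero)).1 ?_
    rw [mul_pow, Real.sq_sqrt (by positivity)]
    exact this
  have e : r * (∑ i ∈ Finset.range n, p i) - (∑ i ∈ Finset.range n, p i) * r = M - star M := by
    rw [hM, star_sum, Finset.mul_sum, Finset.sum_mul, ← Finset.sum_sub_distrib, ← Finset.sum_sub_distrib]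
    refine Finset.sum_congr rfl fun i _ => ?_
    have h2 := congrArg star (hrp i)
    simp only [star_mul, star_sub, (hsa i).star_eq, (hsa (i+1)).star_eq, hr.star_eq] at h2 ⊢
    rw [sub_mul, mul_sub, hrp, h2, mul_assoc]
    abel
  rw [e]
  refine (norm_sub_le _ _).trans ?_
  rw [norm_star]; linarith


def kryW (r1 r2 : H →L[ℂ] H) (E : Set H) : ℕ → Submodule ℂ H
  | 0 => Submodule.span ℂ E
  | n+1 => kryW r1 r2 E n ⊔ ((kryW r1 r2 E n).map r1.toLinearMap ⊔ (kryW r1 r2 E n).map r2.toLinearMap)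

lemma kryW_fd (r1 r2 : H →L[ℂ] H) (E : Set H) (hE : E.Finite) (n : ℕ) : FiniteDimensional ℂ (kryW r1 r2 E n) := by
  induction n with
  | zero => exact FiniteDimensional.span_of_finite ℂ hE
  | succ n ih =>
    change FiniteDimensional ℂ ↥(kryW r1 r2 E n ⊔ ((kryW r1 r2 E n).map r1.toLinearMap ⊔ (kryW r1 r2 E n).map r2.toLinearMap))
    infer_instance

lemma krylov (r1 r2 : H →L[ℂ] H) (h1 : IsSelfAdjoint r1) (h2 : IsSelfAdjoint r2) (n1 : ‖r1‖ ≤ 1) (n2 : ‖r2‖ ≤ 1)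
    (E : Set H) (hE : E.Finite) (δ : ℝ) (hδ : 0 < δ) : ∃ Q : H →L[ℂ] H, FiniteDimensional ℂ (LinearMap.range Q.toLinearMap) ∧ ‖Q‖ ≤ 1 ∧
      (∀ e ∈ E, Q e = e) ∧ ‖r1 * Q - Q * r1‖ ≤ δ ∧ ‖r2 * Q - Q * r2‖ ≤ δ := by
  haveI := kryW_fd r1 r2 E hE
  let p : ℕ → (H →L[ℂ] H) := fun i => (kryW r1 r2 E i).starProjection
  have hsa : ∀ i, IsSelfAdjoint (p i) := fun i => isSelfAdjoint_starProjection _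
  have hn : ∀ i, ‖p i‖ ≤ 1 := fun i => Submodule.starProjection_norm_le _
  have hid : ∀ i, p i * p i = p i := fun i => Submodule.isIdempotentElem_starProjection _
  have hfix : ∀ i x, x ∈ kryW r1 r2 E i → p i x = x := fun i x hx => Submodule.starProjection_eq_self_iff.2 hx
  have hmem : ∀ i x, p i x ∈ kryW r1 r2 E i := fun i x => Submodule.starProjection_apply_mem _ _
  have hmono : ∀ i, kryW r1 r2 E i ≤ kryW r1 r2 E (i+1) := fun i => le_sup_left
  have hle : ∀ i, p (i+1) * p i = p i := by
    intro i; ext x; exact hfix _ _ (hmono i (hmem i x))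
  have hr1 : ∀ i, p (i+1) * (r1 * p i) = r1 * p i := by
    intro i; ext x
    refine hfix _ _ ?_
    exact (le_sup_left.trans le_sup_right : (kryW r1 r2 E i).map r1.toLinearMap ≤ kryW r1 r2 E (i+1)) (Submodule.mem_map_of_mem (hmem i x))
  have hr2 : ∀ i, p (i+1) * (r2 * p i) = r2 * p i := by
    intro i; ext x
    refine hfix _ _ ?_
    exact (le_sup_right.trans le_sup_right : (kryW r1 r2 E i).map r2.toLinearMap ≤ kryW r1 r2 E (i+1)) (Submodule.mem_map_of_mem (hmem i x))
  have hE0 : ∀ i, ∀ e ∈ E, e ∈ kryW r1 r2 E i := by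
    intro i e he
    induction i with
    | zero => exact Submodule.subset_span he
    | succ i ih => exact hmono i ih
  obtain ⟨n, hn0⟩ := exists_nat_gt ((2 / δ)^2)
  have hnpos : (0:ℝ) < n := lt_of_le_of_lt (by positivity) hn0
  have hfin : 2 * Real.sqrt n ≤ n * δ := by
    have : 2 / δ ≤ Real.sqrt n := Real.le_sqrt_of_sq_le hn0.le
    rw [div_le_iff₀ hδ] at this
    calc 2 * Real.sqrt n ≤ (Real.sqrt n * δ) * Real.sqrt n := by gcongr
      _ = n * δ := by rw [mul_right_comm, Real.mul_self_sqrt hnpos.le]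
  set s := ∑ i ∈ Finset.range n, p i with hs
  have comm : ∀ r : H →L[ℂ] H, ‖r * s - s * r‖ ≤ 2 * Real.sqrt n → ‖r * (((n:ℝ)⁻¹ : ℂ) • s) - (((n:ℝ)⁻¹ : ℂ) • s) * r‖ ≤ δ := by
    intro r hr
    rw [mul_smul_comm, smul_mul_assoc, ← smul_sub, norm_smul]
    have : ‖(((n:ℝ) : ℂ)⁻¹)‖ = (n:ℝ)⁻¹ := by rw [norm_inv, Complex.norm_real, Real.norm_of_nonneg hnpos.le]
    rw [this, inv_mul_le_iff₀ hnpos]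
    exact hr.trans hfin
  refine ⟨((n:ℝ)⁻¹ : ℂ) • s, ?_, ?_, ?_, comm _ (kry_comm hsa hn hid hle h1 n1 hr1 n), comm _ (kry_comm hsa hn hid hle h2 n2 hr2 n)⟩
  · have : LinearMap.range (((n:ℝ)⁻¹ : ℂ) • s).toLinearMap ≤ kryW r1 r2 E n := by
      rintro _ ⟨x, rfl⟩
      have hm : Monotone (kryW r1 r2 E) := monotone_nat_of_le_succ hmono
      change ((n:ℝ)⁻¹ : ℂ) • (s x) ∈ _
      apply Submodule.smul_mem
      rw [hs, ContinuousLinearMap.sum_apply]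
      exact Submodule.sum_mem _ fun i hi => hm (Finset.mem_range.1 hi).le (hmem i x)
    exact Submodule.finiteDimensional_of_le this
  · rw [norm_smul]
    have : ‖(((n:ℝ) : ℂ)⁻¹)‖ = (n:ℝ)⁻¹ := by rw [norm_inv, Complex.norm_real, Real.norm_of_nonneg hnpos.le]
    rw [this, inv_mul_le_iff₀ hnpos]
    refine (norm_sum_le _ _).trans ((Finset.sum_le_sum fun i _ => hn i).trans ?_)
    simp
  · intro e he
    rw [ContinuousLinearMap.smul_apply, hs, ContinuousLinearMap.sum_apply, Finset.sum_congr rfl fun i _ => hfix i e (hE0 i e he)]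
    rw [Finset.sum_const, Finset.card_range, ← Nat.cast_smul_eq_nsmul ℂ, smul_smul]
    have : ((n:ℝ):ℂ)⁻¹ * (n:ℂ) = 1 := by
      rw [Complex.ofReal_natCast]; apply inv_mul_cancel₀; exact_mod_cast hnpos.ne'
    rw [this, one_smul]
end
end SliceMap

namespace SliceMap

section
variable {H : Type*} [NormedAddCommGroup H] [InnerProductSpace ℂ H] [CompleteSpace H]

lemma spec_conj {r Q k u : H →L[ℂ] H} (hk : ‖k‖ ≤ 1) (hQ : ‖Q‖ ≤ 1) (hkr : k * r = r * k) (hu : k = u * r) {δ : ℝ} (hδ : ‖r * Q - Q * r‖ ≤ δ)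
    (hδu : δ * ‖u‖ ≤ 1) (x : H) : ‖r ((k * (Q * k)) x)‖ ≤ 2 * ‖r x‖ := by
  have kb : ∀ x, ‖k x‖ ≤ ‖x‖ := fun x => by simpa using k.le_of_opNorm_le hk x
  have qb : ∀ x, ‖Q x‖ ≤ ‖x‖ := fun x => by simpa using Q.le_of_opNorm_le hQ x
  have e1 : r ((k * (Q * k)) x) = k (r (Q (k x))) := by
    have : r * (k * (Q * k)) = k * (r * (Q * k)) := by rw [← mul_assoc, ← hkr]; simp only [mul_assoc]
    exact congrArg (fun T : H →L[ℂ] H => T x) this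
  have e2 : r (Q (k x)) = Q (k (r x)) + (r * Q - Q * r) (k x) := by
    have : r * (Q * k) = Q * (k * r) + (r * Q - Q * r) * k := by rw [hkr]; noncomm_ring
    exact congrArg (fun T : H →L[ℂ] H => T x) this
  rw [e1]
  refine (kb _).trans ?_
  rw [e2]
  refine (norm_add_le _ _).trans ?_
  have h1 : ‖Q (k (r x))‖ ≤ ‖r x‖ := (qb _).trans (kb _)
  have hδ0 : 0 ≤ δ := (norm_nonneg _).trans hδ
  have h2 : ‖(r * Q - Q * r) (k x)‖ ≤ ‖r x‖ := by
    refine (ContinuousLinearMap.le_of_opNorm_le _ hδ _).trans ?_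
    have : k x = u (r x) := congrArg (fun T : H →L[ℂ] H => T x) hu
    rw [this]
    calc _ ≤ δ * (‖u‖ * ‖r x‖) := by gcongr; exact u.le_opNorm _
      _ = (δ * ‖u‖) * ‖r x‖ := by ring
      _ ≤ 1 * ‖r x‖ := by gcongr
      _ = _ := one_mul _
  linarith

theorem specLemma (S : H →L[ℂ] H) (h0 : 0 ≤ S) (h1 : S ≤ 1) (E : Set H) (hE : E.Finite) (ε : ℝ) (hε : 0 < ε) :
    ∃ P : H →L[ℂ] H, FiniteDimensional ℂ (LinearMap.range P.toLinearMap) ∧ (∀ e ∈ E, ‖P e - e‖ ≤ ε) ∧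
      (∀ x, (inner ℂ (S (P x)) (P x)).re ≤ 9 * (inner ℂ (S x) x).re) ∧
      (∀ x, (inner ℂ ((1 - S) (P x)) (P x)).re ≤ 9 * (inner ℂ ((1 - S) x) x).re) := by
  have hsa : IsSelfAdjoint S := IsSelfAdjoint.of_nonneg h0
  have hsp : ∀ x ∈ spectrum ℝ S, 0 ≤ x ∧ x ≤ 1 := by
    intro x hx
    refine ⟨spectrum_nonneg_of_nonneg h0 hx, ?_⟩
    have hS1 : ‖S‖ ≤ 1 := (CStarAlgebra.norm_le_one_iff_of_nonneg S h0).2 h1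
    rcases subsingleton_or_nontrivial H with hs | hs
    · exfalso
      have : Subsingleton (H →L[ℂ] H) := inferInstance
      simp [spectrum.of_subsingleton] at hx
    · have := spectrum.norm_le_norm_of_mem hx
      have := le_abs_self x
      rw [Real.norm_eq_abs] at *
      linarith
  have hmul : ∀ f g h : ℝ → ℝ, Continuous f → Continuous g → (∀ x, 0 ≤ x → x ≤ 1 → f x * g x = h x) → cfc f S * cfc g S = cfc h S := by
    intro f g h hf hg hh
    rw [← cfc_mul f g S hf.continuousOn hg.continuousOn]
    exact cfc_congr fun x hx => hh x (hsp x hx).1 (hsp x hx).2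
  have hnorm : ∀ (f : ℝ → ℝ) (c : ℝ), 0 ≤ c → (∀ x, 0 ≤ x → x ≤ 1 → |f x| ≤ c) → ‖cfc f S‖ ≤ c := by
    intro f c hc hf
    exact norm_cfc_le hc fun x hx => hf x (hsp x hx).1 (hsp x hx).2
  have hfsa : ∀ f : ℝ → ℝ, IsSelfAdjoint (cfc f S) := fun f => cfc_predicate f S
  let r1 := cfc (fun x : ℝ => Real.sqrt x) S
  let r2 := cfc (fun x : ℝ => Real.sqrt (1 - x)) S
  have hid : cfc (fun x : ℝ => x) S = S := cfc_id' ℝ S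
  have hone : cfc (fun _ : ℝ => (1:ℝ)) S = 1 := cfc_const_one ℝ S
  have hsub : cfc (fun x : ℝ => 1 - x) S = 1 - S := by
    rw [cfc_sub (fun _ => 1) (fun x => x) S, hid, hone]
  have hr1 : r1 * r1 = S := by
    conv_rhs => rw [← hid]
    exact hmul _ _ _ (by fun_prop) (by fun_prop) fun x h0 h1 => Real.mul_self_sqrt h0
  have hr2 : r2 * r2 = 1 - S := by
    rw [← hsub]
    exact hmul _ _ _ (by fun_prop) (by fun_prop) fun x h0 h1 => Real.mul_self_sqrt (by linarith)
  have nr1 : ‖r1‖ ≤ 1 := hnorm _ _ zero_le_one fun x h0 h1 => by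
    rw [abs_of_nonneg (Real.sqrt_nonneg _)]; exact Real.sqrt_le_one.2 h1
  have nr2 : ‖r2‖ ≤ 1 := hnorm _ _ zero_le_one fun x h0 h1 => by
    rw [abs_of_nonneg (Real.sqrt_nonneg _)]; exact Real.sqrt_le_one.2 (by linarith)
  let T := cfc (fun x : ℝ => x * (1 - x)) S
  have hT : S * (1 - S) = T := by
    rw [← hsub]
    conv_lhs => enter [1]; rw [← hid]
    exact hmul _ _ _ (by fun_prop) (by fun_prop) fun x h0 h1 => rfl
  have hTsa : IsSelfAdjoint T := hfsa _
  -- den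
  let den : ℕ → ℝ → ℝ := fun m x => 1 + m * |x * (1 - x)|
  have hden : ∀ m x, 0 < den m x := fun m x => by positivity
  have hden0 : ∀ m x, den m x ≠ 0 := fun m x => (hden m x).ne'
  have hdenc : ∀ m, Continuous (den m) := fun m => by simp only [den]; fun_prop
  let kf : ℕ → ℝ → ℝ := fun m x => m * (x * (1 - x)) / den m x
  have hkc : ∀ m, Continuous (kf m) := fun m => Continuous.div (by fun_prop) (hdenc m) (hden0 m)
  let k : ℕ → (H →L[ℂ] H) := fun m => cfc (kf m) S
  let u1f : ℕ → ℝ → ℝ := fun m x => m * (Real.sqrt x * (1 - x)) / den m x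
  let u2f : ℕ → ℝ → ℝ := fun m x => m * (x * Real.sqrt (1 - x)) / den m x
  let wf : ℕ → ℝ → ℝ := fun m x => m / den m x
  have hu1c : ∀ m, Continuous (u1f m) := fun m => Continuous.div (by fun_prop) (hdenc m) (hden0 m)
  have hu2c : ∀ m, Continuous (u2f m) := fun m => Continuous.div (by fun_prop) (hdenc m) (hden0 m)
  have hwc : ∀ m, Continuous (wf m) := fun m => Continuous.div (by fun_prop) (hdenc m) (hden0 m)
  have hk1 : ∀ m, k m = cfc (u1f m) S * r1 := fun m => (hmul _ _ _ (hu1c m) (by fun_prop) fun x h0 h1 => by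
    simp only [u1f, kf]
    rw [div_mul_eq_mul_div]; congr 1
    calc (m:ℝ) * (√x * (1 - x)) * √x = m * ((√x * √x) * (1 - x)) := by ring
      _ = _ := by rw [Real.mul_self_sqrt h0]).symm
  have hk2 : ∀ m, k m = cfc (u2f m) S * r2 := fun m => (hmul _ _ _ (hu2c m) (by fun_prop) fun x h0 h1 => by
    simp only [u2f, kf]
    rw [div_mul_eq_mul_div]; congr 1
    calc (m:ℝ) * (x * √(1 - x)) * √(1 - x) = m * (x * (√(1 - x) * √(1 - x))) := by ring
      _ = _ := by rw [Real.mul_self_sqrt (by linarith)]).symm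
  have hkw : ∀ m, k m = cfc (wf m) S * T := fun m => (hmul _ _ _ (hwc m) (by fun_prop) fun x h0 h1 => by
    simp only [wf, kf]
    ring).symm
  have ht : ∀ x : ℝ, 0 ≤ x → x ≤ 1 → 0 ≤ x * (1 - x) := fun x h0 h1 => mul_nonneg h0 (by linarith)
  have hkn : ∀ m, ‖k m‖ ≤ 1 := fun m => hnorm _ _ zero_le_one fun x h0 h1 => by
    have := ht x h0 h1
    simp only [kf, den]
    rw [abs_div, abs_of_nonneg this, abs_of_nonneg (a := 1 + _) (by positivity), div_le_one (by positivity), abs_of_nonneg (by positivity)]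
    linarith
  have hk1n : ∀ m, ‖1 - k m‖ ≤ 1 := fun m => by
    have : cfc (fun x => 1 - kf m x) S = 1 - k m := by
      rw [cfc_sub (fun _ => 1) (kf m) S (by fun_prop) (hkc m).continuousOn, hone]
    rw [← this]
    refine hnorm _ _ zero_le_one fun x h0 h1 => ?_
    have := ht x h0 h1
    simp only [kf, den]
    rw [abs_of_nonneg this]
    have e : 1 - (m:ℝ) * (x * (1-x)) / (1 + m * (x * (1-x))) = 1 / (1 + m * (x * (1-x))) := by
      have h3 : (1 + (m:ℝ) * (x * (1-x))) ≠ 0 := by positivity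
      rw [eq_div_iff h3, sub_mul, div_mul_cancel₀ _ h3]
      ring
    rw [e, abs_of_nonneg (by positivity), div_le_one (by positivity)]
    have : 0 ≤ (m:ℝ) * (x * (1-x)) := by positivity
    linarith
  have hkT : ∀ m : ℕ, 0 < m → ‖(1 - k m) * T‖ ≤ 1 / m := fun m hm => by
    have hm' : (0:ℝ) < m := by exact_mod_cast hm
    have : cfc (fun x => 1 - kf m x) S = 1 - k m := by
      rw [cfc_sub (fun _ => 1) (kf m) S (by fun_prop) (hkc m).continuousOn, hone]
    change ‖_ * cfc (fun x : ℝ => x * (1 - x)) S‖ ≤ _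
    rw [← this, hmul (fun x => 1 - kf m x) (fun x : ℝ => x * (1 - x)) (fun x => (1 - kf m x) * (x * (1 - x))) (continuous_const.sub (hkc m)) (by fun_prop) (fun x _ _ => rfl)]
    refine hnorm _ _ (by positivity) fun x h0 h1 => ?_
    have := ht x h0 h1
    simp only [kf, den]
    rw [abs_of_nonneg this]
    have e : (1 - (m:ℝ) * (x * (1-x)) / (1 + m * (x * (1-x)))) * (x * (1 - x)) = (x * (1-x)) / (1 + m * (x * (1-x))) := by
      have h3 : (1 + (m:ℝ) * (x * (1-x))) ≠ 0 := by positivity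
      rw [eq_div_iff h3, mul_right_comm, sub_mul 1, div_mul_cancel₀ _ h3]
      ring
    rw [e, abs_of_nonneg (by positivity), div_le_div_iff₀ (by positivity) hm']
    linarith
  -- kernel
  let N : Submodule ℂ H := LinearMap.ker T.toLinearMap
  haveI : CompleteSpace N := (ContinuousLinearMap.isClosed_ker T).completeSpace_coe
  let z : H → H := fun e => N.starProjection e
  have hz : ∀ e, T (z e) = 0 := fun e => Submodule.starProjection_apply_mem N e
  have hkz : ∀ m e, k m (z e) = 0 := by
    intro m e
    rw [hkw]
    change cfc (wf m) S (T (z e)) = 0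
    rw [hz, map_zero]
  have hconv : ∀ e, ∃ M : ℕ, ∀ m ≥ M, ‖k m (e - z e) - (e - z e)‖ ≤ ε / 2 := by
    intro e
    have hb : e - z e ∈ Nᗮ := Submodule.sub_starProjection_mem_orthogonal e
    have hb2 : e - z e ∈ (LinearMap.range T.toLinearMap).topologicalClosure := by
      have := ContinuousLinearMap.orthogonal_ker T
      rw [← ContinuousLinearMap.star_eq_adjoint, hTsa.star_eq] at this
      rw [← this]; exact hb
    have hb3 : e - z e ∈ closure (LinearMap.range T.toLinearMap : Set H) := hb2
    obtain ⟨_, ⟨y, rfl⟩, hy⟩ := Metric.mem_closure_iff.1 hb3 (ε / 4) (by positivity)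
    obtain ⟨M, hM⟩ := exists_nat_gt (‖y‖ / (ε / 4))
    refine ⟨M + 1, fun m hm => ?_⟩
    have hm0 : 0 < m := by omega
    have hmM : (M:ℝ) ≤ m := by exact_mod_cast (by omega : M ≤ m)
    have hm' : (0:ℝ) < m := by exact_mod_cast hm0
    rw [dist_eq_norm] at hy
    set b := e - z e
    have e1 : k m b - b = -((1 - k m) (b - T y) + ((1 - k m) * T) y) := by
      change k m b - b = -((b - T y) - k m (b - T y) + (T y - k m (T y)))
      have e2 : k m (b - T y) = k m b - k m (T y) := map_sub _ _ _
      rw [e2]; abel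
    rw [e1, norm_neg]
    have := ContinuousLinearMap.le_of_opNorm_le _ (hk1n m) (b - T y)
    have h3 := ContinuousLinearMap.le_of_opNorm_le _ (hkT m hm0) y
    have h4 : 1 / (m:ℝ) * ‖y‖ ≤ ε / 4 := by
      rw [one_div, inv_mul_le_iff₀ hm']
      rw [div_lt_iff₀ (by positivity)] at hM
      nlinarith
    have h5 : ‖b - T y‖ < ε / 4 := hy
    refine (norm_add_le _ _).trans ?_
    linarith
  choose Mf hMf using hconv
  obtain ⟨m, hm⟩ : ∃ m : ℕ, ∀ e ∈ E, Mf e ≤ m := by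
    obtain ⟨m, hm⟩ := (hE.image Mf).bddAbove
    exact ⟨m, fun e he => hm ⟨e, he, rfl⟩⟩
  let U := ‖cfc (u1f m) S‖ + ‖cfc (u2f m) S‖ + 1
  have hU : 0 < U := by positivity
  obtain ⟨Q, hQf, hQn, hQe, hQ1, hQ2⟩ := krylov r1 r2 (hfsa _) (hfsa _) nr1 nr2 (k m '' E) (hE.image _) U⁻¹ (by positivity)
  let W0 : Submodule ℂ H := Submodule.span ℂ (z '' E ∪ (fun e => S (z e)) '' E)
  haveI : FiniteDimensional ℂ W0 := FiniteDimensional.span_of_finite ℂ ((hE.image _).union (hE.image _))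
  let P0 := W0.starProjection
  have hSS : ∀ e, S (S (z e)) = S (z e) := by
    intro e
    have := congrArg (fun T : H →L[ℂ] H => T (z e)) hT
    change S (z e - S (z e)) = T (z e) at this
    rw [map_sub, hz] at this
    exact (sub_eq_zero.1 this).symm
  have hinv : ∀ x ∈ W0, S x ∈ W0 := by
    intro x hx
    have : W0 ≤ W0.comap S.toLinearMap := by
      refine Submodule.span_le.2 ?_
      rintro _ (⟨e, he, rfl⟩ | ⟨e, he, rfl⟩)
      · exact Submodule.subset_span (Or.inr ⟨e, he, rfl⟩)
      · change S (S (z e)) ∈ W0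
        rw [hSS]
        exact Submodule.subset_span (Or.inr ⟨e, he, rfl⟩)
    exact this hx
  have hP0sa : IsSelfAdjoint P0 := isSelfAdjoint_starProjection _
  have hcomm0 : S * P0 = P0 * S := by
    have a1 : P0 * (S * P0) = S * P0 := by
      ext x
      exact Submodule.starProjection_eq_self_iff.2 (hinv _ (Submodule.starProjection_apply_mem W0 x))
    have a2 := congrArg star a1
    simp only [star_mul, hP0sa.star_eq, hsa.star_eq] at a2
    rw [← a1, ← a2, mul_assoc]
  have hP0r : ∀ f : ℝ → ℝ, cfc f S * P0 = P0 * cfc f S := fun f => (Commute.cfc_real (show Commute S P0 from hcomm0) f)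
  have hWN : W0 ≤ N := by
    refine Submodule.span_le.2 ?_
    rintro _ (⟨e, he, rfl⟩ | ⟨e, he, rfl⟩)
    · exact hz e
    · change T (S (z e)) = 0
      rw [← hT]
      simp [hSS]
  have hbr : ∀ (f : ℝ → ℝ) (x : H), ‖cfc f S (P0 x)‖ ≤ ‖cfc f S x‖ := by
    intro f x
    have : cfc f S (P0 x) = P0 (cfc f S x) := congrArg (fun T : H →L[ℂ] H => T x) (hP0r f)
    rw [this]
    exact Submodule.norm_starProjection_apply_le _ _
  have hns : ∀ (r R : H →L[ℂ] H), IsSelfAdjoint r → r * r = R → ∀ x, (inner ℂ (R x) x).re = ‖r x‖^2 := by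
    intro r R hr hR x
    rw [← hR]
    change (inner ℂ (r (r x)) x).re = _
    rw [inner_comm_sa hr, inner_self_eq_norm_sq_to_K]
    norm_cast
  refine ⟨P0 + k m * (Q * k m), ?_, ?_, ?_, ?_⟩
  · let V := W0 ⊔ (LinearMap.range Q.toLinearMap).map (k m).toLinearMap
    have : LinearMap.range (P0 + k m * (Q * k m)).toLinearMap ≤ V := by
      rintro _ ⟨x, rfl⟩
      change P0 x + k m (Q (k m x)) ∈ V
      exact Submodule.add_mem _ (Submodule.mem_sup_left (Submodule.starProjection_apply_mem W0 x))
        (Submodule.mem_sup_right (Submodule.mem_map_of_mem ⟨k m x, rfl⟩))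
    exact Submodule.finiteDimensional_of_le this
  · intro e he
    have hp0 : P0 e = z e := by
      have hb : e - z e ∈ Nᗮ := Submodule.sub_starProjection_mem_orthogonal e
      have hmem : z e ∈ W0 := Submodule.subset_span (Or.inl ⟨e, he, rfl⟩)
      exact (Submodule.eq_starProjection_of_mem_orthogonal hmem (Submodule.orthogonal_le hWN hb))
    change ‖P0 e + k m (Q (k m e)) - e‖ ≤ ε
    rw [hQe _ ⟨e, he, rfl⟩, hp0]
    have hke : k m e = k m (e - z e) := by rw [map_sub, hkz, sub_zero]
    rw [hke]
    have hb := hMf e m (hm e he)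
    set b := e - z e with hbdef
    have : z e + k m (k m b) - e = k m (k m b - b) + (k m b - b) := by
      have e2 : k m (k m b - b) = k m (k m b) - k m b := map_sub _ _ _
      rw [e2]
      have e3 : e = b + z e := by rw [hbdef]; abel
      calc z e + k m (k m b) - e = z e + k m (k m b) - (b + z e) := by rw [← e3]
        _ = _ := by abel
    rw [this]
    have := ContinuousLinearMap.le_of_opNorm_le _ (hkn m) (k m b - b)
    refine (norm_add_le _ _).trans ?_
    linarith
  · intro x
    rw [hns r1 S (hfsa _) hr1, hns r1 S (hfsa _) hr1]
    have a := spec_conj (hkn m) hQn (cfc_commute_cfc _ _ S : Commute (k m) r1) (hk1 m) hQ1 (by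
      rw [inv_mul_le_iff₀ hU]; simp only [U]; linarith [norm_nonneg (cfc (u2f m) S)]) x
    have b := hbr (fun x : ℝ => Real.sqrt x) x
    have : ‖r1 ((P0 + k m * (Q * k m)) x)‖ ≤ 3 * ‖r1 x‖ := by
      rw [ContinuousLinearMap.add_apply, map_add]
      refine (norm_add_le _ _).trans ?_
      change ‖r1 (P0 x)‖ ≤ ‖r1 x‖ at b
      linarith
    nlinarith [norm_nonneg (r1 ((P0 + k m * (Q * k m)) x))]
  · intro x
    rw [hns r2 _ (hfsa _) hr2, hns r2 _ (hfsa _) hr2]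
    have a := spec_conj (hkn m) hQn (cfc_commute_cfc _ _ S : Commute (k m) r2) (hk2 m) hQ2 (by
      rw [inv_mul_le_iff₀ hU]; simp only [U]; linarith [norm_nonneg (cfc (u1f m) S)]) x
    have b := hbr (fun x : ℝ => Real.sqrt (1 - x)) x
    have : ‖r2 ((P0 + k m * (Q * k m)) x)‖ ≤ 3 * ‖r2 x‖ := by
      rw [ContinuousLinearMap.add_apply, map_add]
      refine (norm_add_le _ _).trans ?_
      change ‖r2 (P0 x)‖ ≤ ‖r2 x‖ at b
      linarith
    nlinarith [norm_nonneg (r2 ((P0 + k m * (Q * k m)) x))]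
end
end SliceMap

namespace SliceMap

section
theorem exists_hilb {V : Type u} [AddCommGroup V] [Module ℂ V] (c : PreInnerProductSpace.Core ℂ V) :
    ∃ (H : Type u) (_ : NormedAddCommGroup H) (_ : InnerProductSpace ℂ H) (_ : CompleteSpace H) (j : V →ₗ[ℂ] H),
      DenseRange j ∧ ∀ a, ‖j a‖^2 = (c.inner a a).re := by
  letI : SeminormedAddCommGroup V := InnerProductSpace.Core.toSeminormedAddCommGroup (𝕜 := ℂ) (c := c)
  letI : InnerProductSpace ℂ V := InnerProductSpace.ofCore c
  refine ⟨UniformSpace.Completion V, inferInstance, inferInstance, inferInstance,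
    (UniformSpace.Completion.toComplL (𝕜 := ℂ) (E := V)).toLinearMap, ?_, ?_⟩
  · exact UniformSpace.Completion.denseRange_coe
  · intro a
    change ‖((a : V) : UniformSpace.Completion V)‖^2 = _
    rw [UniformSpace.Completion.norm_coe]
    have := inner_self_eq_norm_sq (𝕜 := ℂ) a
    exact this.symm

variable {A : Type u} [NonUnitalCStarAlgebra A]

lemma sq_le_cancel {a b : ℝ} (hb : 0 ≤ b) (h : a^2 ≤ b^2) : a ≤ b := abs_le_of_sq_le_sq' h hb |>.2

theorem hilbE (f1 f2 : A →L[ℂ] ℂ) (h1 : ∀ x, f1 (star x) = star (f1 x)) (h2 : ∀ x, f2 (star x) = star (f2 x))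
    (p1 : ∀ a, 0 ≤ (f1 (a * star a)).re) (p2 : ∀ a, 0 ≤ (f2 (star a * a)).re) :
    ∃ (H : Type u) (_ : NormedAddCommGroup H) (_ : InnerProductSpace ℂ H) (_ : CompleteSpace H)
      (K : Type u) (_ : NormedAddCommGroup K) (_ : InnerProductSpace ℂ K) (_ : CompleteSpace K)
      (L : Type u) (_ : NormedAddCommGroup L) (_ : InnerProductSpace ℂ L) (_ : CompleteSpace L)
      (j : A →ₗ[ℂ] H) (J1 : H →L[ℂ] K) (J2 : H →L[ℂ] L), DenseRange j ∧
      (∀ a, ‖J1 (j a)‖^2 = (f1 (a * star a)).re) ∧ (∀ a, ‖J2 (j a)‖^2 = (f2 (star a * a)).re) ∧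
      ∀ x, ‖J1 x‖^2 + ‖J2 x‖^2 = ‖x‖^2 := by
  let c1 : PreInnerProductSpace.Core ℂ A :=
    { inner := fun a b => f1 (b * star a)
      conj_inner_symm := fun a b => by
        change star (f1 (a * star b)) = _
        rw [← h1]; simp
      re_inner_nonneg := fun a => p1 a
      add_left := fun a b c => by simp [mul_add]
      smul_left := fun a b c => by simp [mul_smul_comm (α := ℂ) (β := A)] }
  let c2 : PreInnerProductSpace.Core ℂ A :=
    { inner := fun a b => f2 (star a * b)
      conj_inner_symm := fun a b => by
        change star (f2 (star b * a)) = _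
        rw [← h2]; simp
      re_inner_nonneg := fun a => p2 a
      add_left := fun a b c => by simp [add_mul]
      smul_left := fun a b c => by simp [smul_mul_assoc (α := ℂ) (β := A)] }
  let c3 : PreInnerProductSpace.Core ℂ A :=
    { inner := fun a b => f1 (b * star a) + f2 (star a * b)
      conj_inner_symm := fun a b => by
        change star (f1 (a * star b) + f2 (star b * a)) = _
        rw [star_add, ← h1, ← h2]; simp
      re_inner_nonneg := fun a => by
        have := p1 a
        have := p2 a
        change 0 ≤ (f1 (a * star a) + f2 (star a * a)).re
        rw [Complex.add_re]
        linarith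
      add_left := fun a b c => by simp [add_mul, mul_add]; ring
      smul_left := fun a b c => by simp [mul_smul_comm (α := ℂ) (β := A), smul_mul_assoc (α := ℂ) (β := A)]; ring }
  obtain ⟨K, i1, i2, i3, j1, d1, e1⟩ := exists_hilb c1
  obtain ⟨L, i4, i5, i6, j2, d2, e2⟩ := exists_hilb c2
  obtain ⟨H, i7, i8, i9, j, d3, e3⟩ := exists_hilb c3
  have hs : ∀ a, ‖j1 a‖^2 + ‖j2 a‖^2 = ‖j a‖^2 := by
    intro a
    rw [e1, e2, e3]
    exact (Complex.add_re _ _).symm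
  have b1 : ∃ C, ∀ a, ‖j1 a‖ ≤ C * ‖j a‖ := ⟨1, fun a => by
    rw [one_mul]
    exact sq_le_cancel (norm_nonneg _) (by rw [← hs]; nlinarith [sq_nonneg ‖j2 a‖])⟩
  have b2 : ∃ C, ∀ a, ‖j2 a‖ ≤ C * ‖j a‖ := ⟨1, fun a => by
    rw [one_mul]
    exact sq_le_cancel (norm_nonneg _) (by rw [← hs]; nlinarith [sq_nonneg ‖j1 a‖])⟩
  have k1 : ∀ a, (j1.extendOfNorm j) (j a) = j1 a := fun a => LinearMap.extendOfNorm_eq d3 b1 a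
  have k2 : ∀ a, (j2.extendOfNorm j) (j a) = j2 a := fun a => LinearMap.extendOfNorm_eq d3 b2 a
  refine ⟨H, i7, i8, i9, K, i1, i2, i3, L, i4, i5, i6, j, j1.extendOfNorm j, j2.extendOfNorm j, d3, ?_, ?_, ?_⟩
  · intro a; rw [k1, e1]; rfl
  · intro a; rw [k2, e2]; rfl
  · intro x
    refine d3.induction_on (p := fun x => ‖(j1.extendOfNorm j) x‖^2 + ‖(j2.extendOfNorm j) x‖^2 = ‖x‖^2) x (isClosed_eq (by fun_prop) (by fun_prop)) ?_
    intro a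
    rw [k1, k2, hs]

/-- Cauchy-Schwarz type scaling. -/
lemma scale_bound {A B : Type*} [AddCommGroup A] [Module ℂ A] [AddCommGroup B] [Module ℂ B] (f : A →ₗ[ℂ] B →ₗ[ℂ] ℂ)
    (p : A → ℝ) (q : B → ℝ) (hp : ∀ a, 0 ≤ p a) (hq : ∀ b, 0 ≤ q b) (hps : ∀ (c : ℂ) a, p (c • a) = ‖c‖ * p a) (hqs : ∀ (c : ℂ) b, q (c • b) = ‖c‖ * q b)
    (M : ℝ) (hM : 0 ≤ M) (h : ∀ a b, (f a b).re ≤ p a ^2 + M * q b ^2) (a : A) (b : B) : ‖f a b‖ ≤ (1 + M) * p a * q b := by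
  obtain ⟨c, hc, hz⟩ := RCLike.exists_norm_eq_mul_self (f a b)
  have hc' : (c * f a b).re = ‖f a b‖ := by rw [← hz]; simp
  have key : ∀ δ : ℝ, 0 < δ → ‖f a b‖ ≤ (1 + M) * (p a + δ) * (q b + δ) := by
    intro δ hδ
    have hP : 0 < p a + δ := by linarith [hp a]
    have hQ : 0 < q b + δ := by linarith [hq b]
    have := h ((((p a + δ)⁻¹ : ℝ) : ℂ) • a) ((((q b + δ)⁻¹ : ℝ) * c : ℂ) • b)
    rw [hps, hqs, map_smul (f _), map_smul f, LinearMap.smul_apply, smul_eq_mul, smul_eq_mul, mul_left_comm, mul_assoc, Complex.re_ofReal_mul, Complex.re_ofReal_mul, hc',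
      norm_mul, hc, Complex.norm_real, Complex.norm_real, Real.norm_of_nonneg (by positivity), Real.norm_of_nonneg (by positivity), mul_one] at this
    have a1 : ((p a + δ)⁻¹ * p a)^2 ≤ 1 := by
      have : (p a + δ)⁻¹ * p a ≤ 1 := by rw [inv_mul_le_iff₀ hP]; linarith
      have h0 : 0 ≤ (p a + δ)⁻¹ * p a := mul_nonneg (by positivity) (hp a)
      nlinarith
    have a2 : ((q b + δ)⁻¹ * q b)^2 ≤ 1 := by
      have : (q b + δ)⁻¹ * q b ≤ 1 := by rw [inv_mul_le_iff₀ hQ]; linarith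
      have h0 : 0 ≤ (q b + δ)⁻¹ * q b := mul_nonneg (by positivity) (hq b)
      nlinarith
    have a3 : (p a + δ)⁻¹ * ((q b + δ)⁻¹ * ‖f a b‖) ≤ 1 + M := by nlinarith
    rw [inv_mul_le_iff₀ hP, inv_mul_le_iff₀ hQ] at a3
    linarith
  have ht : Filter.Tendsto (fun δ : ℝ => (1 + M) * (p a + δ) * (q b + δ)) (nhdsWithin 0 (Set.Ioi 0)) (nhds ((1 + M) * (p a + 0) * (q b + 0))) := by
    apply Filter.Tendsto.mono_left _ nhdsWithin_le_nhds
    exact Continuous.tendsto (by fun_prop) 0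
  rw [add_zero, add_zero] at ht
  exact ge_of_tendsto ht (by filter_upwards [self_mem_nhdsWithin] with δ hδ using key δ hδ)
end
end SliceMap

namespace SliceMap

section
variable {A B : Type u} [NonUnitalCStarAlgebra A] [NonUnitalCStarAlgebra B]

theorem approxG (f1 f2 : A →L[ℂ] ℂ) (g1 g2 : B →L[ℂ] ℂ) (h1 : ∀ x, f1 (star x) = star (f1 x)) (h2 : ∀ x, f2 (star x) = star (f2 x))
    (p1 : ∀ a, 0 ≤ (f1 (a * star a)).re) (p2 : ∀ a, 0 ≤ (f2 (star a * a)).re) (f : A →ₗ[ℂ] B →ₗ[ℂ] ℂ)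
    (hf : ∀ a b, ∀ τ : ℝ, 0 < τ →
      (f a b).re ≤ (f1 (a * star a)).re + τ^2 * (f2 (star a * a)).re + (τ^2)⁻¹ * (g2 (b * star b)).re + (g1 (star b * b)).re)
    (E : Set A) (hE : E.Finite) (ε : ℝ) (hε : 0 < ε) :
    ∃ (n : ℕ) (φ : Fin n → (A →L[ℂ] ℂ)) (ψ : Fin n → (B →L[ℂ] ℂ)),
      (∀ b, (∀ a, f a b = 0) → ∀ m, ψ m b = 0) ∧
      (∀ a ∈ E, ∀ b, ‖f a b - ∑ m, φ m a * ψ m b‖ ≤ ε * ‖b‖) ∧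
      ∀ a b, ∀ τ : ℝ, 0 < τ → (∑ m, φ m a * ψ m b).re ≤
        9 * (f1 (a * star a)).re + τ^2 * (9 * (f2 (star a * a)).re) + (τ^2)⁻¹ * (g2 (b * star b)).re + (g1 (star b * b)).re := by
  obtain ⟨H, _, _, _, K, _, _, _, L, _, _, _, j, J1, J2, hd, e1, e2, e3⟩ := hilbE f1 f2 h1 h2 p1 p2
  have hj : ∀ a, ‖j a‖^2 = (f1 (a * star a)).re + (f2 (star a * a)).re := fun a => by rw [← e1, ← e2, e3]
  have fb : ∀ {A : Type u} [NonUnitalCStarAlgebra A] (f : A →L[ℂ] ℂ) (a c : A), (f (a * c)).re ≤ ‖f‖ * (‖a‖ * ‖c‖) := by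
    intro A _ f a c
    refine (Complex.re_le_norm _).trans ((f.le_opNorm _).trans ?_)
    gcongr
    exact norm_mul_le _ _
  -- j bounded
  have hjb : ∀ a, ‖j a‖ ≤ Real.sqrt (‖f1‖ + ‖f2‖) * ‖a‖ := by
    intro a
    refine sq_le_cancel (by positivity) ?_
    rw [mul_pow, Real.sq_sqrt (by positivity), hj]
    have a1 := fb f1 a (star a)
    have a2 := fb f2 (star a) a
    rw [norm_star] at a1 a2
    nlinarith
  let M := ‖g1‖ + ‖g2‖
  have hM : 0 ≤ M := by positivity
  have hfb := scale_bound f (fun a => ‖j a‖) (fun b => ‖b‖) (fun _ => norm_nonneg _) (fun _ => norm_nonneg _)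
    (fun c a => by rw [map_smul, norm_smul]) (fun c b => norm_smul _ _) M hM (fun a b => by
      have := hf a b 1 one_pos
      simp only [one_pow, inv_one, one_mul] at this
      have a1 := fb g1 (star b) b
      have a2 := fb g2 b (star b)
      rw [norm_star] at a1 a2
      change _ ≤ ‖j a‖^2 + M * ‖b‖^2
      rw [hj]
      simp only [M]
      nlinarith)
  let C := 1 + M
  have hC : 0 ≤ C := by simp only [C]; linarith
  let F0 : A →ₗ[ℂ] (B →L[ℂ] ℂ) :=
    { toFun := fun a => (f a).mkContinuous (C * ‖j a‖) (fun b => hfb a b)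
      map_add' := fun a a' => by ext b; simp
      map_smul' := fun c a => by ext b; simp }
  have hF0 : ∀ a b, F0 a b = f a b := fun a b => rfl
  have hF0n : ∀ a, ‖F0 a‖ ≤ C * ‖j a‖ := fun a => ContinuousLinearMap.opNorm_le_bound _ (by positivity) (fun b => hfb a b)
  let F : H →L[ℂ] (B →L[ℂ] ℂ) := F0.extendOfNorm j
  have hFj : ∀ a, F (j a) = F0 a := fun a => LinearMap.extendOfNorm_eq hd ⟨C, hF0n⟩ a
  have hFn : ∀ x, ‖F x‖ ≤ C * ‖x‖ := fun x => by
    refine hd.induction_on (p := fun x => ‖F x‖ ≤ C * ‖x‖) x (isClosed_le (by fun_prop) (by fun_prop)) ?_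
    intro a; rw [hFj]; exact hF0n a
  have hFi : ∀ x b, ∀ τ : ℝ, 0 < τ → (F x b).re ≤ ‖J1 x‖^2 + τ^2 * ‖J2 x‖^2 + (τ^2)⁻¹ * (g2 (b * star b)).re + (g1 (star b * b)).re := by
    intro x b τ hτ
    refine hd.induction_on (p := fun x => (F x b).re ≤ ‖J1 x‖^2 + τ^2 * ‖J2 x‖^2 + (τ^2)⁻¹ * (g2 (b * star b)).re + (g1 (star b * b)).re) x
      (isClosed_le (by fun_prop) (by fun_prop)) ?_
    intro a; rw [hFj, hF0, e1, e2]; exact hf a b τ hτ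
  -- S
  let S : H →L[ℂ] H := ContinuousLinearMap.adjoint J1 ∘L J1
  have hS : ∀ x, (inner ℂ (S x) x).re = ‖J1 x‖^2 := by
    intro x
    change (inner ℂ (ContinuousLinearMap.adjoint J1 (J1 x)) x).re = _
    rw [ContinuousLinearMap.adjoint_inner_left, inner_self_eq_norm_sq_to_K]
    norm_cast
  have hS1 : ∀ x, (inner ℂ ((1 - S) x) x).re = ‖J2 x‖^2 := by
    intro x
    change (inner ℂ (x - S x) x).re = _
    rw [inner_sub_left, Complex.sub_re, hS, inner_self_eq_norm_sq_to_K]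
    have := e3 x
    have h3 : (((‖x‖ : ℂ))^2).re = ‖x‖^2 := by norm_cast
    erw [h3]
    linarith
  have hSsa : IsSelfAdjoint S := by
    rw [ContinuousLinearMap.isSelfAdjoint_iff']
    simp [S, ContinuousLinearMap.adjoint_comp]
  have hS0 : 0 ≤ S := by
    rw [ContinuousLinearMap.nonneg_iff_isPositive]
    refine ContinuousLinearMap.isPositive_def'.2 ⟨hSsa, fun x => ?_⟩
    change 0 ≤ (inner ℂ (S x) x).re
    rw [hS]; positivity
  have hSle : S ≤ 1 := by
    rw [← sub_nonneg, ContinuousLinearMap.nonneg_iff_isPositive]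
    refine ContinuousLinearMap.isPositive_def'.2 ⟨(IsSelfAdjoint.one _).sub hSsa, fun x => ?_⟩
    change 0 ≤ (inner ℂ ((1 - S) x) x).re
    rw [hS1]; positivity
  obtain ⟨P, hPf, hPe, hP1, hP2⟩ := specLemma S hS0 hSle (j '' E) (hE.image _) (ε / (C + 1)) (by positivity)
  simp only [hS] at hP1
  simp only [hS1] at hP2
  let W := LinearMap.range P.toLinearMap
  haveI : FiniteDimensional ℂ W := hPf
  let e := stdOrthonormalBasis ℂ W
  have hP : ∀ x, P x = ∑ m, inner ℂ (e m : H) (P x) • (e m : H) := by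
    intro x
    have := e.sum_repr' ⟨P x, ⟨x, rfl⟩⟩
    have := congrArg (Subtype.val) this
    refine this.symm.trans ?_
    simp
  refine ⟨Module.finrank ℂ W, fun m => LinearMap.mkContinuous ((innerSL ℂ (e m : H) ∘L P).toLinearMap ∘ₗ j) (‖innerSL ℂ (e m : H) ∘L P‖ * Real.sqrt (‖f1‖ + ‖f2‖)) (fun a => by
      refine ((innerSL ℂ (e m : H) ∘L P).le_opNorm _).trans ?_
      rw [mul_assoc]
      exact mul_le_mul_of_nonneg_left (hjb a) (norm_nonneg _)), fun m => F (e m), ?_, ?_, ?_⟩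
  · intro b hb m
    refine hd.induction_on (p := fun x => F x b = 0) (e m : H) (isClosed_eq (by fun_prop) (by fun_prop)) ?_
    intro a; rw [hFj, hF0, hb]
  all_goals
    have hG : ∀ a b, F (P (j a)) b = ∑ m, inner ℂ (e m : H) (P (j a)) * F (e m) b := by
      intro a b
      conv_lhs => rw [hP]
      rw [map_sum, ContinuousLinearMap.sum_apply]
      refine Finset.sum_congr rfl fun m _ => ?_
      rw [map_smul]; rfl
  · intro a ha b
    change ‖f a b - ∑ m, inner ℂ (e m : H) (P (j a)) * F (e m) b‖ ≤ _
    rw [← hG, ← hF0, ← hFj, ← ContinuousLinearMap.sub_apply, ← map_sub]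
    refine (ContinuousLinearMap.le_opNorm _ _).trans ?_
    gcongr
    refine (hFn _).trans ?_
    rw [norm_sub_rev]
    have := hPe _ ⟨a, ha, rfl⟩
    calc _ ≤ C * (ε / (C + 1)) := by gcongr
      _ ≤ (C + 1) * (ε / (C + 1)) := by gcongr; linarith
      _ = ε := by field_simp
  · intro a b τ hτ
    change (∑ m, inner ℂ (e m : H) (P (j a)) * F (e m) b).re ≤ _
    rw [← hG]
    refine (hFi _ b τ hτ).trans ?_
    have a1 := hP1 (j a)
    have a2 := hP2 (j a)
    rw [e1] at a1
    rw [e2] at a2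
    gcongr
end
end SliceMap

namespace SliceMap

section
open Matrix

/-- rows orthonormal or zero -/
structure ONZ {n k : Type*} [Fintype k] (z : n → k → ℂ) : Prop where
  unit : ∀ m, (∑ j, star (z m j) * z m j = 1) ∨ (∀ j, z m j = 0)
  orth : ∀ m m', m ≠ m' → ∑ j, star (z m j) * z m' j = 0

open scoped ComplexOrder in
theorem svd {p q : ℕ} (α : Matrix (Fin p) (Fin q) ℂ) : ∃ (x : Fin p → Fin p → ℂ) (s : Fin p → ℝ) (x' : Fin p → Fin q → ℂ),
    ONZ x ∧ ONZ x' ∧ (∀ m, 0 ≤ s m) ∧ (∀ i k, α i k = ∑ m, (s m : ℂ) * x m i * x' m k) ∧ ∑ m, (s m)^2 = ∑ i, ∑ k, ‖α i k‖^2 := by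
  have hp : (α * αᴴ).PosSemidef := posSemidef_self_mul_conjTranspose α
  have hH := hp.1
  let U : Matrix (Fin p) (Fin p) ℂ := hH.eigenvectorUnitary
  let l := hH.eigenvalues
  have hl : ∀ i, 0 ≤ l i := hp.eigenvalues_nonneg
  have hU1 : Uᴴ * U = 1 := Unitary.coe_star_mul_self hH.eigenvectorUnitary
  have hU2 : U * Uᴴ = 1 := Unitary.coe_mul_star_self hH.eigenvectorUnitary
  have hsp : α * αᴴ = U * diagonal (fun i => (l i : ℂ)) * Uᴴ := hH.spectral_theorem
  let Y := Uᴴ * α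
  have hUY : α = U * Y := by simp only [Y]; rw [← Matrix.mul_assoc, hU2, Matrix.one_mul]
  have hYY : Y * Yᴴ = diagonal (fun i => (l i : ℂ)) := by
    have : Y * Yᴴ = Uᴴ * (α * αᴴ) * U := by simp [Y, Matrix.mul_assoc]
    rw [this, hsp]
    calc _ = (Uᴴ * U) * diagonal (fun i => (l i : ℂ)) * (Uᴴ * U) := by simp only [mul_assoc]
      _ = _ := by rw [hU1]; simp
  have hY : ∀ m m', ∑ k, star (Y m k) * Y m' k = if m' = m then (l m' : ℂ) else 0 := by
    intro m m'
    have := congrFun (congrFun hYY m') m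
    rw [diagonal_apply, mul_apply] at this
    rw [← this]
    refine Finset.sum_congr rfl fun k _ => ?_
    rw [conjTranspose_apply, mul_comm]
  let s : Fin p → ℝ := fun m => Real.sqrt (l m)
  have hs2 : ∀ m, ((s m : ℂ))^2 = l m := fun m => by
    have : (s m)^2 = l m := Real.sq_sqrt (hl m)
    rw [← this]; norm_cast
  have hY0 : ∀ m, s m = 0 → ∀ k, Y m k = 0 := by
    intro m hm k
    have h0 : l m = 0 := (Real.sqrt_eq_zero (hl m)).1 hm
    have := hY m m
    rw [if_pos rfl, h0] at this
    have h2 : ∑ k, ‖Y m k‖^2 = 0 := by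
      have h3 : ((∑ k, ‖Y m k‖^2 : ℝ) : ℂ) = 0 := by
        rw [← Complex.ofReal_zero, ← this]
        push_cast
        refine Finset.sum_congr rfl fun k _ => ?_
        exact (Complex.conj_mul' (Y m k)).symm
      exact_mod_cast h3
    have := (Finset.sum_eq_zero_iff_of_nonneg (fun _ _ => by positivity)).1 h2 k (Finset.mem_univ _)
    simpa using this
  refine ⟨fun m i => U i m, s, fun m k => (s m : ℂ)⁻¹ * Y m k, ⟨?_, ?_⟩, ⟨?_, ?_⟩, fun m => Real.sqrt_nonneg _, ?_, ?_⟩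
  · intro m
    left
    have := congrFun (congrFun hU1 m) m
    simpa [mul_apply, conjTranspose_apply] using this
  · intro m m' h
    have := congrFun (congrFun hU1 m) m'
    simpa [mul_apply, conjTranspose_apply, h] using this
  · intro m
    by_cases hm : s m = 0
    · right; intro k; rw [hY0 m hm, mul_zero]
    · left
      have := hY m m
      rw [if_pos rfl, ← hs2] at this
      have hm' : (s m : ℂ) ≠ 0 := by exact_mod_cast hm
      calc _ = ((s m : ℂ)⁻¹)^2 * ∑ k, star (Y m k) * Y m k := by
            rw [Finset.mul_sum]
            refine Finset.sum_congr rfl fun k _ => ?_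
            simp; ring
        _ = 1 := by rw [this]; field_simp
  · intro m m' h
    have := hY m m'
    rw [if_neg (Ne.symm h)] at this
    calc _ = ((s m : ℂ)⁻¹) * ((s m' : ℂ)⁻¹) * ∑ k, star (Y m k) * Y m' k := by
            rw [Finset.mul_sum]
            refine Finset.sum_congr rfl fun k _ => ?_
            simp; ring
        _ = 0 := by rw [this, mul_zero]
  · intro i k
    conv_lhs => rw [hUY]
    rw [mul_apply]
    refine Finset.sum_congr rfl fun m _ => ?_
    by_cases hm : s m = 0
    · simp [hY0 m hm]
    · have hm' : (s m : ℂ) ≠ 0 := by exact_mod_cast hm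
      field_simp
  · have h1 : ∑ m, (s m)^2 = ∑ m, l m := Finset.sum_congr rfl fun m _ => Real.sq_sqrt (hl m)
    have h2 : trace (α * αᴴ) = ∑ m, (l m : ℂ) := by
      rw [hsp, trace_mul_comm, ← mul_assoc, hU1, one_mul, trace_diagonal]
    have h3 : trace (α * αᴴ) = ∑ i, ∑ k, ((‖α i k‖^2 : ℝ) : ℂ) := by
      rw [trace]
      refine Finset.sum_congr rfl fun i _ => ?_
      rw [diag_apply, mul_apply]
      refine Finset.sum_congr rfl fun k _ => ?_
      rw [conjTranspose_apply]
      push_cast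
      exact Complex.mul_conj' _
    rw [h1]
    have := h2.symm.trans h3
    exact_mod_cast this

theorem bessel {K : Type*} [NormedAddCommGroup K] [InnerProductSpace ℂ K] {n k : Type*} [Fintype n] [Fintype k] [DecidableEq n] {z : n → k → ℂ} (hz : ONZ z)
    (ζ : k → K) : ∑ m, ‖∑ j, z m j • ζ j‖^2 ≤ ∑ j, ‖ζ j‖^2 := by
  set ξ : n → K := fun m => ∑ j, z m j • ζ j with hξ
  have h0 : 0 ≤ ∑ j, ‖ζ j - ∑ m, star (z m j) • ξ m‖^2 := by positivity
  have h1 : ∑ j, inner ℂ (ζ j) (∑ m, star (z m j) • ξ m) = ((∑ m, ‖ξ m‖^2 : ℝ) : ℂ) := by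
    simp only [inner_sum, inner_smul_right]
    rw [Finset.sum_comm]
    push_cast
    refine Finset.sum_congr rfl fun m _ => ?_
    have : (‖ξ m‖ : ℂ)^2 = inner ℂ (ξ m) (ξ m) := by
      rw [inner_self_eq_norm_sq_to_K]; rfl
    rw [this]
    have e : inner ℂ (ξ m) (ξ m) = inner ℂ (∑ j, z m j • ζ j) (ξ m) := rfl
    rw [e, sum_inner]
    refine Finset.sum_congr rfl fun j _ => ?_
    rw [inner_smul_left]; rfl
  have hd : ∀ m, (∑ j, star (z m j) * z m j) * inner ℂ (ξ m) (ξ m) = ((‖ξ m‖^2 : ℝ) : ℂ) := by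
    intro m
    rcases hz.unit m with h | h
    · rw [h, one_mul, inner_self_eq_norm_sq_to_K]; norm_cast
    · have : ξ m = 0 := by simp [hξ, h]
      rw [this]; simp
  have h2 : ∑ j, inner ℂ (∑ m, star (z m j) • ξ m) (∑ m, star (z m j) • ξ m) = ((∑ m, ‖ξ m‖^2 : ℝ) : ℂ) := by
    simp only [inner_sum, inner_smul_right, sum_inner, inner_smul_left]
    rw [Finset.sum_comm]
    push_cast
    refine Finset.sum_congr rfl fun m _ => ?_
    simp only [Finset.mul_sum]
    rw [Finset.sum_comm, Finset.sum_eq_single m]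
    · have := hd m
      push_cast at this
      rw [← this, Finset.sum_mul]
      refine Finset.sum_congr rfl fun j _ => ?_
      simp [mul_assoc]
    · intro m' _ hm'
      have := hz.orth m m' hm'.symm
      calc _ = (∑ j, star (z m j) * z m' j) * inner ℂ (ξ m') (ξ m) := by
            rw [Finset.sum_mul]
            refine Finset.sum_congr rfl fun j _ => ?_
            simp [mul_assoc]
        _ = 0 := by rw [this, zero_mul]
    · simp
  have h3 : ∑ j, ‖ζ j - ∑ m, star (z m j) • ξ m‖^2 = ∑ j, ‖ζ j‖^2 - 2 * (∑ j, inner ℂ (ζ j) (∑ m, star (z m j) • ξ m)).re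
      + (∑ j, inner ℂ (∑ m, star (z m j) • ξ m) (∑ m, star (z m j) • ξ m)).re := by
    rw [Complex.re_sum, Complex.re_sum, Finset.mul_sum, ← Finset.sum_sub_distrib, ← Finset.sum_add_distrib]
    refine Finset.sum_congr rfl fun j _ => ?_
    rw [@norm_sub_sq ℂ]
    congr 1
    exact (inner_self_eq_norm_sq (𝕜 := ℂ) _).symm
  rw [h3, h1, h2, Complex.ofReal_re] at h0
  linarith
end
end SliceMap

namespace SliceMap

section
variable {A B : Type*} [NonUnitalCStarAlgebra A] [NonUnitalCStarAlgebra B]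

lemma f_sum_le {A : Type*} [NonUnitalCStarAlgebra A] (f : A →L[ℂ] ℂ) {n : Type*} [Fintype n] (g : n → A) : ∑ j, (f (g j)).re ≤ ‖f‖ * ‖∑ j, g j‖ := by
  rw [← Complex.re_sum, ← map_sum]
  exact (Complex.re_le_norm _).trans (f.le_opNorm _)

theorem rowB {K : Type*} [NormedAddCommGroup K] [InnerProductSpace ℂ K] {p : ℕ} {N : Matrix (Fin p) (Fin p) A → ℝ} (hN : IsCStarNorm N)
    (f : A →L[ℂ] ℂ) (T : A →ₗ[ℂ] K) (hT : ∀ a, ‖T a‖^2 = (f (a * star a)).re) {n : Type*} [Fintype n] [DecidableEq n]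
    (x : Fin p → ℂ) (hx : (∑ i, star (x i) * x i = 1) ∨ ∀ i, x i = 0) (z : n → Fin p → ℂ) (hz : ONZ z) (v : Matrix (Fin p) (Fin p) A) :
    ∑ m, ‖T (∑ i, ∑ j, (x i * z m j) • v i j)‖^2 ≤ ‖f‖ * (N v * N v) := by
  have hn := CN.nonneg hN v
  rcases hx with hx | hx
  · have e : ∀ m, T (∑ i, ∑ j, (x i * z m j) • v i j) = ∑ j, z m j • T (∑ i, x i • v i j) := by
      intro m
      rw [Finset.sum_comm, map_sum]
      refine Finset.sum_congr rfl fun j _ => ?_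
      rw [← map_smul, Finset.smul_sum]
      congr 1
      refine Finset.sum_congr rfl fun i _ => ?_
      rw [smul_smul, mul_comm]
    simp only [e]
    refine (bessel hz _).trans ?_
    simp only [hT]
    refine (f_sum_le f _).trans ?_
    gcongr
    exact cn_row hN x hx v
  · simp only [hx, zero_mul, zero_smul, Finset.sum_const_zero, map_zero, norm_zero]
    simp only [ne_eq, OfNat.ofNat_ne_zero, not_false_eq_true, zero_pow, Finset.sum_const_zero]
    positivity

theorem colB {K : Type*} [NormedAddCommGroup K] [InnerProductSpace ℂ K] {p : ℕ} {N : Matrix (Fin p) (Fin p) A → ℝ} (hN : IsCStarNorm N)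
    (f : A →L[ℂ] ℂ) (T : A →ₗ[ℂ] K) (hT : ∀ a, ‖T a‖^2 = (f (star a * a)).re) {n : Type*} [Fintype n] [DecidableEq n]
    (x : Fin p → ℂ) (hx : (∑ i, star (x i) * x i = 1) ∨ ∀ i, x i = 0) (z : n → Fin p → ℂ) (hz : ONZ z) (v : Matrix (Fin p) (Fin p) A) :
    ∑ m, ‖T (∑ i, ∑ j, (z m i * x j) • v i j)‖^2 ≤ ‖f‖ * (N v * N v) := by
  have hn := CN.nonneg hN v
  rcases hx with hx | hx
  · have e : ∀ m, T (∑ i, ∑ j, (z m i * x j) • v i j) = ∑ i, z m i • T (∑ j, x j • v i j) := by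
      intro m
      rw [map_sum]
      refine Finset.sum_congr rfl fun j _ => ?_
      rw [← map_smul, Finset.smul_sum]
      congr 1
      refine Finset.sum_congr rfl fun i _ => ?_
      rw [smul_smul]
    simp only [e]
    refine (bessel hz _).trans ?_
    simp only [hT]
    refine (f_sum_le f _).trans ?_
    gcongr
    exact cn_col hN x hx v
  · simp only [hx, mul_zero, zero_smul, Finset.sum_const_zero, map_zero, norm_zero]
    simp only [ne_eq, OfNat.ofNat_ne_zero, not_false_eq_true, zero_pow, Finset.sum_const_zero]
    positivity

lemma sum6 {I J K L M N : Type*} [Fintype I] [Fintype J] [Fintype K] [Fintype L] [Fintype M] [Fintype N] (h : M → N → I → J → K → L → ℂ) :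
    ∑ i, ∑ k, ∑ j, ∑ l, ∑ m, ∑ n, h m n i j k l = ∑ m, ∑ n, ∑ i, ∑ j, ∑ k, ∑ l, h m n i j k l := by
  have := Fintype.sum_equiv (M := ℂ) (⟨fun x => (x.2.2.2.2.1, x.2.2.2.2.2, x.1, x.2.2.1, x.2.1, x.2.2.2.1), fun y => (y.2.2.1, y.2.2.2.2.1, y.2.2.2.1, y.2.2.2.2.2, y.1, y.2.1), fun _ => rfl, fun _ => rfl⟩ : I × K × J × L × M × N ≃ M × N × I × J × K × L)
    (fun x => h x.2.2.2.2.1 x.2.2.2.2.2 x.1 x.2.2.1 x.2.1 x.2.2.2.1) (fun y => h y.1 y.2.1 y.2.2.1 y.2.2.2.1 y.2.2.2.2.1 y.2.2.2.2.2) (fun _ => rfl)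
  simpa only [Fintype.sum_prod_type] using this

theorem coreB {K1 K2 L1 L2 : Type*} [NormedAddCommGroup K1] [InnerProductSpace ℂ K1] [NormedAddCommGroup K2] [InnerProductSpace ℂ K2]
    [NormedAddCommGroup L1] [InnerProductSpace ℂ L1] [NormedAddCommGroup L2] [InnerProductSpace ℂ L2]
    {p q : ℕ} {NA : Matrix (Fin p) (Fin p) A → ℝ} (hNA : IsCStarNorm NA) {NB : Matrix (Fin q) (Fin q) B → ℝ} (hNB : IsCStarNorm NB)
    (f1 f2 : A →L[ℂ] ℂ) (g1 g2 : B →L[ℂ] ℂ) (T1 : A →ₗ[ℂ] K1) (T2 : A →ₗ[ℂ] K2) (R1 : B →ₗ[ℂ] L1) (R2 : B →ₗ[ℂ] L2)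
    (hT1 : ∀ a, ‖T1 a‖^2 = (f1 (a * star a)).re) (hT2 : ∀ a, ‖T2 a‖^2 = (f2 (star a * a)).re)
    (hR1 : ∀ a, ‖R1 a‖^2 = (g1 (star a * a)).re) (hR2 : ∀ a, ‖R2 a‖^2 = (g2 (a * star a)).re)
    (Γ : A →ₗ[ℂ] B →ₗ[ℂ] ℂ) (hΓ : ∀ a b, ∀ τ : ℝ, 0 < τ → (Γ a b).re ≤ ‖T1 a‖^2 + τ^2 * ‖T2 a‖^2 + (τ^2)⁻¹ * ‖R2 b‖^2 + ‖R1 b‖^2)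
    (α β : Matrix (Fin p) (Fin q) ℂ) (v : Matrix (Fin p) (Fin p) A) (w : Matrix (Fin q) (Fin q) B) :
    (∑ i, ∑ k, ∑ j, ∑ l, (α i k * β j l) * Γ (v i j) (w k l)).re ≤
      (∑ i, ∑ k, ‖α i k‖^2) * (‖f1‖ * (NA v * NA v) + ‖g2‖ * (NB w * NB w)) +
      (∑ i, ∑ k, ‖β i k‖^2) * (‖f2‖ * (NA v * NA v) + ‖g1‖ * (NB w * NB w)) := by
  obtain ⟨x, s, x', hx, hx', hs, hα, hsα⟩ := svd α
  obtain ⟨z, t, z', hz, hz', ht, hβ, htβ⟩ := svd β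
  let v' := fun m n => ∑ i, ∑ j, (x m i * z n j) • v i j
  let w' := fun m n => ∑ k, ∑ l, (x' m k * z' n l) • w k l
  have hZ : ∑ i, ∑ k, ∑ j, ∑ l, (α i k * β j l) * Γ (v i j) (w k l) = ∑ m, ∑ n, ((s m * t n : ℝ) : ℂ) * Γ (v' m n) (w' m n) := by
    have e1 : ∀ i k j l, (α i k * β j l) * Γ (v i j) (w k l) = ∑ m, ∑ n, ((s m * t n : ℝ) : ℂ) * ((x m i * z n j) * ((x' m k * z' n l) * Γ (v i j) (w k l))) := by
      intro i k j l
      rw [hα, hβ, Finset.sum_mul_sum, Finset.sum_mul]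
      refine Finset.sum_congr rfl fun m _ => ?_
      rw [Finset.sum_mul]
      refine Finset.sum_congr rfl fun n _ => ?_
      push_cast; ring
    simp only [e1]
    rw [sum6 (fun m n i j k l => ((s m * t n : ℝ) : ℂ) * ((x m i * z n j) * ((x' m k * z' n l) * Γ (v i j) (w k l))))]
    refine Finset.sum_congr rfl fun m _ => ?_
    refine Finset.sum_congr rfl fun n _ => ?_
    have e2 : Γ (v' m n) = ∑ i, ∑ j, (x m i * z n j) • Γ (v i j) := by
      simp only [v', map_sum, map_smul]
    have e3 : ∀ g : B →ₗ[ℂ] ℂ, g (w' m n) = ∑ k, ∑ l, (x' m k * z' n l) * g (w k l) := by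
      intro g
      simp only [w', map_sum, map_smul, smul_eq_mul]
    rw [e2, LinearMap.sum_apply, Finset.mul_sum]
    refine Finset.sum_congr rfl fun i _ => ?_
    rw [LinearMap.sum_apply, Finset.mul_sum]
    refine Finset.sum_congr rfl fun j _ => ?_
    rw [LinearMap.smul_apply, e3, smul_eq_mul]
    simp only [Finset.mul_sum]
  have hterm : ∀ m n, (((s m * t n : ℝ) : ℂ) * Γ (v' m n) (w' m n)).re ≤
      (s m)^2 * (‖T1 (v' m n)‖^2 + ‖R2 (w' m n)‖^2) + (t n)^2 * (‖T2 (v' m n)‖^2 + ‖R1 (w' m n)‖^2) := by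
    intro m n
    rcases (hs m).eq_or_lt with h0 | h0
    · rw [← h0]; simp; positivity
    rcases (ht n).eq_or_lt with h1 | h1
    · rw [← h1]; simp; positivity
    have := hΓ ((s m : ℂ) • v' m n) ((t n : ℂ) • w' m n) (t n / s m) (by positivity)
    simp only [map_smul, LinearMap.smul_apply, norm_smul, smul_eq_mul, Complex.norm_real, Real.norm_of_nonneg h0.le, Real.norm_of_nonneg h1.le] at this
    have e : ((s m * t n : ℝ) : ℂ) * Γ (v' m n) (w' m n) = (t n : ℂ) * ((s m : ℂ) * Γ (v' m n) (w' m n)) := by push_cast; ring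
    have e' : ((s m * t n : ℝ) : ℂ) * Γ (v' m n) (w' m n) = (s m : ℂ) * ((t n : ℂ) * Γ (v' m n) (w' m n)) := by push_cast; ring
    first | rw [← e] at this | rw [← e'] at this
    refine this.trans (le_of_eq ?_)
    field_simp
    ring
  rw [hZ, Complex.re_sum]
  simp only [Complex.re_sum]
  calc _ ≤ ∑ m, ∑ n, ((s m)^2 * (‖T1 (v' m n)‖^2 + ‖R2 (w' m n)‖^2) + (t n)^2 * (‖T2 (v' m n)‖^2 + ‖R1 (w' m n)‖^2)) :=
        Finset.sum_le_sum fun m _ => Finset.sum_le_sum fun n _ => hterm m n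
    _ = ∑ m, (s m)^2 * (∑ n, ‖T1 (v' m n)‖^2 + ∑ n, ‖R2 (w' m n)‖^2) + ∑ n, (t n)^2 * (∑ m, ‖T2 (v' m n)‖^2 + ∑ m, ‖R1 (w' m n)‖^2) := by
        simp only [Finset.sum_add_distrib, Finset.mul_sum, mul_add]
        rw [Finset.sum_comm (f := fun m n => t n ^ 2 * ‖T2 (v' m n)‖^2), Finset.sum_comm (f := fun m n => t n ^ 2 * ‖R1 (w' m n)‖^2)]
    _ ≤ ∑ m, (s m)^2 * (‖f1‖ * (NA v * NA v) + ‖g2‖ * (NB w * NB w)) + ∑ n, (t n)^2 * (‖f2‖ * (NA v * NA v) + ‖g1‖ * (NB w * NB w)) := by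
        gcongr with m _ n _
        · exact rowB hNA f1 T1 hT1 (x m) (hx.unit m) z hz v
        · exact rowB hNB g2 R2 hR2 (x' m) (hx'.unit m) z' hz' w
        · exact colB hNA f2 T2 hT2 (z n) (hz.unit n) x hx v
        · exact colB hNB g1 R1 hR1 (z' n) (hz'.unit n) x' hx' w
    _ = _ := by rw [← Finset.sum_mul, ← Finset.sum_mul, hsα, htβ]
end
end SliceMap

namespace SliceMap

section
variable {A B : Type u} [NonUnitalCStarAlgebra A] [NonUnitalCStarAlgebra B]

lemma inv_mul_sq_le {x δ : ℝ} (hx : 0 ≤ x) (hδ : 0 < δ) : ((x + δ)⁻¹ * x)^2 ≤ 1 := by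
  have : (x + δ)⁻¹ * x ≤ 1 := by
    rw [inv_mul_le_iff₀ (by positivity)]; linarith
  have h0 : 0 ≤ (x + δ)⁻¹ * x := by positivity
  nlinarith

theorem boundG0 {K1 K2 L1 L2 : Type*} [NormedAddCommGroup K1] [InnerProductSpace ℂ K1] [NormedAddCommGroup K2] [InnerProductSpace ℂ K2]
    [NormedAddCommGroup L1] [InnerProductSpace ℂ L1] [NormedAddCommGroup L2] [InnerProductSpace ℂ L2]
    {p q : ℕ} {NA : Matrix (Fin p) (Fin p) A → ℝ} (hNA : IsCStarNorm NA) {NB : Matrix (Fin q) (Fin q) B → ℝ} (hNB : IsCStarNorm NB)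
    (f1 f2 : A →L[ℂ] ℂ) (g1 g2 : B →L[ℂ] ℂ) (T1 : A →ₗ[ℂ] K1) (T2 : A →ₗ[ℂ] K2) (R1 : B →ₗ[ℂ] L1) (R2 : B →ₗ[ℂ] L2)
    (hT1 : ∀ a, ‖T1 a‖^2 = (f1 (a * star a)).re) (hT2 : ∀ a, ‖T2 a‖^2 = (f2 (star a * a)).re)
    (hR1 : ∀ a, ‖R1 a‖^2 = (g1 (star a * a)).re) (hR2 : ∀ a, ‖R2 a‖^2 = (g2 (a * star a)).re)
    (Γ : A →ₗ[ℂ] B →ₗ[ℂ] ℂ) (hΓ : ∀ a b, ∀ τ : ℝ, 0 < τ → (Γ a b).re ≤ ‖T1 a‖^2 + τ^2 * ‖T2 a‖^2 + (τ^2)⁻¹ * ‖R2 b‖^2 + ‖R1 b‖^2)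
    (α β : Matrix (Fin p) (Fin q) ℂ) (v : Matrix (Fin p) (Fin p) A) (w : Matrix (Fin q) (Fin q) B) :
    ‖∑ i, ∑ k, ∑ j, ∑ l, (α i k * β j l) * Γ (v i j) (w k l)‖ ≤
      2 * (‖f1‖ + ‖f2‖ + ‖g1‖ + ‖g2‖) * (Real.sqrt (∑ i, ∑ k, ‖α i k‖^2) * NA v * NB w * Real.sqrt (∑ i, ∑ k, ‖β i k‖^2)) := by
  set Z := ∑ i, ∑ k, ∑ j, ∑ l, (α i k * β j l) * Γ (v i j) (w k l) with hZ
  set a := Real.sqrt (∑ i, ∑ k, ‖α i k‖^2) with ha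
  set b := Real.sqrt (∑ i, ∑ k, ‖β i k‖^2) with hb
  have ha2 : a^2 = ∑ i, ∑ k, ‖α i k‖^2 := Real.sq_sqrt (by positivity)
  have hb2 : b^2 = ∑ i, ∑ k, ‖β i k‖^2 := Real.sq_sqrt (by positivity)
  have ha0 : 0 ≤ a := Real.sqrt_nonneg _
  have hb0 : 0 ≤ b := Real.sqrt_nonneg _
  have hv := CN.nonneg hNA v
  have hw := CN.nonneg hNB w
  obtain ⟨c, hc, hcz⟩ := RCLike.exists_norm_eq_mul_self Z
  have hc' : (c * Z).re = ‖Z‖ := by rw [← hcz]; simp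
  have key : ∀ δ : ℝ, 0 < δ → ‖Z‖ ≤ 2 * (‖f1‖ + ‖f2‖ + ‖g1‖ + ‖g2‖) * ((a + δ) * (NA v + δ) * (NB w + δ) * (b + δ)) := by
    intro δ hδ
    have pa : 0 < a + δ := by linarith
    have pb : 0 < b + δ := by linarith
    have pv : 0 < NA v + δ := by linarith
    have pw : 0 < NB w + δ := by linarith
    have := coreB hNA hNB f1 f2 g1 g2 T1 T2 R1 R2 hT1 hT2 hR1 hR2 Γ hΓ
      ((((a + δ)⁻¹ : ℝ) * c : ℂ) • α) ((((b + δ)⁻¹ : ℝ) : ℂ) • β) ((((NA v + δ)⁻¹ : ℝ) : ℂ) • v) ((((NB w + δ)⁻¹ : ℝ) : ℂ) • w)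
    have eZ : ∑ i, ∑ k, ∑ j, ∑ l, (((((a + δ)⁻¹ : ℝ) * c : ℂ) • α) i k * ((((b + δ)⁻¹ : ℝ) : ℂ) • β) j l) *
        Γ (((((NA v + δ)⁻¹ : ℝ) : ℂ) • v) i j) (((((NB w + δ)⁻¹ : ℝ) : ℂ) • w) k l) =
        (((a + δ)⁻¹ * (NA v + δ)⁻¹ * (NB w + δ)⁻¹ * (b + δ)⁻¹ : ℝ) : ℂ) * (c * Z) := by
      rw [hZ]
      simp only [Finset.mul_sum]
      refine Finset.sum_congr rfl fun i _ => Finset.sum_congr rfl fun k _ => Finset.sum_congr rfl fun j _ => Finset.sum_congr rfl fun l _ => ?_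
      simp only [Matrix.smul_apply, map_smul, LinearMap.smul_apply, smul_eq_mul]
      push_cast
      ring
    rw [eZ, Complex.re_ofReal_mul, hc', hNA.smul_eq, hNB.smul_eq] at this
    have eα : ∑ i, ∑ k, ‖((((a + δ)⁻¹ : ℝ) * c : ℂ) • α) i k‖^2 = ((a + δ)⁻¹ * a)^2 := by
      rw [mul_pow, ha2, Finset.mul_sum]
      refine Finset.sum_congr rfl fun i _ => ?_
      rw [Finset.mul_sum]
      refine Finset.sum_congr rfl fun k _ => ?_
      rw [Matrix.smul_apply, norm_smul, norm_mul, hc, Complex.norm_real, Real.norm_of_nonneg (by positivity), mul_one, mul_pow]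
    have eβ : ∑ i, ∑ k, ‖((((b + δ)⁻¹ : ℝ) : ℂ) • β) i k‖^2 = ((b + δ)⁻¹ * b)^2 := by
      rw [mul_pow, hb2, Finset.mul_sum]
      refine Finset.sum_congr rfl fun i _ => ?_
      rw [Finset.mul_sum]
      refine Finset.sum_congr rfl fun k _ => ?_
      rw [Matrix.smul_apply, norm_smul, Complex.norm_real, Real.norm_of_nonneg (by positivity), mul_pow]
    rw [eα, eβ, Complex.norm_real, Complex.norm_real, Real.norm_of_nonneg (by positivity), Real.norm_of_nonneg (by positivity), ← pow_two, ← pow_two] at this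
    have a1 := inv_mul_sq_le ha0 hδ
    have a2 := inv_mul_sq_le hb0 hδ
    have a3 := inv_mul_sq_le hv hδ
    have a4 := inv_mul_sq_le hw hδ
    have t1 : ((a + δ)⁻¹ * a)^2 * (‖f1‖ * ((NA v + δ)⁻¹ * NA v)^2 + ‖g2‖ * ((NB w + δ)⁻¹ * NB w)^2) ≤ 1 * (‖f1‖ * 1 + ‖g2‖ * 1) := by gcongr
    have t2 : ((b + δ)⁻¹ * b)^2 * (‖f2‖ * ((NA v + δ)⁻¹ * NA v)^2 + ‖g1‖ * ((NB w + δ)⁻¹ * NB w)^2) ≤ 1 * (‖f2‖ * 1 + ‖g1‖ * 1) := by gcongr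
    have t3 : (a + δ)⁻¹ * (NA v + δ)⁻¹ * (NB w + δ)⁻¹ * (b + δ)⁻¹ * ‖Z‖ ≤ 2 * (‖f1‖ + ‖f2‖ + ‖g1‖ + ‖g2‖) := by
      have := norm_nonneg f1
      have := norm_nonneg f2
      have := norm_nonneg g1
      have := norm_nonneg g2
      linarith
    rw [← mul_inv, ← mul_inv, ← mul_inv, inv_mul_le_iff₀ (by positivity)] at t3
    linarith
  have lim : Filter.Tendsto (fun δ : ℝ => 2 * (‖f1‖ + ‖f2‖ + ‖g1‖ + ‖g2‖) * ((a + δ) * (NA v + δ) * (NB w + δ) * (b + δ))) (nhdsWithin 0 (Set.Ioi 0))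
      (nhds (2 * (‖f1‖ + ‖f2‖ + ‖g1‖ + ‖g2‖) * ((a + 0) * (NA v + 0) * (NB w + 0) * (b + 0)))) :=
    (Continuous.tendsto (by fun_prop) 0).mono_left nhdsWithin_le_nhds
  have := ge_of_tendsto lim (by filter_upwards [self_mem_nhdsWithin] with t ht using key t ht)
  simpa only [add_zero] using this

lemma tensor_rep (u : A ⊗[ℂ] B) : ∃ (n : ℕ) (a : Fin n → A) (b : Fin n → B), u = ∑ i, a i ⊗ₜ[ℂ] b i := by
  induction u with
  | zero => exact ⟨0, Fin.elim0, Fin.elim0, by simp⟩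
  | tmul x y => exact ⟨1, fun _ => x, fun _ => y, by simp⟩
  | add x y hx hy =>
    obtain ⟨n, a, b, rfl⟩ := hx
    obtain ⟨m, c, d, rfl⟩ := hy
    exact ⟨n + m, Fin.append a c, Fin.append b d, by simp [Fin.sum_univ_add]⟩

theorem boundG {NA : ∀ p : ℕ, Matrix (Fin p) (Fin p) A → ℝ} {NB : ∀ q : ℕ, Matrix (Fin q) (Fin q) B → ℝ}
    (hNA : ∀ p, IsCStarNorm (NA p)) (hNB : ∀ q, IsCStarNorm (NB q))
    (f1 f2 : A →L[ℂ] ℂ) (g1 g2 : B →L[ℂ] ℂ)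
    (h1 : ∀ x, f1 (star x) = star (f1 x)) (h2 : ∀ x, f2 (star x) = star (f2 x))
    (h3 : ∀ x, g1 (star x) = star (g1 x)) (h4 : ∀ x, g2 (star x) = star (g2 x))
    (p1 : ∀ a, 0 ≤ (f1 (a * star a)).re) (p2 : ∀ a, 0 ≤ (f2 (star a * a)).re)
    (p3 : ∀ b, 0 ≤ (g1 (star b * b)).re) (p4 : ∀ b, 0 ≤ (g2 (b * star b)).re)
    (Γ : A →ₗ[ℂ] B →ₗ[ℂ] ℂ) (hΓ : ∀ a b, ∀ τ : ℝ, 0 < τ → (Γ a b).re ≤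
        9 * (f1 (a * star a)).re + τ^2 * (9 * (f2 (star a * a)).re) + (τ^2)⁻¹ * (g2 (b * star b)).re + (g1 (star b * b)).re)
    (u : A ⊗[ℂ] B) : ‖TensorProduct.lift Γ u‖ ≤ 2 * (9 * ‖f1‖ + 9 * ‖f2‖ + ‖g1‖ + ‖g2‖) * osProjNorm NA NB u := by
  have q1 : ∀ a, ((9:ℂ) • f1) (a * star a) = ((9:ℝ) : ℂ) * f1 (a * star a) := fun a => by simp
  have q2 : ∀ a, ((9:ℂ) • f2) (star a * a) = ((9:ℝ) : ℂ) * f2 (star a * a) := fun a => by simp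
  obtain ⟨H, _, _, _, K, _, _, _, L, _, _, _, j, J1, J2, -, e1, e2, -⟩ := hilbE ((9:ℂ) • f1) ((9:ℂ) • f2)
    (fun x => by simp [h1]) (fun x => by simp [h2])
    (fun a => by rw [q1, Complex.re_ofReal_mul]; have := p1 a; positivity) (fun a => by rw [q2, Complex.re_ofReal_mul]; have := p2 a; positivity)
  obtain ⟨H', _, _, _, K', _, _, _, L', _, _, _, j', J1', J2', -, e1', e2', -⟩ := hilbE g2 g1 h4 h3 p4 p3
  have n1 : ‖(9:ℂ) • f1‖ = 9 * ‖f1‖ := by rw [norm_smul]; norm_num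
  have n2 : ‖(9:ℂ) • f2‖ = 9 * ‖f2‖ := by rw [norm_smul]; norm_num
  set C := 2 * (9 * ‖f1‖ + 9 * ‖f2‖ + ‖g1‖ + ‖g2‖) with hC
  have hC0 : 0 ≤ C := by positivity
  rw [osProjNorm, ← smul_eq_mul, ← Real.sInf_smul_of_nonneg hC0]
  apply le_csInf
  · refine Set.Nonempty.smul_set ?_
    obtain ⟨n, a, b, rfl⟩ := tensor_rep u
    refine ⟨_, n, n, fun ik => if ik.1 = ik.2 then 1 else 0, Matrix.diagonal a, Matrix.diagonal b, fun ik => if ik.1 = ik.2 then 1 else 0, ?_, rfl⟩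
    simp only [Fintype.sum_prod_type, ite_mul, one_mul, zero_mul, ite_smul, one_smul, zero_smul, mul_ite, mul_one, mul_zero]
    refine Finset.sum_congr rfl fun i _ => ?_
    rw [Finset.sum_eq_single i, Finset.sum_eq_single i, Finset.sum_eq_single i]
    · simp
    · intro k _ hk; simp [hk.symm]
    · simp
    · intro k _ hk; simp [Matrix.diagonal_apply_ne _ hk.symm]
    · simp
    · intro k _ hk
      simp [hk.symm]
    · simp
  · rintro _ ⟨r, ⟨p, q, α, v, w, β, rfl, rfl⟩, rfl⟩
    have := boundG0 (hNA p) (hNB q) ((9:ℂ) • f1) ((9:ℂ) • f2) g1 g2 ((J1 : H →ₗ[ℂ] K) ∘ₗ j) ((J2 : H →ₗ[ℂ] L) ∘ₗ j)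
      ((J2' : H' →ₗ[ℂ] L') ∘ₗ j') ((J1' : H' →ₗ[ℂ] K') ∘ₗ j') e1 e2 e2' e1' Γ (by
        intro a b τ hτ
        refine (hΓ a b τ hτ).trans (le_of_eq ?_)
        have E1 := e1 a
        have E2 := e2 a
        have E3 := e1' b
        have E4 := e2' b
        rw [q1, Complex.re_ofReal_mul] at E1
        rw [q2, Complex.re_ofReal_mul] at E2
        simp only [LinearMap.comp_apply, ContinuousLinearMap.coe_coe]
        rw [E1, E2, E3, E4])
      (fun i k => α (i, k)) (fun i k => β (i, k)) v w
    rw [n1, n2, ← hC] at this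
    simp only [smul_eq_mul, map_sum, map_smul, TensorProduct.lift.tmul, Fintype.sum_prod_type]
    exact this
end
end SliceMap

namespace SliceMap

lemma ideal_smul_mem {B : Type u} [NonUnitalCStarAlgebra B] (J : TwoSidedIdeal B) (hJ : IsClosed (J : Set B)) (c : ℂ) {b : B} (hb : b ∈ J) :
    c • b ∈ J := by
  letI := CStarAlgebra.spectralOrder B
  haveI := CStarAlgebra.spectralOrderedRing B
  have h := (CStarAlgebra.increasingApproximateUnit B).tendsto_mul_right b
  have h2 : Filter.Tendsto (fun x => (c • x) * b) (CStarAlgebra.approximateUnit B) (nhds (c • b)) := by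
    have h3 := h.const_smul c
    simpa only [smul_mul_assoc] using h3
  exact hJ.mem_of_tendsto h2 (Filter.Eventually.of_forall fun x => J.mul_mem_left _ _ hb)

lemma hb_sep {X : Type u} [NormedAddCommGroup X] [NormedSpace ℂ X] (M : Submodule ℂ X) (hM : IsClosed (M : Set X)) (x : X) (hx : x ∉ M) :
    ∃ F : X →L[ℂ] ℂ, (∀ y ∈ M, F y = 0) ∧ F x ≠ 0 := by
  haveI := hM
  have : (Submodule.Quotient.mk x : X ⧸ M) ≠ 0 := by rwa [Ne, Submodule.Quotient.mk_eq_zero]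
  obtain ⟨F, hF⟩ := SeparatingDual.exists_ne_zero (R := ℂ) this
  refine ⟨F.comp M.mkQL, fun y hy => ?_, hF⟩
  have : (Submodule.Quotient.mk y : X ⧸ M) = 0 := by rwa [Submodule.Quotient.mk_eq_zero]
  change F (Submodule.Quotient.mk y) = 0
  rw [this, map_zero]

theorem vanish {A B X : Type u} [NonUnitalCStarAlgebra A] [NonUnitalCStarAlgebra B]
    [NonUnitalNormedRing X] [StarRing X] [NormedSpace ℂ X] [CompleteSpace X]
    (NA : ∀ p : ℕ, Matrix (Fin p) (Fin p) A → ℝ)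
    (NB : ∀ q : ℕ, Matrix (Fin q) (Fin q) B → ℝ)
    (hNA : ∀ p, IsCStarNorm (NA p)) (hNB : ∀ q, IsCStarNorm (NB q))
    (ι : A ⊗[ℂ] B →ₗ[ℂ] X) (hX : IsTensorCompletion (osProjNorm NA NB) X ι)
    (J : Set B)
    (R : (A →L[ℂ] ℂ) → X →L[ℂ] B)
    (hR : ∀ (φ : A →L[ℂ] ℂ) (a : A) (b : B), R φ (ι (a ⊗ₜ[ℂ] b)) = φ a • b)
    (F : X →L[ℂ] ℂ) (hF : ∀ a, ∀ b ∈ J, F (ι (a ⊗ₜ[ℂ] b)) = 0) (x : X) (hx : ∀ φ : A →L[ℂ] ℂ, R φ x ∈ J) : F x = 0 := by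
  obtain ⟨f1, f2, g1, g2, h1, h2, h3, h4, p1, p2, p3, p4, hf⟩ := partD hNA hNB (norm_nonneg F) (osb_of_tensor hNA hNB ι hX F)
  set C := 2 * (9 * ‖f1‖ + 9 * ‖f2‖ + ‖g1‖ + ‖g2‖) with hC
  have hC0 : 0 ≤ C := by positivity
  have key : ∀ ε : ℝ, 0 < ε → ‖F x‖ ≤ (‖F‖ + C + 1) * ε := by
    intro ε hε
    obtain ⟨u, hu⟩ := Metric.denseRange_iff.1 hX.dense x ε hε
    rw [dist_eq_norm] at hu
    obtain ⟨N, a, b, rfl⟩ := tensor_rep u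
    set S := ∑ i, ‖b i‖ with hS
    have hS0 : 0 ≤ S := by positivity
    obtain ⟨n, φ, ψ, hk, hE, hG⟩ := approxG f1 f2 g1 g2 h1 h2 p1 p2 _ hf (Set.range a) (Set.finite_range a) (ε / (S + 1)) (by positivity)
    let Γ : A →ₗ[ℂ] B →ₗ[ℂ] ℂ := ∑ m, LinearMap.mk₂ ℂ (fun a b => φ m a * ψ m b) (fun _ _ _ => by rw [map_add, add_mul])
      (fun _ _ _ => by rw [map_smul, smul_mul_assoc]) (fun _ _ _ => by rw [map_add, mul_add]) (fun _ _ _ => by rw [map_smul, mul_smul_comm])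
    have hΓ : ∀ a b, Γ a b = ∑ m, φ m a * ψ m b := fun a b => by simp [Γ, LinearMap.sum_apply]
    have hb := boundG hNA hNB f1 f2 g1 g2 h1 h2 h3 h4 p1 p2 p3 p4 Γ (by simpa only [hΓ] using hG)
    let G : X →L[ℂ] ℂ := ∑ m, (ψ m).comp (R (φ m))
    have hGx : ∀ z, G z = ∑ m, ψ m (R (φ m) z) := fun z => by simp [G]
    have hGι : ∀ u, G (ι u) = TensorProduct.lift Γ u := by
      intro u
      have : (G : X →ₗ[ℂ] ℂ) ∘ₗ ι = TensorProduct.lift Γ := by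
        apply TensorProduct.ext'
        intro a b
        rw [TensorProduct.lift.tmul, hΓ, LinearMap.comp_apply, ContinuousLinearMap.coe_coe, hGx]
        refine Finset.sum_congr rfl fun m _ => ?_
        rw [hR, map_smul, smul_eq_mul]
      exact LinearMap.congr_fun this u
    have hGb : ∀ z, ‖G z‖ ≤ C * ‖z‖ := by
      intro z
      refine hX.dense.induction_on (p := fun z => ‖G z‖ ≤ C * ‖z‖) z (isClosed_le (by fun_prop) (by fun_prop)) ?_
      intro u
      rw [hGι, hX.norm_eq]
      exact hb u
    have hG0 : G x = 0 := by
      rw [hGx]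
      refine Finset.sum_eq_zero fun m _ => ?_
      exact hk _ (fun a => hF a _ (hx _)) m
    have hd : ‖F (ι (∑ i, a i ⊗ₜ[ℂ] b i)) - G (ι (∑ i, a i ⊗ₜ[ℂ] b i))‖ ≤ ε := by
      rw [hGι]
      simp only [map_sum, TensorProduct.lift.tmul, hΓ]
      rw [← Finset.sum_sub_distrib]
      calc _ ≤ ∑ i, ‖F (ι (a i ⊗ₜ[ℂ] b i)) - ∑ m, φ m (a i) * ψ m (b i)‖ := norm_sum_le _ _
        _ ≤ ∑ i, ε / (S + 1) * ‖b i‖ := Finset.sum_le_sum fun i _ => hE (a i) ⟨i, rfl⟩ (b i)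
        _ = ε / (S + 1) * S := by rw [← Finset.mul_sum]
        _ ≤ ε := by
          rw [div_mul_eq_mul_div, div_le_iff₀ (by positivity)]
          nlinarith
    set y := ι (∑ i, a i ⊗ₜ[ℂ] b i)
    have e : F x = F (x - y) + (F y - G y) - G (x - y) := by
      rw [map_sub, map_sub, hG0]; ring
    rw [e]
    have i1 := norm_sub_le (F (x - y) + (F y - G y)) (G (x - y))
    have i2 := norm_add_le (F (x - y)) (F y - G y)
    have i3 := F.le_opNorm (x - y)
    have i4 := hGb (x - y)
    have i5 : ‖F‖ * ‖x - y‖ ≤ ‖F‖ * ε := by gcongr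
    have i6 : C * ‖x - y‖ ≤ C * ε := by gcongr
    linarith
  have lim : Filter.Tendsto (fun ε : ℝ => (‖F‖ + C + 1) * ε) (nhdsWithin 0 (Set.Ioi 0)) (nhds ((‖F‖ + C + 1) * 0)) :=
    (Continuous.tendsto (by fun_prop) 0).mono_left nhdsWithin_le_nhds
  have := ge_of_tendsto lim (by filter_upwards [self_mem_nhdsWithin] with t ht using key t ht)
  rw [mul_zero] at this
  exact norm_le_zero_iff.1 this

end SliceMap

/-- **slice map theorem for ideals.** For C⋆-algebras `A`, `B` and a closed
two-sided ideal `J` of `B`, the product ideal `A ⊗̂ J` consists exactly of those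
`x ∈ A ⊗̂ B` with `R_φ(x) ∈ J` for every `φ ∈ A*`. -/
theorem slice_map_theorem_for_ideals {A B X : Type u} [NonUnitalCStarAlgebra A] [NonUnitalCStarAlgebra B]
    [NonUnitalNormedRing X] [StarRing X] [NormedSpace ℂ X] [CompleteSpace X]
    [IsScalarTower ℂ X X] [SMulCommClass ℂ X X]
    (NA : ∀ p : ℕ, Matrix (Fin p) (Fin p) A → ℝ)
    (NB : ∀ q : ℕ, Matrix (Fin q) (Fin q) B → ℝ)
    (hNA : ∀ p, IsCStarNorm (NA p)) (hNB : ∀ q, IsCStarNorm (NB q))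
    (ι : A ⊗[ℂ] B →ₗ[ℂ] X) (hX : IsTensorCompletion (osProjNorm NA NB) X ι)
    (J : TwoSidedIdeal B) (hJ : IsClosed (J : Set B))
    (R : (A →L[ℂ] ℂ) → X →L[ℂ] B)
    (hR : ∀ (φ : A →L[ℂ] ℂ) (a : A) (b : B), R φ (ι (a ⊗ₜ[ℂ] b)) = φ a • b) :
    tensorIdeal ι (Set.univ : Set A) (J : Set B) =
      {x : X | ∀ φ : A →L[ℂ] ℂ, R φ x ∈ J} := by
  apply Set.Subset.antisymm
  · have hcl : IsClosed {x : X | ∀ φ : A →L[ℂ] ℂ, R φ x ∈ J} := by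
      rw [Set.setOf_forall]
      exact isClosed_iInter fun φ => hJ.preimage (R φ).continuous
    refine closure_minimal ?_ hcl
    rintro _ ⟨u, hu, rfl⟩ φ
    change u ∈ Submodule.span ℂ _ at hu
    induction hu using Submodule.span_induction with
    | mem u hu =>
      obtain ⟨a, -, b, hb, rfl⟩ := hu
      rw [hR]
      exact SliceMap.ideal_smul_mem J hJ _ hb
    | zero => rw [map_zero, map_zero]; exact J.zero_mem
    | add u v _ _ hu hv => rw [map_add, map_add]; exact J.add_mem hu hv
    | smul c u _ hu => rw [map_smul, map_smul]; exact SliceMap.ideal_smul_mem J hJ _ hu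
  · intro x hx
    by_contra hxn
    let M : Submodule ℂ X := ((Submodule.span ℂ (Set.image2 (fun (a : A) (b : B) => a ⊗ₜ[ℂ] b) Set.univ (J : Set B))).map ι).topologicalClosure
    have hM : (M : Set X) = tensorIdeal ι (Set.univ : Set A) (J : Set B) := by
      simp only [M, tensorIdeal, Submodule.topologicalClosure_coe, Submodule.map_coe]
    obtain ⟨F, hF, hFx⟩ := SliceMap.hb_sep M (Submodule.isClosed_topologicalClosure _) x (fun h => hxn (hM ▸ h))
    refine hFx (SliceMap.vanish NA NB hNA hNB ι hX (J : Set B) R hR F ?_ x hx)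
    intro a b hb
    refine hF _ (Submodule.le_topologicalClosure _ ?_)
    exact Submodule.mem_map_of_mem (Submodule.subset_span ⟨a, trivial, b, hb, rfl⟩)

end
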